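/- Let D₁ ⊆ B(H₁) and D₂ ⊆ B(H₂) be masas on separable Hilbert spaces, let B₁, …, B_r ⊆ B(H₁,H₂) be masa-bimodules of finite width, let U, U₁, …, U_r ⊆ B(K₁,K₂) be weak* closed subspaces, and set W = B₁ ⊗̄ U₁ + ⋯ + B_r ⊗̄ U_r. Let (ψ_i)_{i∈ℕ} be a nested sequence of contractive Schur idempotents on B(H₁,H₂) (nested meaning ran ψ_{i+1} ⊆ ran ψ_i for all i). Then ∩_{i∈ℕ} cl(ran ψ_i ⊗̄ U + W) = cl((∩_{i∈ℕ} ran ψ_i) ⊗̄ U + W), where cl denotes weak* closure. -/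

import Mathlib

open scoped ComplexInnerProductSpace Pointwise
open Set MeasureTheory

noncomputable section

namespace OpSynth

/-! ### The σ-weak (weak*) topology on `B(H,K)` -/

/-- The σ-weak (weak*) topology on the space of bounded operators between Hilbert
spaces: the initial topology with respect to the functionals
`T ↦ ∑' n, ⟪η n, T (ξ n)⟫` associated to square-summable sequences `ξ`, `η`.
This is the weak* topology arising from the identification of `B(H,K)` with the
dual of the trace class operators. -/
def sigmaWeak (H K : Type*) [NormedAddCommGroup H] [InnerProductSpace ℂ H]
    [NormedAddCommGroup K] [InnerProductSpace ℂ K] :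
    TopologicalSpace (H →L[ℂ] K) :=
  ⨅ (ξ : ℕ → H) (η : ℕ → K) (_ : Summable fun n => ‖ξ n‖ ^ 2)
    (_ : Summable fun n => ‖η n‖ ^ 2),
    TopologicalSpace.induced
      (fun T : H →L[ℂ] K => ∑' n, ⟪η n, T (ξ n)⟫) inferInstance

section Basic

variable {H K H₁ H₂ H₃ K₁ K₂ T₁ T₂ : Type*}
  [NormedAddCommGroup H] [InnerProductSpace ℂ H]
  [NormedAddCommGroup K] [InnerProductSpace ℂ K]
  [NormedAddCommGroup H₁] [InnerProductSpace ℂ H₁]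
  [NormedAddCommGroup H₂] [InnerProductSpace ℂ H₂]
  [NormedAddCommGroup H₃] [InnerProductSpace ℂ H₃]
  [NormedAddCommGroup K₁] [InnerProductSpace ℂ K₁]
  [NormedAddCommGroup K₂] [InnerProductSpace ℂ K₂]
  [NormedAddCommGroup T₁] [InnerProductSpace ℂ T₁]
  [NormedAddCommGroup T₂] [InnerProductSpace ℂ T₂]

/-- A set of operators is weak* closed if it is closed in the σ-weak topology. -/
def WkClosed (S : Set (H →L[ℂ] K)) : Prop :=
  @IsClosed _ (sigmaWeak H K) S

/-- The weak* closure of a set of operators. -/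
def wkClosure (S : Set (H →L[ℂ] K)) : Set (H →L[ℂ] K) :=
  @closure _ (sigmaWeak H K) S

/-- A weak* closed (linear) subspace of `B(H,K)`. -/
def IsWkClosedSubspace (S : Set (H →L[ℂ] K)) : Prop :=
  (∃ M : Submodule ℂ (H →L[ℂ] K), (M : Set (H →L[ℂ] K)) = S) ∧ WkClosed S

/-- A map between operator spaces is weak* continuous if it is continuous with
respect to the σ-weak topologies. -/
def WkContinuous (φ : (H₁ →L[ℂ] H₂) → (K₁ →L[ℂ] K₂)) : Prop :=
  @Continuous _ _ (sigmaWeak H₁ H₂) (sigmaWeak K₁ K₂) φ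

/-- The norm of an `n × n` matrix of operators, viewed as an operator on the
column Hilbert space `ℓ²(Fin n, H)`: the supremum over the unit ball of the
ℓ²-norm of the image. -/
def blockNorm {n : ℕ} (M : Matrix (Fin n) (Fin n) (H →L[ℂ] K)) : ℝ :=
  sSup { r | ∃ v : Fin n → H, (∑ j, ‖v j‖ ^ 2) ≤ 1 ∧
    r = Real.sqrt (∑ i, ‖∑ j, M i j (v j)‖ ^ 2) }

/-- A map `φ : B(H₁,H₂) → B(K₁,K₂)` is completely bounded if its matrix
amplifications are uniformly bounded. -/
def CompletelyBounded (φ : (H₁ →L[ℂ] H₂) → (K₁ →L[ℂ] K₂)) : Prop :=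
  ∃ C : ℝ, 0 ≤ C ∧ ∀ (n : ℕ) (M : Matrix (Fin n) (Fin n) (H₁ →L[ℂ] H₂)),
    blockNorm (M.map φ) ≤ C * blockNorm M

/-- `t : H → K → T₁` realizes `T₁` as the Hilbertian tensor product `H ⊗ K`:
`t` is bilinear, multiplicative for inner products, and has total range. -/
def IsTensorEmbedding (t : H → K → T₁) : Prop :=
  (∀ x x' y, t (x + x') y = t x y + t x' y) ∧
  (∀ x y y', t x (y + y') = t x y + t x y') ∧
  (∀ (c : ℂ) x y, t (c • x) y = c • t x y) ∧
  (∀ (c : ℂ) x y, t x (c • y) = c • t x y) ∧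
  (∀ x x' y y', ⟪t x y, t x' y'⟫ = ⟪x, x'⟫ * ⟪y, y'⟫) ∧
  (Submodule.span ℂ { z | ∃ x y, z = t x y }).topologicalClosure = ⊤

/-- `W` is the elementary tensor `S ⊗ R` of the operators `S` and `R`, relative
to the tensor product realizations `t₁`, `t₂`. -/
def IsElemTensor (t₁ : H₁ → K₁ → T₁) (t₂ : H₂ → K₂ → T₂)
    (W : T₁ →L[ℂ] T₂) (S : H₁ →L[ℂ] H₂) (R : K₁ →L[ℂ] K₂) : Prop :=
  ∀ x y, W (t₁ x y) = t₂ (S x) (R y)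

/-- The weak* closed tensor product `V ⊗̄ U`: the weak* closed subspace generated
by the elementary tensors `S ⊗ R` with `S ∈ V`, `R ∈ U`. -/
def wTensor (t₁ : H₁ → K₁ → T₁) (t₂ : H₂ → K₂ → T₂)
    (V : Set (H₁ →L[ℂ] H₂)) (U : Set (K₁ →L[ℂ] K₂)) : Set (T₁ →L[ℂ] T₂) :=
  wkClosure ↑(Submodule.span ℂ
    { W : T₁ →L[ℂ] T₂ | ∃ S ∈ V, ∃ R ∈ U, IsElemTensor t₁ t₂ W S R })

/-- The Fubini product `F(V,U) = (V ⊗̄ B(K₁,K₂)) ∩ (B(H₁,H₂) ⊗̄ U)`. -/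
def Fubini (t₁ : H₁ → K₁ → T₁) (t₂ : H₂ → K₂ → T₂)
    (V : Set (H₁ →L[ℂ] H₂)) (U : Set (K₁ →L[ℂ] K₂)) : Set (T₁ →L[ℂ] T₂) :=
  wTensor t₁ t₂ V univ ∩ wTensor t₁ t₂ univ U

/-- Sum of finitely many subsets of an additive monoid. -/
def setSum {α : Type*} [AddCommMonoid α] {n : ℕ} (S : Fin n → Set α) : Set α :=
  { x | ∃ f : Fin n → α, (∀ i, f i ∈ S i) ∧ x = ∑ i, f i }

/-- The reflexive hull `Ref W = {T : Tx ∈ closure (W x) for all x}`. -/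
def RefHull (W : Set (H →L[ℂ] K)) : Set (H →L[ℂ] K) :=
  { T | ∀ x : H, T x ∈ closure ((fun S : H →L[ℂ] K => S x) '' W) }

end Basic

/-- Property `S_σ`: `F(V,U) = V ⊗̄ U` for every weak* closed subspace `U` of
`B(K₁,K₂)`, all Hilbert spaces `K₁`, `K₂`, and all realizations of the
corresponding Hilbertian tensor products. -/
def HasSsigma {H₁ H₂ : Type*}
    [NormedAddCommGroup H₁] [InnerProductSpace ℂ H₁]
    [NormedAddCommGroup H₂] [InnerProductSpace ℂ H₂]
    (V : Set (H₁ →L[ℂ] H₂)) : Prop :=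
  ∀ (K₁ K₂ T₁ T₂ : Type)
    [NormedAddCommGroup K₁] [InnerProductSpace ℂ K₁] [CompleteSpace K₁]
    [NormedAddCommGroup K₂] [InnerProductSpace ℂ K₂] [CompleteSpace K₂]
    [NormedAddCommGroup T₁] [InnerProductSpace ℂ T₁] [CompleteSpace T₁]
    [NormedAddCommGroup T₂] [InnerProductSpace ℂ T₂] [CompleteSpace T₂]
    (t₁ : H₁ → K₁ → T₁) (t₂ : H₂ → K₂ → T₂),
    IsTensorEmbedding t₁ → IsTensorEmbedding t₂ →
    ∀ U : Set (K₁ →L[ℂ] K₂), IsWkClosedSubspace U →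
      Fubini t₁ t₂ V U = wTensor t₁ t₂ V U

section Masa

variable {H H₁ H₂ H₃ : Type*}
  [NormedAddCommGroup H] [InnerProductSpace ℂ H] [CompleteSpace H]
  [NormedAddCommGroup H₁] [InnerProductSpace ℂ H₁] [CompleteSpace H₁]
  [NormedAddCommGroup H₂] [InnerProductSpace ℂ H₂] [CompleteSpace H₂]
  [NormedAddCommGroup H₃] [InnerProductSpace ℂ H₃] [CompleteSpace H₃]

/-- A masa: a maximal abelian selfadjoint subalgebra of `B(H)`. -/
def IsMasa (D : StarSubalgebra ℂ (H →L[ℂ] H)) : Prop :=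
  (∀ a ∈ D, ∀ b ∈ D, a * b = b * a) ∧
  ∀ E : StarSubalgebra ℂ (H →L[ℂ] H),
    (∀ a ∈ E, ∀ b ∈ E, a * b = b * a) → D ≤ E → E = D

/-- A (weak* closed) `D₂,D₁`-masa-bimodule. -/
def IsMasaBimodule (D₁ : StarSubalgebra ℂ (H₁ →L[ℂ] H₁))
    (D₂ : StarSubalgebra ℂ (H₂ →L[ℂ] H₂)) (V : Set (H₁ →L[ℂ] H₂)) : Prop :=
  IsWkClosedSubspace V ∧
  ∀ X ∈ V, ∀ A ∈ D₁, ∀ B ∈ D₂, B ∘L X ∘L A ∈ V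

/-- A ternary set of operators: closed under the triple product `T S* R`. -/
def IsTernary (M : Set (H₁ →L[ℂ] H₂)) : Prop :=
  ∀ T ∈ M, ∀ S ∈ M, ∀ R ∈ M, T ∘L (ContinuousLinearMap.adjoint S) ∘L R ∈ M

/-- An orthogonal projection. -/
def IsProj (p : H →L[ℂ] H) : Prop := p ∘L p = p ∧ IsSelfAdjoint p

/-- A minimal non-zero projection of a masa. -/
def IsMinimalProjOf (D : StarSubalgebra ℂ (H →L[ℂ] H)) (p : H →L[ℂ] H) : Prop :=
  p ∈ D ∧ IsProj p ∧ p ≠ 0 ∧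
    ∀ q ∈ D, IsProj q → p ∘L q = q → q = 0 ∨ q = p

/-- A projection in a masa is non-atomic if it dominates no minimal non-zero
projection of the masa. -/
def IsNonAtomicProj (D : StarSubalgebra ℂ (H →L[ℂ] H)) (E : H →L[ℂ] H) : Prop :=
  ∀ p, IsMinimalProjOf D p → ¬ (E ∘L p = p)

/-- A `D₂,D₁`-masa-bimodule map. -/
def IsMasaBimoduleMap (D₁ : StarSubalgebra ℂ (H₁ →L[ℂ] H₁))
    (D₂ : StarSubalgebra ℂ (H₂ →L[ℂ] H₂))
    (φ : (H₁ →L[ℂ] H₂) → (H₁ →L[ℂ] H₂)) : Prop :=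
  ∀ (X : H₁ →L[ℂ] H₂), ∀ A ∈ D₁, ∀ B ∈ D₂,
    φ (B ∘L X ∘L A) = B ∘L (φ X) ∘L A

/-- A Schur idempotent: a weak* continuous completely bounded idempotent
masa-bimodule map. -/
def IsSchurIdempotent (D₁ : StarSubalgebra ℂ (H₁ →L[ℂ] H₁))
    (D₂ : StarSubalgebra ℂ (H₂ →L[ℂ] H₂))
    (φ : (H₁ →L[ℂ] H₂) → (H₁ →L[ℂ] H₂)) : Prop :=
  IsLinearMap ℂ φ ∧ WkContinuous φ ∧ CompletelyBounded φ ∧ φ ∘ φ = φ ∧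
    IsMasaBimoduleMap D₁ D₂ φ

/-- A nest: a totally ordered family of closed subspaces containing the
intersection and the closed linear span of any of its subsets. -/
def IsNest (N : Set (Submodule ℂ H)) : Prop :=
  (∀ p ∈ N, IsClosed (p : Set H)) ∧ IsChain (· ≤ ·) N ∧
  ∀ S : Set (Submodule ℂ H), S ⊆ N →
    sInf S ∈ N ∧ (sSup S).topologicalClosure ∈ N

/-- The nest algebra of a nest: all operators leaving each subspace invariant. -/
def nestAlg (N : Set (Submodule ℂ H)) : Set (H →L[ℂ] H) :=
  { T | ∀ p ∈ N, ∀ x ∈ p, T x ∈ p }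

/-- A (weak* closed) nest algebra bimodule. -/
def IsNestBimodule (V : Set (H₁ →L[ℂ] H₂)) : Prop :=
  IsWkClosedSubspace V ∧
  ∃ (N₁ : Set (Submodule ℂ H₁)) (N₂ : Set (Submodule ℂ H₂)),
    IsNest N₁ ∧ IsNest N₂ ∧
    ∀ X ∈ V, ∀ A ∈ nestAlg N₁, ∀ B ∈ nestAlg N₂, B ∘L X ∘L A ∈ V

/-- A masa-bimodule of finite width: a finite intersection of masa-bimodules
each of which is a nest algebra bimodule. -/
def HasFiniteWidth (D₁ : StarSubalgebra ℂ (H₁ →L[ℂ] H₁))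
    (D₂ : StarSubalgebra ℂ (H₂ →L[ℂ] H₂)) (V : Set (H₁ →L[ℂ] H₂)) : Prop :=
  ∃ (k : ℕ) (Vs : Fin k → Set (H₁ →L[ℂ] H₂)),
    (∀ j, IsMasaBimodule D₁ D₂ (Vs j) ∧ IsNestBimodule (Vs j)) ∧
    V = ⋂ j, Vs j

end Masa

section Algebras

variable {H H₁ H₂ H₃ K : Type*}
  [NormedAddCommGroup H] [InnerProductSpace ℂ H] [CompleteSpace H]
  [NormedAddCommGroup H₁] [InnerProductSpace ℂ H₁] [CompleteSpace H₁]
  [NormedAddCommGroup H₂] [InnerProductSpace ℂ H₂] [CompleteSpace H₂]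
  [NormedAddCommGroup H₃] [InnerProductSpace ℂ H₃] [CompleteSpace H₃]

/-- A weak* closed unital operator algebra in `B(H)`. -/
def IsWkClosedUnitalAlg (A : Set (H →L[ℂ] H)) : Prop :=
  IsWkClosedSubspace A ∧ (1 : H →L[ℂ] H) ∈ A ∧ ∀ a ∈ A, ∀ b ∈ A, a ∘L b ∈ A

/-- `[X Y]`: the weak* closed linear span of the products `x ∘ y`. -/
def mulSpan (X : Set (H₂ →L[ℂ] H₃)) (Y : Set (H₁ →L[ℂ] H₂)) :
    Set (H₁ →L[ℂ] H₃) :=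
  wkClosure ↑(Submodule.span ℂ { T : H₁ →L[ℂ] H₃ | ∃ x ∈ X, ∃ y ∈ Y, T = x ∘L y })

/-- The data witnessing a spatial embedding of `A` into `B`. -/
def SpatialPair (A : Set (H₁ →L[ℂ] H₁)) (B : Set (H₂ →L[ℂ] H₂))
    (X : Set (H₁ →L[ℂ] H₂)) (Y : Set (H₂ →L[ℂ] H₁)) : Prop :=
  IsWkClosedSubspace X ∧ IsWkClosedSubspace Y ∧
  (∀ x ∈ X, ∀ b ∈ B, ∀ a ∈ A, b ∘L x ∘L a ∈ X) ∧
  (∀ y ∈ Y, ∀ a ∈ A, ∀ b ∈ B, a ∘L y ∘L b ∈ Y) ∧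
  mulSpan X Y ⊆ B ∧ mulSpan Y X = A

/-- `A` is spatially embedded in `B`. -/
def SpatiallyEmbedded (A : Set (H₁ →L[ℂ] H₁)) (B : Set (H₂ →L[ℂ] H₂)) : Prop :=
  ∃ X Y, SpatialPair A B X Y

/-- `A` and `B` are spatially Morita equivalent. -/
def SpatiallyMorita (A : Set (H₁ →L[ℂ] H₁)) (B : Set (H₂ →L[ℂ] H₂)) : Prop :=
  ∃ X Y, SpatialPair A B X Y ∧ mulSpan X Y = B

/-- The strong operator topology on `B(H,K)`. -/
def sot (H K : Type*) [NormedAddCommGroup H] [InnerProductSpace ℂ H]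
    [NormedAddCommGroup K] [InnerProductSpace ℂ K] :
    TopologicalSpace (H →L[ℂ] K) :=
  TopologicalSpace.induced (fun T : H →L[ℂ] K => (T : H → K)) Pi.topologicalSpace

/-- A commutative subspace lattice (CSL): a strongly closed lattice of mutually
commuting orthogonal projections containing `0` and `1`. -/
def IsCSL (L : Set (H →L[ℂ] H)) : Prop :=
  (∀ P ∈ L, IsProj P) ∧
  (∀ P ∈ L, ∀ Q ∈ L, P ∘L Q = Q ∘L P) ∧
  (0 : H →L[ℂ] H) ∈ L ∧ (1 : H →L[ℂ] H) ∈ L ∧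
  (∀ P ∈ L, ∀ Q ∈ L, P ∘L Q ∈ L ∧ P + Q - P ∘L Q ∈ L) ∧
  @IsClosed _ (sot H H) L

/-- The CSL algebra `Alg L = {T : (1 - P) T P = 0 for all P ∈ L}`. -/
def cslAlg (L : Set (H →L[ℂ] H)) : Set (H →L[ℂ] H) :=
  { T | ∀ P ∈ L, (1 - P) ∘L T ∘L P = 0 }

/-- A lattice homomorphism between CSLs (preserving meets and joins). -/
def IsLatticeHom (L₁ : Set (H₁ →L[ℂ] H₁)) (L₂ : Set (H₂ →L[ℂ] H₂))
    (φ : (H₁ →L[ℂ] H₁) → (H₂ →L[ℂ] H₂)) : Prop :=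
  MapsTo φ L₁ L₂ ∧
  (∀ P ∈ L₁, ∀ Q ∈ L₁, φ (P ∘L Q) = φ P ∘L φ Q) ∧
  (∀ P ∈ L₁, ∀ Q ∈ L₁, φ (P + Q - P ∘L Q) = φ P + φ Q - φ P ∘L φ Q)

end Algebras

section MeasurePart

variable {X X₁ X₂ : Type*} [MeasurableSpace X] [MeasurableSpace X₁] [MeasurableSpace X₂]

/-- A subset of a product of measure spaces is marginally null if it is
contained in `(M₁ × X₂) ∪ (X₁ × M₂)` with `μ₁ M₁ = μ₂ M₂ = 0`. -/
def MargNull (μ₁ : Measure X₁) (μ₂ : Measure X₂) (E : Set (X₁ × X₂)) : Prop :=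
  ∃ (M₁ : Set X₁) (M₂ : Set X₂), MeasurableSet M₁ ∧ MeasurableSet M₂ ∧
    μ₁ M₁ = 0 ∧ μ₂ M₂ = 0 ∧
    E ⊆ (M₁ ×ˢ (univ : Set X₂)) ∪ ((univ : Set X₁) ×ˢ M₂)

/-- Marginal equivalence: the symmetric difference is marginally null. -/
def MargEquiv (μ₁ : Measure X₁) (μ₂ : Measure X₂) (E F : Set (X₁ × X₂)) : Prop :=
  MargNull μ₁ μ₂ ((E \ F) ∪ (F \ E))

/-- ω-open sets: marginally equivalent to a countable union of measurable
rectangles. -/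
def OmegaOpen (μ₁ : Measure X₁) (μ₂ : Measure X₂) (E : Set (X₁ × X₂)) : Prop :=
  ∃ (α : ℕ → Set X₁) (β : ℕ → Set X₂),
    (∀ n, MeasurableSet (α n)) ∧ (∀ n, MeasurableSet (β n)) ∧
    MargEquiv μ₁ μ₂ E (⋃ n, (α n) ×ˢ (β n))

/-- ω-closed sets: complements of ω-open sets. -/
def OmegaClosed (μ₁ : Measure X₁) (μ₂ : Measure X₂) (E : Set (X₁ × X₂)) : Prop :=
  OmegaOpen μ₁ μ₂ Eᶜ

/-- `A` is a multiplication operator on `L²(X,μ)`: `A f = φ · f` for some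
essentially bounded function `φ`.  The collection `{A | IsMultOp μ A}` is the
multiplication masa of `L^∞(X,μ)`. -/
def IsMultOp (μ : Measure X) (A : Lp ℂ 2 μ →L[ℂ] Lp ℂ 2 μ) : Prop :=
  ∃ φ : X → ℂ, AEStronglyMeasurable φ μ ∧ (∃ C, ∀ᵐ x ∂μ, ‖φ x‖ ≤ C) ∧
    ∀ f : Lp ℂ 2 μ, ⇑(A f) =ᵐ[μ] fun x => φ x * f x

/-- A (weak* closed) masa-bimodule over the multiplication masas. -/
def IsMultBimodule (μ₁ : Measure X₁) (μ₂ : Measure X₂)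
    (V : Set (Lp ℂ 2 μ₁ →L[ℂ] Lp ℂ 2 μ₂)) : Prop :=
  IsWkClosedSubspace V ∧
  ∀ X ∈ V, ∀ (A : Lp ℂ 2 μ₁ →L[ℂ] Lp ℂ 2 μ₁) (B : Lp ℂ 2 μ₂ →L[ℂ] Lp ℂ 2 μ₂),
    IsMultOp μ₁ A → IsMultOp μ₂ B → B ∘L X ∘L A ∈ V

/-- `T` is supported on `κ`: `M_{χ_β} T M_{χ_α} = 0` (equivalently,
`⟪T f, g⟫ = 0` whenever `f` vanishes off `α` and `g` vanishes off `β`)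
whenever the rectangle `α × β` intersects `κ` marginally nullly. -/
def SupportedOn (μ₁ : Measure X₁) (μ₂ : Measure X₂) (κ : Set (X₁ × X₂))
    (T : Lp ℂ 2 μ₁ →L[ℂ] Lp ℂ 2 μ₂) : Prop :=
  ∀ (α : Set X₁) (β : Set X₂), MeasurableSet α → MeasurableSet β →
    MargNull μ₁ μ₂ ((α ×ˢ β) ∩ κ) →
    ∀ (f : Lp ℂ 2 μ₁) (g : Lp ℂ 2 μ₂),
      (∀ᵐ x ∂μ₁, x ∉ α → f x = 0) → (∀ᵐ y ∂μ₂, y ∉ β → g y = 0) →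
      ⟪T f, g⟫ = (0 : ℂ)

/-- `M_max κ`: the space of all operators supported on `κ` — the largest
masa-bimodule with support `κ`. -/
def Mmax (μ₁ : Measure X₁) (μ₂ : Measure X₂) (κ : Set (X₁ × X₂)) :
    Set (Lp ℂ 2 μ₁ →L[ℂ] Lp ℂ 2 μ₂) :=
  { T | SupportedOn μ₁ μ₂ κ T }

/-- `U` has support `κ`: `κ` is ω-closed and `Ref U = M_max κ`. -/
def HasSupport (μ₁ : Measure X₁) (μ₂ : Measure X₂)
    (U : Set (Lp ℂ 2 μ₁ →L[ℂ] Lp ℂ 2 μ₂)) (κ : Set (X₁ × X₂)) : Prop :=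
  OmegaClosed μ₁ μ₂ κ ∧ RefHull U = Mmax μ₁ μ₂ κ

/-- `M_min κ`: the smallest weak* closed masa-bimodule with support `κ`,
realized as the intersection of all weak* closed masa-bimodules with support `κ`. -/
def Mmin (μ₁ : Measure X₁) (μ₂ : Measure X₂) (κ : Set (X₁ × X₂)) :
    Set (Lp ℂ 2 μ₁ →L[ℂ] Lp ℂ 2 μ₂) :=
  ⋂₀ { U | IsMultBimodule μ₁ μ₂ U ∧ HasSupport μ₁ μ₂ U κ }

/-- `κ` is operator synthetic if it is ω-closed and `M_min κ = M_max κ`. -/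
def OperatorSynthetic (μ₁ : Measure X₁) (μ₂ : Measure X₂)
    (κ : Set (X₁ × X₂)) : Prop :=
  OmegaClosed μ₁ μ₂ κ ∧ Mmin μ₁ μ₂ κ = Mmax μ₁ μ₂ κ

/-- A masa-bimodule of finite width over the multiplication masas. -/
def MultFiniteWidth (μ₁ : Measure X₁) (μ₂ : Measure X₂)
    (V : Set (Lp ℂ 2 μ₁ →L[ℂ] Lp ℂ 2 μ₂)) : Prop :=
  ∃ (k : ℕ) (Vs : Fin k → Set (Lp ℂ 2 μ₁ →L[ℂ] Lp ℂ 2 μ₂)),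
    (∀ j, IsMultBimodule μ₁ μ₂ (Vs j) ∧ IsNestBimodule (Vs j)) ∧
    V = ⋂ j, Vs j

/-- A set of finite width: the support of a masa-bimodule of finite width. -/
def FiniteWidthSet (μ₁ : Measure X₁) (μ₂ : Measure X₂)
    (κ : Set (X₁ × X₂)) : Prop :=
  ∃ V, MultFiniteWidth μ₁ μ₂ V ∧ HasSupport μ₁ μ₂ V κ

end MeasurePart

/-- The flip `ρ : (X₁ × X₂) × (Y₁ × Y₂) → (X₁ × Y₁) × (X₂ × Y₂)`. -/
def flipProd {X₁ X₂ Y₁ Y₂ : Type*} :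
    (X₁ × X₂) × (Y₁ × Y₂) → (X₁ × Y₁) × (X₂ × Y₂) :=
  fun q => ((q.1.1, q.2.1), (q.1.2, q.2.2))

end OpSynth



open scoped ComplexInnerProductSpace Pointwise
open Set OpSynth

set_option autoImplicit false
set_option linter.all false

namespace OpSynth
open Filter Topology ContinuousLinearMap

section Core
variable {H K G : Type*}
  [NormedAddCommGroup H] [InnerProductSpace ℂ H]
  [NormedAddCommGroup K] [InnerProductSpace ℂ K]
  [NormedAddCommGroup G] [InnerProductSpace ℂ G]

/-- square-summable sequences -/
abbrev L2 (H : Type*) [NormedAddCommGroup H] := lp (fun _ : ℕ => H) 2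

/-- amplification -/
def Amp (X : H →L[ℂ] K) : L2 H →L[ℂ] L2 K :=
  lp.mapCLM 2 (fun _ => X) (norm_nonneg X) (fun _ => le_rfl)

@[simp] lemma Amp_apply (X : H →L[ℂ] K) (ξ : L2 H) (n : ℕ) : Amp X ξ n = X (ξ n) := rfl

lemma Amp_norm_le (X : H →L[ℂ] K) : ‖Amp X‖ ≤ ‖X‖ := lp.norm_mapCLM_le 2 _ _ _

lemma Amp_add (X Y : H →L[ℂ] K) : Amp (X + Y) = Amp X + Amp Y := by ext; rfl
lemma Amp_smul (c : ℂ) (X : H →L[ℂ] K) : Amp (c • X) = c • Amp X := by ext; rfl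
lemma Amp_comp (X : K →L[ℂ] G) (Y : H →L[ℂ] K) : Amp (X ∘L Y) = Amp X ∘L Amp Y := by ext; rfl
lemma Amp_comp_apply (X : K →L[ℂ] G) (Y : H →L[ℂ] K) (ξ : L2 H) :
    Amp (X ∘L Y) ξ = Amp X (Amp Y ξ) := rfl
lemma Amp_mul_apply (X Y : H →L[ℂ] H) (ξ : L2 H) :
    Amp (X * Y) ξ = Amp X (Amp Y ξ) := rfl
lemma Amp_one (ξ : L2 H) : Amp (1 : H →L[ℂ] H) ξ = ξ := rfl

/-- The elementary normal functional. -/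
def om (ξ : L2 H) (η : L2 K) : (H →L[ℂ] K) →ₗ[ℂ] ℂ where
  toFun X := ⟪η, Amp X ξ⟫
  map_add' X Y := by rw [Amp_add, add_apply, inner_add_right]
  map_smul' c X := by rw [Amp_smul, smul_apply, inner_smul_right]; rfl

lemma om_apply (ξ : L2 H) (η : L2 K) (X : H →L[ℂ] K) : om ξ η X = ⟪η, Amp X ξ⟫ := rfl

lemma om_tsum (ξ : L2 H) (η : L2 K) (X : H →L[ℂ] K) : om ξ η X = ∑' n, ⟪η n, X (ξ n)⟫ := by
  rw [om_apply, lp.inner_eq_tsum]; rfl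

lemma L2_summable (ξ : L2 H) : Summable fun n => ‖ξ n‖ ^ 2 := by
  have := (lp.memℓp ξ).summable (by norm_num)
  simpa using this

/-- make an element of L2 -/
def mkL2 (ξ : ℕ → H) (h : Summable fun n => ‖ξ n‖ ^ 2) : L2 H :=
  ⟨ξ, by
    refine (memℓp_gen_iff (by norm_num)).2 ?_
    simpa using h⟩

@[simp] lemma mkL2_apply (ξ : ℕ → H) (h) (n : ℕ) : mkL2 ξ h n = ξ n := rfl

lemma summable_join {ξ ξ' : ℕ → H} (h : Summable fun n => ‖ξ n‖ ^ 2)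
    (h' : Summable fun n => ‖ξ' n‖ ^ 2) : Summable fun n =>
    ‖Sum.elim ξ ξ' (Equiv.natSumNatEquivNat.symm n)‖ ^ 2 := by
  refine (Equiv.summable_iff Equiv.natSumNatEquivNat.symm
    (f := fun s : ℕ ⊕ ℕ => ‖(Sum.elim ξ ξ' s : H)‖ ^ 2)).2 ?_
  exact (HasSum.sum (f := fun s : ℕ ⊕ ℕ => ‖(Sum.elim ξ ξ' s : H)‖ ^ 2) h.hasSum h'.hasSum).summable

/-- interleaving -/
def joinL2 (ξ ξ' : L2 H) : L2 H := mkL2 _ (summable_join (L2_summable ξ) (L2_summable ξ'))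

lemma om_join (ξ ξ' : L2 H) (η η' : L2 K) :
    om (joinL2 ξ ξ') (joinL2 η η') = om ξ η + om ξ' η' := by
  ext X
  rw [LinearMap.add_apply, om_tsum, om_apply, om_apply]
  let f : ℕ ⊕ ℕ → ℂ := fun s => ⟪(Sum.elim (fun n => η n) (fun n => η' n) s : K),
    X (Sum.elim (fun n => ξ n) (fun n => ξ' n) s)⟫
  change ∑' n, f (Equiv.natSumNatEquivNat.symm n) = _
  rw [Equiv.tsum_eq Equiv.natSumNatEquivNat.symm f]
  exact (HasSum.sum (f := f) (lp.hasSum_inner η (Amp X ξ)) (lp.hasSum_inner η' (Amp X ξ'))).tsum_eq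

/-- The space of normal functionals. -/
def Pre (H K : Type*) [NormedAddCommGroup H] [InnerProductSpace ℂ H]
  [NormedAddCommGroup K] [InnerProductSpace ℂ K] : Submodule ℂ ((H →L[ℂ] K) →ₗ[ℂ] ℂ) where
  carrier := {f | ∃ ξ η, f = om ξ η}
  add_mem' := by
    rintro _ _ ⟨ξ, η, rfl⟩ ⟨ξ', η', rfl⟩
    exact ⟨_, _, (om_join ξ ξ' η η').symm⟩
  zero_mem' := ⟨0, 0, by ext; simp [om_apply]⟩
  smul_mem' := by
    rintro c _ ⟨ξ, η, rfl⟩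
    refine ⟨c • ξ, η, ?_⟩
    ext X
    simp [om_apply, inner_smul_right]

lemma sigmaWeak_eq : sigmaWeak H K =
    TopologicalSpace.induced (fun (X : H →L[ℂ] K) (f : Pre H K) => f.1 X) Pi.topologicalSpace := by
  apply le_antisymm
  · rw [← continuous_iff_le_induced]
    refine @continuous_pi _ _ _ (sigmaWeak H K) _ _ ?_
    rintro ⟨_, ξ, η, rfl⟩
    rw [continuous_iff_le_induced]
    refine (iInf_le_of_le (ξ : ℕ → H) (iInf_le_of_le (η : ℕ → K)
      (iInf_le_of_le (L2_summable ξ) (iInf_le_of_le (L2_summable η) ?_))))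
    simp_rw [om_tsum]
    exact le_rfl
  · refine le_iInf fun ξ => le_iInf fun η => le_iInf fun h1 => le_iInf fun h2 => ?_
    rw [← continuous_iff_le_induced]
    have : (fun T : H →L[ℂ] K => ∑' n, ⟪η n, T (ξ n)⟫) =
      (fun g : Pre H K → ℂ => g ⟨om (mkL2 ξ h1) (mkL2 η h2), _, _, rfl⟩) ∘
        (fun (X : H →L[ℂ] K) (f : Pre H K) => f.1 X) := by
      ext T
      simp only [Function.comp]
      rw [om_tsum]; rfl
    rw [this]
    exact @Continuous.comp _ _ _ (_) _ _ _ _ (continuous_apply _) continuous_induced_dom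

lemma mem_wkClosure_iff (M : Submodule ℂ (H →L[ℂ] K)) (X : H →L[ℂ] K) :
    X ∈ wkClosure (M : Set (H →L[ℂ] K)) ↔
      ∀ ξ η, (∀ Y ∈ M, om ξ η Y = 0) → om ξ η X = 0 := by
  unfold wkClosure
  rw [sigmaWeak_eq, closure_induced]
  constructor
  · intro h ξ η hM
    let F : Pre H K := ⟨om ξ η, _, _, rfl⟩
    have hc : IsClosed {g : Pre H K → ℂ | g F = 0} := isClosed_eq (continuous_apply _) continuous_const
    have := closure_minimal (t := {g : Pre H K → ℂ | g F = 0}) ?_ hc h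
    · exact this
    · rintro _ ⟨Y, hY, rfl⟩; exact hM Y hY
  · intro h
    rw [mem_closure_iff]
    intro o ho hXo
    obtain ⟨I, u, hu, hsub⟩ := isOpen_pi_iff.1 ho _ hXo
    classical
    let F : (H →L[ℂ] K) →ₗ[ℂ] (I → ℂ) := LinearMap.pi fun f => f.1.1
    have : F X ∈ M.map F := by
      by_contra hn
      obtain ⟨g, hg, hgM⟩ := Submodule.exists_le_ker_of_notMem hn
      have hP : g ∘ₗ F ∈ Pre H K := by
        have : g ∘ₗ F = ∑ i : I, g (Pi.single i 1) • (i.1.1) := by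
          ext Y
          simp only [LinearMap.comp_apply, LinearMap.sum_apply, LinearMap.smul_apply]
          conv_lhs => rw [LinearMap.pi_apply_eq_sum_univ g (F Y)]
          refine Finset.sum_congr rfl fun i _ => ?_
          rw [smul_eq_mul, smul_eq_mul, mul_comm]
          congr 2
          ext j; simp [Pi.single_apply, eq_comm]
        rw [this]
        exact Submodule.sum_mem _ fun i _ => Submodule.smul_mem _ _ i.1.2
      obtain ⟨ξ, η, e⟩ := hP
      apply hg
      have := h ξ η (fun Y hY => by
        rw [← e]; exact hgM (Submodule.mem_map_of_mem hY))
      rw [← e] at this; exact this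
    obtain ⟨Y, hY, e⟩ := this
    refine ⟨_, hsub ?_, ⟨Y, hY, rfl⟩⟩
    intro f hf
    have := congrFun e ⟨f, hf⟩
    change f.1 Y = f.1 X at this
    change f.1 Y ∈ u f
    rw [this]; exact (hu f hf).2

/-- weak* closed span, defined by bipolarity -/
def wkSpan (S : Set (H →L[ℂ] K)) : Submodule ℂ (H →L[ℂ] K) where
  carrier := {X | ∀ ξ η, (∀ Y ∈ S, om ξ η Y = 0) → om ξ η X = 0}
  add_mem' := fun h h' ξ η k => by rw [map_add, h ξ η k, h' ξ η k, add_zero]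
  zero_mem' := fun ξ η _ => map_zero _
  smul_mem' := fun c X h ξ η k => by rw [map_smul, h ξ η k, smul_zero]

lemma mem_wkSpan {S : Set (H →L[ℂ] K)} {X : H →L[ℂ] K} :
    X ∈ wkSpan S ↔ ∀ ξ η, (∀ Y ∈ S, om ξ η Y = 0) → om ξ η X = 0 := Iff.rfl

lemma subset_wkSpan (S : Set (H →L[ℂ] K)) : S ⊆ wkSpan S := fun X h _ _ k => k X h

lemma wkSpan_le {S T : Set (H →L[ℂ] K)} (h : S ⊆ wkSpan T) : wkSpan S ≤ wkSpan T :=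
  fun _ hX ξ η k => hX ξ η fun Y hY => h hY ξ η k

lemma wkSpan_mono {S T : Set (H →L[ℂ] K)} (h : S ⊆ T) : wkSpan S ≤ wkSpan T :=
  wkSpan_le (h.trans (subset_wkSpan T))

lemma wkClosure_submodule (M : Submodule ℂ (H →L[ℂ] K)) :
    wkClosure (M : Set (H →L[ℂ] K)) = wkSpan (M : Set (H →L[ℂ] K)) := by
  ext X; exact mem_wkClosure_iff M X

lemma wkSpan_span (S : Set (H →L[ℂ] K)) :
    wkSpan (Submodule.span ℂ S : Set (H →L[ℂ] K)) = wkSpan S := by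
  apply le_antisymm
  · apply wkSpan_le
    exact fun x hx => (Submodule.span_le (p := wkSpan S)).2 (subset_wkSpan S) hx
  · exact wkSpan_mono Submodule.subset_span

lemma wkClosure_span (S : Set (H →L[ℂ] K)) :
    wkClosure (Submodule.span ℂ S : Set (H →L[ℂ] K)) = wkSpan S := by
  rw [wkClosure_submodule, wkSpan_span]

lemma isWk_iff {S : Set (H →L[ℂ] K)} (h : IsWkClosedSubspace S) : (wkSpan S : Set _) = S := by
  obtain ⟨⟨M, rfl⟩, hc⟩ := h
  rw [← wkClosure_submodule]
  exact @IsClosed.closure_eq _ (sigmaWeak H K) _ hc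

lemma setSum_wkSpan {r : ℕ} (S : Set (H →L[ℂ] K)) (T : Fin r → Set (H →L[ℂ] K)) :
    wkClosure ((wkSpan S : Set (H →L[ℂ] K)) + setSum fun j => (wkSpan (T j) : Set (H →L[ℂ] K)))
      = wkSpan (S ∪ ⋃ j, T j) := by
  have e : ((wkSpan S : Set (H →L[ℂ] K)) + setSum fun j => (wkSpan (T j) : Set (H →L[ℂ] K)))
    = ((wkSpan S ⊔ ⨆ j, wkSpan (T j) : Submodule ℂ (H →L[ℂ] K)) : Set (H →L[ℂ] K)) := by
    rw [Submodule.coe_sup]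
    congr 1
    ext x
    rw [SetLike.mem_coe, Submodule.mem_iSup_iff_exists_finsupp]
    constructor
    · rintro ⟨f, hf, rfl⟩
      refine ⟨Finsupp.equivFunOnFinite.symm f, hf, ?_⟩
      rw [Finsupp.sum_fintype _ _ (fun _ => rfl)]; rfl
    · rintro ⟨f, hf, rfl⟩
      refine ⟨f, hf, ?_⟩
      rw [Finsupp.sum_fintype _ _ (fun _ => rfl)]
  rw [e, wkClosure_submodule]
  congr 1
  apply le_antisymm
  · apply wkSpan_le
    have : wkSpan S ⊔ ⨆ j, wkSpan (T j) ≤ wkSpan (S ∪ ⋃ j, T j) :=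
      sup_le (wkSpan_mono subset_union_left) (iSup_le fun j => wkSpan_mono
        ((subset_iUnion T j).trans subset_union_right))
    exact this
  · apply wkSpan_mono
    apply union_subset
    · exact (subset_wkSpan S).trans (le_sup_left (a := wkSpan S) (b := ⨆ j, wkSpan (T j)))
    · refine iUnion_subset fun j => (subset_wkSpan (T j)).trans ?_
      exact (le_iSup (fun j => wkSpan (T j)) j).trans (le_sup_right)

lemma pre_of_cont (f : (H →L[ℂ] K) →ₗ[ℂ] ℂ) (hf : @Continuous _ _ (sigmaWeak H K) _ f) :
    f ∈ Pre H K := by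
  rw [sigmaWeak_eq] at hf
  have ho := @IsOpen.preimage _ _ (_) _ _ hf _ (Metric.isOpen_ball (x := (0:ℂ)) (ε := 1))
  rw [isOpen_induced_iff] at ho
  obtain ⟨t, ht, e⟩ := ho
  have h0 : (fun f : Pre H K => f.1 (0 : H →L[ℂ] K)) ∈ t := by
    have : (0 : H →L[ℂ] K) ∈ f ⁻¹' Metric.ball (0:ℂ) 1 := by simp
    rw [← e] at this; exact this
  obtain ⟨I, u, hu, hsub⟩ := isOpen_pi_iff.1 ht _ h0
  have key : ⨅ i : I, LinearMap.ker i.1.1 ≤ LinearMap.ker f := by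
    intro X hX
    rw [Submodule.mem_iInf] at hX
    rw [LinearMap.mem_ker]
    by_contra hne
    have : ((f X)⁻¹ • X) ∈ f ⁻¹' Metric.ball (0:ℂ) 1 := by
      rw [← e]
      apply hsub
      intro g hg
      have h1 : g.1 X = 0 := hX ⟨g, hg⟩
      have h2 := (hu g hg).2
      simp only [map_zero] at h2
      simp only [map_smul, h1, smul_zero]
      exact h2
    simp [hne] at this
  have h3 := mem_span_of_iInf_ker_le_ker key
  refine Submodule.span_le.2 ?_ h3
  rintro _ ⟨i, rfl⟩
  exact i.1.2

lemma pre_comp_wk {H' K' : Type*} [NormedAddCommGroup H'] [InnerProductSpace ℂ H']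
    [NormedAddCommGroup K'] [InnerProductSpace ℂ K'] {φ : (H →L[ℂ] K) → (H' →L[ℂ] K')}
    (hl : IsLinearMap ℂ φ) (hc : WkContinuous φ)
    (ξ : L2 H') (η : L2 K') : ∃ ξ' η', ∀ X, om ξ η (φ X) = om ξ' η' X := by
  have hco : @Continuous _ _ (sigmaWeak H' K') _ (om ξ η) := by
    rw [sigmaWeak_eq]
    exact @Continuous.comp _ _ _ (_) _ _ (fun (X : H' →L[ℂ] K') (f : Pre H' K') => f.1 X)
      (fun g : Pre H' K' → ℂ => g ⟨om ξ η, _, _, rfl⟩)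
      (continuous_apply _) continuous_induced_dom
  have : (om ξ η) ∘ₗ hl.mk' ∈ Pre H K := by
    apply pre_of_cont
    exact @Continuous.comp _ _ _ (sigmaWeak H K) (sigmaWeak H' K') _ _ _ hco hc
  obtain ⟨ξ', η', e⟩ := this
  exact ⟨ξ', η', fun X => by rw [← e]; rfl⟩

/-- single-vector functional -/
lemma om_single (x : H) (y : K) (X : H →L[ℂ] K) :
    om (lp.single 2 0 x) (lp.single 2 0 y) X = ⟪y, X x⟫ := by
  rw [om_apply, lp.inner_single_left]
  simp [lp.single_apply]

end Core

section Complete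
variable {H K G : Type*}
  [NormedAddCommGroup H] [InnerProductSpace ℂ H] [CompleteSpace H]
  [NormedAddCommGroup K] [InnerProductSpace ℂ K] [CompleteSpace K]
  [NormedAddCommGroup G] [InnerProductSpace ℂ G] [CompleteSpace G]

lemma Amp_adjoint (X : H →L[ℂ] K) : adjoint (Amp X) = Amp (adjoint X) := by
  symm
  rw [eq_adjoint_iff]
  intro x y
  rw [lp.inner_eq_tsum, lp.inner_eq_tsum]
  simp [adjoint_inner_left]

lemma Amp_inner_left (X : H →L[ℂ] K) (x : L2 K) (y : L2 H) :
    ⟪Amp (adjoint X) x, y⟫ = ⟪x, Amp X y⟫ := by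
  rw [← Amp_adjoint, adjoint_inner_left]

lemma Amp_inner_right (X : H →L[ℂ] K) (x : L2 H) (y : L2 K) :
    ⟪x, Amp (adjoint X) y⟫ = ⟪Amp X x, y⟫ := by
  rw [← Amp_adjoint, adjoint_inner_right]

lemma om_comp_left (A : K →L[ℂ] G) (X : H →L[ℂ] K) (ξ : L2 H) (η : L2 G) :
    om ξ η (A ∘L X) = om ξ (Amp (adjoint A) η) X := by
  rw [om_apply, om_apply, Amp_inner_left]; rfl

lemma om_comp_right (X : K →L[ℂ] G) (B : H →L[ℂ] K) (ξ : L2 H) (η : L2 G) :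
    om ξ η (X ∘L B) = om (Amp B ξ) η X := rfl

/-- images under two-sided multiplication -/
lemma wkSpan_comp {H' K' : Type*} [NormedAddCommGroup H'] [InnerProductSpace ℂ H'] [CompleteSpace H']
    [NormedAddCommGroup K'] [InnerProductSpace ℂ K'] [CompleteSpace K']
    (A : K →L[ℂ] K') (B : H' →L[ℂ] H) {S : Set (H →L[ℂ] K)} {T : Set (H' →L[ℂ] K')}
    (h : ∀ X ∈ S, A ∘L X ∘L B ∈ wkSpan T) {X : H →L[ℂ] K} (hX : X ∈ wkSpan S) :
    A ∘L X ∘L B ∈ wkSpan T := by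
  intro ξ η k
  rw [om_comp_left, om_comp_right]
  apply hX
  intro Y hY
  rw [← om_comp_right, ← om_comp_left]
  exact h Y hY ξ η k

/-- ultrafilter compactness of balls -/
lemma ultra_limit (F : Ultrafilter (H →L[ℂ] K)) (r : ℝ) (hF : ∀ᶠ X in (F : Filter (H →L[ℂ] K)), ‖X‖ ≤ r) :
    ∃ T : H →L[ℂ] K, ‖T‖ ≤ r ∧ ∀ ξ η, Tendsto (fun X => om ξ η X) (F : Filter (H →L[ℂ] K)) (𝓝 (om ξ η T)) := by
  have hr : 0 ≤ r := by
    obtain ⟨X, hX⟩ := hF.exists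
    exact (norm_nonneg X).trans hX
  have h1 : ∀ (x : H) (y : K), ∃ l : ℂ, ‖l‖ ≤ r * ‖x‖ * ‖y‖ ∧
      Tendsto (fun X : H →L[ℂ] K => ⟪X x, y⟫) (F : Filter (H →L[ℂ] K)) (𝓝 l) := by
    intro x y
    have hc : IsCompact (Metric.closedBall (0:ℂ) (r * ‖x‖ * ‖y‖)) := isCompact_closedBall _ _
    have := hc.ultrafilter_le_nhds (F.map fun X : H →L[ℂ] K => ⟪X x, y⟫) ?_
    · obtain ⟨l, hl, hl'⟩ := this
      exact ⟨l, by simpa using hl, hl'⟩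
    · rw [le_principal_iff]
      change ∀ᶠ X in (F : Filter (H →L[ℂ] K)), ⟪X x, y⟫ ∈ Metric.closedBall (0:ℂ) (r * ‖x‖ * ‖y‖)
      filter_upwards [hF] with X hX
      rw [mem_closedBall_zero_iff]
      refine (norm_inner_le_norm _ _).trans ?_
      gcongr
      exact X.le_of_opNorm_le hX x
  choose l hl hlt using h1
  let B : H →ₗ⋆[ℂ] K →ₗ[ℂ] ℂ := LinearMap.mk₂'ₛₗ _ _ l
    (fun x x' y => tendsto_nhds_unique (hlt _ _) (by
      simpa [inner_add_left] using (hlt x y).add (hlt x' y)))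
    (fun c x y => tendsto_nhds_unique (hlt _ _) (by
      simpa [inner_smul_left, mul_comm] using (hlt x y).const_mul (starRingEnd ℂ c)))
    (fun x y y' => tendsto_nhds_unique (hlt _ _) (by
      simpa [inner_add_right] using (hlt x y).add (hlt x y')))
    (fun c x y => tendsto_nhds_unique (hlt _ _) (by
      simpa [inner_smul_right] using (hlt x y).const_mul c))
  let B' : H →L⋆[ℂ] K →L[ℂ] ℂ := B.mkContinuous₂ r hl
  let T : H →L[ℂ] K :=
    ((InnerProductSpace.toDual ℂ K).symm.toContinuousLinearEquiv : _ →L⋆[ℂ] K).comp B'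
  have hT : ∀ x y, ⟪T x, y⟫ = l x y := fun x y => by
    change ⟪(InnerProductSpace.toDual ℂ K).symm (B' x), y⟫ = _
    rw [InnerProductSpace.toDual_symm_apply]; rfl
  have hTr : ‖T‖ ≤ r := by
    refine T.opNorm_le_bound hr fun x => ?_
    by_cases h0 : T x = 0
    · rw [h0, norm_zero]; positivity
    · have h2 := hl x (T x)
      rw [← hT, inner_self_eq_norm_sq_to_K] at h2
      have h3 : ‖T x‖ ^ 2 ≤ r * ‖x‖ * ‖T x‖ := by simpa using h2
      have h4 : 0 < ‖T x‖ := norm_pos_iff.2 h0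
      nlinarith
  refine ⟨T, hTr, fun ξ η => ?_⟩
  simp_rw [om_tsum]
  refine tendsto_tsum_of_dominated_convergence (bound := fun n => r * (‖ξ n‖ * ‖η n‖)) ?_ ?_ ?_
  · apply Summable.mul_left
    refine Summable.of_nonneg_of_le (fun n => by positivity) (fun n => ?_)
      ((L2_summable ξ).add (L2_summable η))
    nlinarith [sq_nonneg (‖ξ n‖ - ‖η n‖), sq_nonneg (‖ξ n‖ ), sq_nonneg (‖η n‖)]
  · intro n
    have h5 := hlt (ξ n) (η n)
    rw [← hT] at h5
    have := (Complex.continuous_conj.tendsto _).comp h5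
    simpa only [Function.comp_def, inner_conj_symm] using this
  · filter_upwards [hF] with X hX n
    refine (norm_inner_le_norm _ _).trans ?_
    have := X.le_of_opNorm_le hX (ξ n)
    nlinarith [norm_nonneg (η n)]

/-- FIP form of compactness. -/
lemma fip_limit {ι : Type*} (C : ι → Set (H →L[ℂ] K)) (r : ℝ)
    (hr : ∃ i, ∀ X ∈ C i, ‖X‖ ≤ r) (hne : ∀ s : Finset ι, ∃ X, ∀ i ∈ s, X ∈ C i) :
    ∃ (F : Ultrafilter (H →L[ℂ] K)) (T : H →L[ℂ] K), (∀ i, C i ∈ F) ∧ ‖T‖ ≤ r ∧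
      ∀ ξ η, Tendsto (fun X => om ξ η X) (F : Filter (H →L[ℂ] K)) (𝓝 (om ξ η T)) := by
  obtain ⟨F, hF⟩ := Ultrafilter.exists_ultrafilter_of_finite_inter_nonempty (range C) (by
    classical
    intro T hT
    haveI : Nonempty ι := ⟨hr.choose⟩
    choose! g hg using hT
    obtain ⟨s, hs⟩ : ∃ s : Finset ι, s.image C = T := ⟨T.image g, by
      rw [Finset.image_image]
      exact (Finset.image_congr (g := id) fun a ha => hg ha).trans Finset.image_id⟩
    obtain ⟨X, hX⟩ := hne s
    refine ⟨X, ?_⟩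
    rw [← hs]
    rintro _ h
    simp only [Finset.coe_image, Set.mem_image] at h
    obtain ⟨i, hi, rfl⟩ := h
    exact hX i hi)
  have hF' : ∀ i, C i ∈ F := fun i => hF ⟨i, rfl⟩
  obtain ⟨i, hi⟩ := hr
  obtain ⟨T, hT, h⟩ := ultra_limit F r (mem_of_superset (hF' i) hi)
  exact ⟨F, T, hF', hT, h⟩

/-- eventual membership passes to limits -/
lemma limit_mem_wkSpan {F : Filter (H →L[ℂ] K)} [NeBot F] {T : H →L[ℂ] K}
    (h : ∀ ξ η, Tendsto (fun X => om ξ η X) F (𝓝 (om ξ η T))) {S : Set (H →L[ℂ] K)}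
    (hS : ∀ᶠ X in F, X ∈ wkSpan S) : T ∈ wkSpan S := by
  intro ξ η k
  refine tendsto_nhds_unique (h ξ η) (Tendsto.congr' ?_ tendsto_const_nhds)
  filter_upwards [hS] with X hX
  exact (hX ξ η k).symm

lemma limit_inner {F : Filter (H →L[ℂ] K)} {T : H →L[ℂ] K}
    (h : ∀ ξ η, Tendsto (fun X => om ξ η X) F (𝓝 (om ξ η T))) (x : H) (y : K) :
    Tendsto (fun X => ⟪y, X x⟫) F (𝓝 ⟪y, T x⟫) := by
  simpa only [om_single] using h (lp.single 2 0 x) (lp.single 2 0 y)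

lemma limit_comm {F : Filter (H →L[ℂ] K)} [NeBot F] {T : H →L[ℂ] K}
    (h : ∀ ξ η, Tendsto (fun X => om ξ η X) F (𝓝 (om ξ η T)))
    (A : K →L[ℂ] K) (B : H →L[ℂ] H) (hS : ∀ᶠ X in F, A ∘L X = X ∘L B) : A ∘L T = T ∘L B := by
  ext x
  refine ext_inner_left ℂ fun y => ?_
  have h1 := limit_inner h (B x) y
  have h2 := limit_inner h x (adjoint A y)
  simp only [adjoint_inner_left] at h2
  refine tendsto_nhds_unique h2 (Tendsto.congr' ?_ h1)
  filter_upwards [hS] with X hX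
  have := congrArg (fun Z => ⟪y, Z x⟫) hX
  exact this.symm

end Complete
end OpSynth

namespace OpSynth
open Filter Topology ContinuousLinearMap
open scoped TensorProduct

section Tensor
variable {H K T H₁ K₁ T₁ H₂ K₂ T₂ H₃ K₃ T₃ : Type*}
  [NormedAddCommGroup H] [InnerProductSpace ℂ H]
  [NormedAddCommGroup K] [InnerProductSpace ℂ K]
  [NormedAddCommGroup T] [InnerProductSpace ℂ T]

namespace IsTensorEmbedding
variable {t : H → K → T} (ht : IsTensorEmbedding t)
include ht

lemma inner (x x' : H) (y y' : K) : ⟪t x y, t x' y'⟫ = ⟪x, x'⟫ * ⟪y, y'⟫ := ht.2.2.2.2.1 x x' y y'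

lemma norm (x : H) (y : K) : ‖t x y‖ = ‖x‖ * ‖y‖ := by
  have h := ht.inner x x y y
  simp only [inner_self_eq_norm_sq_to_K] at h
  have h2 : ‖t x y‖ ^ 2 = ‖x‖ ^ 2 * ‖y‖ ^ 2 := by exact_mod_cast h
  rw [← mul_pow] at h2
  exact (sq_eq_sq₀ (norm_nonneg _) (by positivity)).1 h2

/-- the bilinear map -/
def bil : H →ₗ[ℂ] K →ₗ[ℂ] T := LinearMap.mk₂ ℂ t ht.1 ht.2.2.1 ht.2.1 ht.2.2.2.1

/-- x ↦ t x y -/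
def J (y : K) : H →L[ℂ] T := (ht.bil.flip y).mkContinuous ‖y‖ fun x => by
  change ‖t x y‖ ≤ _
  rw [ht.norm, mul_comm]

/-- y ↦ t x y -/
def I (x : H) : K →L[ℂ] T := (ht.bil x).mkContinuous ‖x‖ fun y => by
  change ‖t x y‖ ≤ _
  rw [ht.norm]

lemma J_apply (x : H) (y : K) : ht.J y x = t x y := rfl
lemma I_apply (x : H) (y : K) : ht.I x y = t x y := rfl

/-- linear map from the algebraic tensor product -/
def lin : H ⊗[ℂ] K →ₗ[ℂ] T := TensorProduct.lift ht.bil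

lemma lin_tmul (x : H) (y : K) : ht.lin (x ⊗ₜ y) = t x y := by
  simp [lin, bil]

lemma dense : DenseRange ht.lin := by
  have h := ht.2.2.2.2.2
  have h2 : Submodule.span ℂ { z | ∃ x y, z = t x y } ≤ LinearMap.range ht.lin := by
    rw [Submodule.span_le]
    rintro _ ⟨x, y, rfl⟩
    exact ⟨x ⊗ₜ y, ht.lin_tmul x y⟩
  have h3 : Dense (Submodule.span ℂ { z | ∃ x y, z = t x y } : Set T) :=
    Submodule.dense_iff_topologicalClosure_eq_top.2 h
  exact h3.mono h2

lemma ext {E : Type*} [NormedAddCommGroup E] [NormedSpace ℂ E] {f g : T →L[ℂ] E}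
    (h : ∀ x y, f (t x y) = g (t x y)) : f = g := by
  have : (f : T →ₗ[ℂ] E) ∘ₗ ht.lin = (g : T →ₗ[ℂ] E) ∘ₗ ht.lin := by
    apply TensorProduct.ext'
    intro x y
    simp [lin_tmul, h]
  apply DFunLike.coe_injective
  refine ht.dense.equalizer f.continuous g.continuous ?_
  ext z; exact congrArg (fun l => l z) this

lemma ext_vec {v w : T} (h : ∀ x y, ⟪t x y, v⟫ = ⟪t x y, w⟫) : v = w := by
  have : innerSL ℂ v = innerSL ℂ w := ht.ext fun x y => by
    simp only [innerSL_apply_apply]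
    rw [← inner_conj_symm, h, inner_conj_symm]
  refine ext_inner_right ℂ fun z => ?_
  exact congrArg (fun l => l z) this

lemma flip : IsTensorEmbedding (fun y x => t x y) := by
  refine ⟨fun y y' x => ht.2.1 x y y', fun y x x' => ht.1 x x' y, fun c y x => ht.2.2.2.1 c x y,
    fun c y x => ht.2.2.1 c x y, fun y y' x x' => ?_, ?_⟩
  · rw [ht.inner, mul_comm]
  · have h := ht.2.2.2.2.2
    have e : { z | ∃ y x, z = t x y } = { z | ∃ x y, z = t x y } := by
      ext z; constructor <;> (rintro ⟨a, b, h⟩; exact ⟨b, a, h⟩)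
    rw [e, h]

end IsTensorEmbedding

variable
  [NormedAddCommGroup H₁] [InnerProductSpace ℂ H₁] [CompleteSpace H₁]
  [NormedAddCommGroup H₂] [InnerProductSpace ℂ H₂] [CompleteSpace H₂]
  [NormedAddCommGroup H₃] [InnerProductSpace ℂ H₃] [CompleteSpace H₃]
  [NormedAddCommGroup K₁] [InnerProductSpace ℂ K₁] [CompleteSpace K₁]
  [NormedAddCommGroup K₂] [InnerProductSpace ℂ K₂] [CompleteSpace K₂]
  [NormedAddCommGroup K₃] [InnerProductSpace ℂ K₃] [CompleteSpace K₃]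
  [NormedAddCommGroup T₁] [InnerProductSpace ℂ T₁] [CompleteSpace T₁]
  [NormedAddCommGroup T₂] [InnerProductSpace ℂ T₂] [CompleteSpace T₂]
  [NormedAddCommGroup T₃] [InnerProductSpace ℂ T₃] [CompleteSpace T₃]

/-- concrete tensor product -/
lemma exists_tensor (H K : Type*) [NormedAddCommGroup H] [InnerProductSpace ℂ H]
    [NormedAddCommGroup K] [InnerProductSpace ℂ K] :
    IsTensorEmbedding (fun (x : H) (y : K) =>
      ((x ⊗ₜ[ℂ] y : H ⊗[ℂ] K) : UniformSpace.Completion (H ⊗[ℂ] K))) := by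
  refine ⟨fun x x' y => ?_, fun x y y' => ?_, fun c x y => ?_, fun c x y => ?_,
    fun x x' y y' => ?_, ?_⟩
  · beta_reduce; rw [TensorProduct.add_tmul, UniformSpace.Completion.coe_add]
  · beta_reduce; rw [TensorProduct.tmul_add, UniformSpace.Completion.coe_add]
  · beta_reduce; rw [← TensorProduct.smul_tmul', UniformSpace.Completion.coe_smul]
  · beta_reduce; rw [TensorProduct.tmul_smul, UniformSpace.Completion.coe_smul]
  · rw [UniformSpace.Completion.inner_coe, TensorProduct.inner_tmul]
  · rw [← Submodule.dense_iff_topologicalClosure_eq_top]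
    refine (UniformSpace.Completion.denseRange_coe (α := H ⊗[ℂ] K)).mono ?_
    rintro _ ⟨z, rfl⟩
    induction z with
    | zero => rw [UniformSpace.Completion.coe_zero]; exact Submodule.zero_mem _
    | add a b ha hb => rw [UniformSpace.Completion.coe_add]; exact Submodule.add_mem _ ha hb
    | tmul x y => exact Submodule.subset_span ⟨x, y, rfl⟩

section ten
variable {t₁ : H₁ → K₁ → T₁} (ht₁ : IsTensorEmbedding t₁)
  {t₂ : H₂ → K₂ → T₂} (ht₂ : IsTensorEmbedding t₂) {t₃ : H₃ → K₃ → T₃} (ht₃ : IsTensorEmbedding t₃)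

lemma lin_gram (S : H₁ →L[ℂ] H₂) (R : K₁ →L[ℂ] K₂) (z z' : H₁ ⊗[ℂ] K₁) :
    ⟪ht₂.lin (TensorProduct.map (S : H₁ →ₗ[ℂ] H₂) (R : K₁ →ₗ[ℂ] K₂) z),
      ht₂.lin (TensorProduct.map (S : H₁ →ₗ[ℂ] H₂) (R : K₁ →ₗ[ℂ] K₂) z')⟫ =
    ⟪ht₁.lin z, ht₁.lin (TensorProduct.map (adjoint S ∘L S : H₁ →L[ℂ] H₁).toLinearMap
      (adjoint R ∘L R : K₁ →L[ℂ] K₁).toLinearMap z')⟫ := by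
  induction z with
  | zero => simp
  | add a b ha hb => simp only [map_add, inner_add_left, ha, hb]
  | tmul x y =>
    induction z' with
    | zero => simp
    | add a b ha hb => simp only [map_add, inner_add_right, ha, hb]
    | tmul x' y' =>
      simp only [TensorProduct.map_tmul, IsTensorEmbedding.lin_tmul, ContinuousLinearMap.coe_coe]
      rw [ht₁.inner, ht₂.inner]
      simp [adjoint_inner_right]

lemma exists_sq {H : Type*} [NormedAddCommGroup H] [InnerProductSpace ℂ H] [CompleteSpace H]
    {A : H →L[ℂ] H} (hA : 0 ≤ A) : ∃ C : H →L[ℂ] H, A = adjoint C ∘L C := by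
  obtain ⟨b, hb⟩ := CStarAlgebra.nonneg_iff_eq_star_mul_self.1 hA
  exact ⟨b, by rw [hb, star_eq_adjoint]; rfl⟩

lemma nonneg_sub (R : H₁ →L[ℂ] H₂) :
    0 ≤ ((‖R‖ ^ 2 : ℝ) : ℂ) • (1 : H₁ →L[ℂ] H₁) - adjoint R ∘L R := by
  rw [nonneg_iff_isPositive]
  rw [isPositive_iff_complex]
  intro x
  have e : ⟪(((‖R‖ ^ 2 : ℝ) : ℂ) • (1 : H₁ →L[ℂ] H₁) - adjoint R ∘L R) x, x⟫ =
      ((‖R‖ ^ 2 * ‖x‖ ^ 2 - ‖R x‖ ^ 2 : ℝ) : ℂ) := by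
    simp [inner_sub_left, inner_smul_left, adjoint_inner_left, inner_self_eq_norm_sq_to_K, mul_comm]
  rw [e]
  refine ⟨by rw [RCLike.re_to_complex, Complex.ofReal_re], ?_⟩
  have := R.le_opNorm x
  have h2 : ‖R x‖ ^ 2 ≤ (‖R‖ * ‖x‖) ^ 2 := by gcongr
  simp only [Complex.coe_algebraMap, RCLike.re_to_complex, Complex.ofReal_re]
  nlinarith

lemma lin_bound_right (R : K₁ →L[ℂ] K₁) (z : H₁ ⊗[ℂ] K₁) :
    ‖ht₁.lin (TensorProduct.map (1 : H₁ →L[ℂ] H₁).toLinearMap R.toLinearMap z)‖ ≤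
      ‖R‖ * ‖ht₁.lin z‖ := by
  obtain ⟨C, hC⟩ := exists_sq (nonneg_sub R)
  have h1 := lin_gram ht₁ ht₁ (1 : H₁ →L[ℂ] H₁) R z z
  have h2 := lin_gram ht₁ ht₁ (1 : H₁ →L[ℂ] H₁) C z z
  rw [← hC] at h2
  have e1 : (adjoint (1 : H₁ →L[ℂ] H₁) ∘L (1 : H₁ →L[ℂ] H₁)) = 1 := by
    rw [← star_eq_adjoint, star_one]; rfl
  rw [e1] at h1 h2
  have e2 : TensorProduct.map (1 : H₁ →L[ℂ] H₁).toLinearMap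
      (((‖R‖ ^ 2 : ℝ) : ℂ) • (1 : K₁ →L[ℂ] K₁) - adjoint R ∘L R : K₁ →L[ℂ] K₁).toLinearMap z
      = ((‖R‖ ^ 2 : ℝ) : ℂ) • z - TensorProduct.map (1 : H₁ →L[ℂ] H₁).toLinearMap
        (adjoint R ∘L R : K₁ →L[ℂ] K₁).toLinearMap z := by
    clear h1 h2
    induction z with
    | zero => simp only [map_zero, smul_zero, sub_zero]
    | add a b ha hb => rw [map_add, ha, hb, map_add, smul_add]; abel
    | tmul x y => simp [TensorProduct.tmul_sub]
  rw [e2, map_sub, inner_sub_right, map_smul, inner_smul_right, ← h1] at h2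
  simp only [inner_self_eq_norm_sq_to_K] at h2
  have h3 : ‖ht₁.lin (TensorProduct.map (1 : H₁ →L[ℂ] H₁).toLinearMap C.toLinearMap z)‖ ^ 2 =
    ‖R‖ ^ 2 * ‖ht₁.lin z‖ ^ 2 -
    ‖ht₁.lin (TensorProduct.map (1 : H₁ →L[ℂ] H₁).toLinearMap R.toLinearMap z)‖ ^ 2 := by
    apply Complex.ofReal_injective
    simpa using h2
  apply le_of_sq_le_sq _ (by positivity)
  rw [mul_pow]
  nlinarith [sq_nonneg ‖ht₁.lin (TensorProduct.map (1 : H₁ →L[ℂ] H₁).toLinearMap C.toLinearMap z)‖]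


lemma lin_swap (z : H₁ ⊗[ℂ] K₁) : ht₁.flip.lin (TensorProduct.comm ℂ H₁ K₁ z) = ht₁.lin z := by
  induction z with
  | zero => simp
  | add a b ha hb => rw [map_add, map_add, map_add, ha, hb]
  | tmul x y => rw [TensorProduct.comm_tmul, IsTensorEmbedding.lin_tmul, IsTensorEmbedding.lin_tmul]

lemma lin_bound_left (R : H₁ →L[ℂ] H₁) (z : H₁ ⊗[ℂ] K₁) :
    ‖ht₁.lin (TensorProduct.map R.toLinearMap (1 : K₁ →L[ℂ] K₁).toLinearMap z)‖ ≤
      ‖R‖ * ‖ht₁.lin z‖ := by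
  have := lin_bound_right ht₁.flip R (TensorProduct.comm ℂ H₁ K₁ z)
  rw [lin_swap, TensorProduct.map_comm, lin_swap] at this
  exact this

lemma exists_abs {H H' : Type*} [NormedAddCommGroup H] [InnerProductSpace ℂ H] [CompleteSpace H]
    [NormedAddCommGroup H'] [InnerProductSpace ℂ H'] [CompleteSpace H']
    (S : H →L[ℂ] H') : ∃ C : H →L[ℂ] H, adjoint S ∘L S = adjoint C ∘L C ∧ ‖C‖ ≤ ‖S‖ := by
  obtain ⟨C, hC⟩ := exists_sq (A := adjoint S ∘L S) (by
    rw [nonneg_iff_isPositive]; exact isPositive_adjoint_comp_self S)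
  refine ⟨C, hC, C.opNorm_le_bound (norm_nonneg _) fun x => ?_⟩
  have h : ⟪x, (adjoint S ∘L S) x⟫ = ⟪x, (adjoint C ∘L C) x⟫ := by rw [hC]
  simp only [comp_apply, adjoint_inner_right, inner_self_eq_norm_sq_to_K] at h
  have h2 : ‖S x‖ ^ 2 = ‖C x‖ ^ 2 := by exact_mod_cast h
  rw [← (sq_eq_sq₀ (norm_nonneg _) (norm_nonneg _)).1 h2]
  exact S.le_opNorm x

lemma lin_bound (S : H₁ →L[ℂ] H₂) (R : K₁ →L[ℂ] K₂) (z : H₁ ⊗[ℂ] K₁) :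
    ‖ht₂.lin (TensorProduct.map S.toLinearMap R.toLinearMap z)‖ ≤ (‖S‖ * ‖R‖) * ‖ht₁.lin z‖ := by
  obtain ⟨C, hC, hCn⟩ := exists_abs S
  obtain ⟨C', hC', hCn'⟩ := exists_abs R
  have h1 := lin_gram ht₁ ht₂ S R z z
  have h2 := lin_gram ht₁ ht₁ C C' z z
  rw [hC, hC', ← h2] at h1
  simp only [inner_self_eq_norm_sq_to_K] at h1
  have h3 : ‖ht₂.lin (TensorProduct.map S.toLinearMap R.toLinearMap z)‖ ^ 2 =
    ‖ht₁.lin (TensorProduct.map C.toLinearMap C'.toLinearMap z)‖ ^ 2 := by exact_mod_cast h1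
  rw [(sq_eq_sq₀ (norm_nonneg _) (norm_nonneg _)).1 h3]
  have h4 : TensorProduct.map C.toLinearMap C'.toLinearMap z =
    TensorProduct.map C.toLinearMap (1 : K₁ →L[ℂ] K₁).toLinearMap
      (TensorProduct.map (1 : H₁ →L[ℂ] H₁).toLinearMap C'.toLinearMap z) := by
    rw [← LinearMap.comp_apply, ← TensorProduct.map_comp]; rfl
  rw [h4]
  refine (lin_bound_left ht₁ C _).trans ?_
  have h5 := lin_bound_right ht₁ C' z
  calc _ ≤ ‖C‖ * (‖C'‖ * ‖ht₁.lin z‖) := by gcongr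
    _ ≤ ‖S‖ * (‖R‖ * ‖ht₁.lin z‖) := by gcongr
    _ = _ := by ring

/-- the operator `S ⊗ R` -/
def ten (S : H₁ →L[ℂ] H₂) (R : K₁ →L[ℂ] K₂) : T₁ →L[ℂ] T₂ :=
  (ht₂.lin ∘ₗ TensorProduct.map S.toLinearMap R.toLinearMap).extendOfNorm ht₁.lin

lemma ten_apply (S : H₁ →L[ℂ] H₂) (R : K₁ →L[ℂ] K₂) (x : H₁) (y : K₁) :
    ten ht₁ ht₂ S R (t₁ x y) = t₂ (S x) (R y) := by
  rw [← ht₁.lin_tmul]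
  unfold ten
  rw [LinearMap.extendOfNorm_eq ht₁.dense ⟨_, lin_bound ht₁ ht₂ S R⟩, LinearMap.comp_apply,
    TensorProduct.map_tmul, ht₂.lin_tmul]; rfl

lemma norm_ten_le (S : H₁ →L[ℂ] H₂) (R : K₁ →L[ℂ] K₂) : ‖ten ht₁ ht₂ S R‖ ≤ ‖S‖ * ‖R‖ :=
  LinearMap.opNorm_extendOfNorm_le ht₁.dense (by positivity) (lin_bound ht₁ ht₂ S R)

lemma isElem_iff {S : H₁ →L[ℂ] H₂} {R : K₁ →L[ℂ] K₂} {W : T₁ →L[ℂ] T₂} :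
    IsElemTensor t₁ t₂ W S R ↔ W = ten ht₁ ht₂ S R :=
  ⟨fun h => ht₁.ext fun x y => by rw [h x y, ten_apply], fun h x y => by rw [h, ten_apply]⟩

lemma ten_comp (S : H₁ →L[ℂ] H₂) (R : K₁ →L[ℂ] K₂) (S' : H₂ →L[ℂ] H₃) (R' : K₂ →L[ℂ] K₃) :
    ten ht₂ ht₃ S' R' ∘L ten ht₁ ht₂ S R = ten ht₁ ht₃ (S' ∘L S) (R' ∘L R) :=
  ht₁.ext fun x y => by simp only [comp_apply, ten_apply]

lemma ten_add_left (S S' : H₁ →L[ℂ] H₂) (R : K₁ →L[ℂ] K₂) :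
    ten ht₁ ht₂ (S + S') R = ten ht₁ ht₂ S R + ten ht₁ ht₂ S' R :=
  ht₁.ext fun x y => by simp only [add_apply, ten_apply, ht₂.1]

lemma ten_add_right (S : H₁ →L[ℂ] H₂) (R R' : K₁ →L[ℂ] K₂) :
    ten ht₁ ht₂ S (R + R') = ten ht₁ ht₂ S R + ten ht₁ ht₂ S R' :=
  ht₁.ext fun x y => by simp only [add_apply, ten_apply, ht₂.2.1]

lemma ten_smul_left (c : ℂ) (S : H₁ →L[ℂ] H₂) (R : K₁ →L[ℂ] K₂) :
    ten ht₁ ht₂ (c • S) R = c • ten ht₁ ht₂ S R :=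
  ht₁.ext fun x y => by simp only [smul_apply, ten_apply, ht₂.2.2.1]

lemma ten_smul_right (c : ℂ) (S : H₁ →L[ℂ] H₂) (R : K₁ →L[ℂ] K₂) :
    ten ht₁ ht₂ S (c • R) = c • ten ht₁ ht₂ S R :=
  ht₁.ext fun x y => by simp only [smul_apply, ten_apply, ht₂.2.2.2.1]

lemma ten_zero_left (R : K₁ →L[ℂ] K₂) : ten ht₁ ht₂ 0 R = 0 := by
  have := ten_smul_left ht₁ ht₂ 0 0 R
  simpa using this

lemma ten_sub_left (S S' : H₁ →L[ℂ] H₂) (R : K₁ →L[ℂ] K₂) :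
    ten ht₁ ht₂ (S - S') R = ten ht₁ ht₂ S R - ten ht₁ ht₂ S' R := by
  rw [eq_sub_iff_add_eq, ← ten_add_left, sub_add_cancel]

lemma ten_one : ten ht₁ ht₁ 1 1 = 1 := ht₁.ext fun x y => by rw [ten_apply]; rfl

lemma ten_adjoint (S : H₁ →L[ℂ] H₂) (R : K₁ →L[ℂ] K₂) :
    adjoint (ten ht₁ ht₂ S R) = ten ht₂ ht₁ (adjoint S) (adjoint R) :=
  ht₂.ext fun x y => ht₁.ext_vec fun x' y' => by
    rw [adjoint_inner_right, ten_apply, ten_apply, ht₁.inner, ht₂.inner, adjoint_inner_right,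
      adjoint_inner_right]

lemma adjI (x x' : H₁) (y : K₁) : adjoint (ht₁.I x) (t₁ x' y) = ⟪x, x'⟫ • y :=
  ext_inner_left ℂ fun z => by
    rw [adjoint_inner_right, ht₁.I_apply, ht₁.inner, inner_smul_right]

lemma adjJ (x : H₁) (y y' : K₁) : adjoint (ht₁.J y) (t₁ x y') = ⟪y, y'⟫ • x :=
  ext_inner_left ℂ fun z => by
    rw [adjoint_inner_right, ht₁.J_apply, ht₁.inner, inner_smul_right, mul_comm]

lemma slI_ten (S : H₁ →L[ℂ] H₂) (R : K₁ →L[ℂ] K₂) (x : H₁) (x' : H₂) :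
    adjoint (ht₂.I x') ∘L ten ht₁ ht₂ S R ∘L ht₁.I x = ⟪x', S x⟫ • R := by
  ext y
  simp only [comp_apply, ht₁.I_apply, ten_apply, adjI, smul_apply]

lemma wTensor_eq (V : Set (H₁ →L[ℂ] H₂)) (U : Set (K₁ →L[ℂ] K₂)) :
    wTensor t₁ t₂ V U = wkSpan (image2 (ten ht₁ ht₂) V U) := by
  unfold wTensor
  rw [wkClosure_span]
  congr 2
  ext W
  simp only [mem_setOf_eq, isElem_iff ht₁ ht₂, mem_image2, eq_comm]

end ten
end Tensor
end OpSynth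

namespace OpSynth
open Filter Topology ContinuousLinearMap InnerProductSpace

section Pr
variable {H K : Type*} [NormedAddCommGroup H] [InnerProductSpace ℂ H] [CompleteSpace H]
  [NormedAddCommGroup K] [InnerProductSpace ℂ K] [CompleteSpace K]

/-- projection onto the closure of a subspace -/
def pr (p : Submodule ℂ H) : H →L[ℂ] H :=
  haveI : CompleteSpace p.topologicalClosure := p.isClosed_topologicalClosure.completeSpace_coe
  p.topologicalClosure.starProjection

lemma pr_mem (p : Submodule ℂ H) (x : H) : pr p x ∈ p.topologicalClosure := by
  haveI : CompleteSpace p.topologicalClosure := p.isClosed_topologicalClosure.completeSpace_coe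
  exact Submodule.starProjection_apply_mem _ x

lemma pr_of_mem {p : Submodule ℂ H} {x : H} (h : x ∈ p.topologicalClosure) : pr p x = x := by
  haveI : CompleteSpace p.topologicalClosure := p.isClosed_topologicalClosure.completeSpace_coe
  exact Submodule.starProjection_eq_self_iff.2 h

lemma pr_of_mem' {p : Submodule ℂ H} {x : H} (h : x ∈ p) : pr p x = x :=
  pr_of_mem (p.le_topologicalClosure h)

lemma pr_sa (p : Submodule ℂ H) (x y : H) : ⟪pr p x, y⟫ = ⟪x, pr p y⟫ := by
  haveI : CompleteSpace p.topologicalClosure := p.isClosed_topologicalClosure.completeSpace_coe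
  exact Submodule.inner_starProjection_left_eq_right _ x y

lemma pr_adj (p : Submodule ℂ H) : adjoint (pr p) = pr p := by
  symm; rw [eq_adjoint_iff]; exact pr_sa p

lemma pr_idem (p : Submodule ℂ H) : pr p ∘L pr p = pr p := by
  ext x; exact pr_of_mem (pr_mem p x)

lemma pr_norm (p : Submodule ℂ H) : ‖pr p‖ ≤ 1 := by
  haveI : CompleteSpace p.topologicalClosure := p.isClosed_topologicalClosure.completeSpace_coe
  exact Submodule.starProjection_norm_le _

lemma pr_orth {p : Submodule ℂ H} {x y : H} (h : y ∈ p) : ⟪y, x - pr p x⟫ = 0 := by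
  rw [inner_sub_right, ← pr_sa, pr_of_mem' h, sub_self]

lemma pr_zero {p : Submodule ℂ H} {x : H} (h : ∀ y ∈ p, ⟪y, x⟫ = 0) : pr p x = 0 := by
  have hc : IsClosed {y : H | ⟪y, x⟫ = 0} :=
    isClosed_eq (continuous_id.inner continuous_const) continuous_const
  have h2 : ∀ y ∈ p.topologicalClosure, ⟪y, x⟫ = 0 := fun y hy =>
    closure_minimal (s := (p : Set H)) h hc hy
  rw [← inner_self_eq_zero (𝕜 := ℂ), ← pr_sa, pr_of_mem (pr_mem p x)]
  exact h2 _ (pr_mem p x)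

lemma closure_map {p : Submodule ℂ H} {q : Submodule ℂ K} (A : H →L[ℂ] K)
    (h : ∀ x ∈ p, A x ∈ q.topologicalClosure) {x : H} (hx : x ∈ p.topologicalClosure) :
    A x ∈ q.topologicalClosure :=
  closure_minimal (s := (p : Set H)) (t := A ⁻¹' q.topologicalClosure) h
    (q.isClosed_topologicalClosure.preimage A.continuous) hx

lemma pr_comm {p : Submodule ℂ H} (A : H →L[ℂ] H) (h : ∀ x ∈ p, A x ∈ p.topologicalClosure)
    (h' : ∀ x ∈ p, adjoint A x ∈ p.topologicalClosure) : A ∘L pr p = pr p ∘L A := by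
  ext x
  rw [comp_apply, comp_apply]
  have e : A x = A (pr p x) + A (x - pr p x) := by rw [← map_add]; congr 1; abel
  rw [e, map_add, pr_of_mem (closure_map A h (pr_mem p x)), pr_zero (x := A (x - pr p x)), add_zero]
  intro y hy
  rw [← adjoint_inner_left, inner_sub_right, ← pr_sa, pr_of_mem (h' y hy), sub_self]

lemma closed_pr {p : Submodule ℂ H} (hp : IsClosed (p : Set H)) : p.topologicalClosure = p :=
  hp.submodule_topologicalClosure_eq

end Pr

section Nest
variable {H K : Type*} [NormedAddCommGroup H] [InnerProductSpace ℂ H] [CompleteSpace H]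
  [NormedAddCommGroup K] [InnerProductSpace ℂ K] [CompleteSpace K]

/-- rank one elements of a nest algebra -/
def NR (N : Set (Submodule ℂ H)) (x y : H) : Prop :=
  ∃ p ∈ N, x ∈ p ∧ ∀ q ∈ N, q < p → ∀ z ∈ q, ⟪y, z⟫ = 0

lemma nest_lt {N : Set (Submodule ℂ H)} (hN : IsNest N) {p q : Submodule ℂ H} (hp : p ∈ N)
    (hq : q ∈ N) (h : ¬ p ≤ q) : q < p := by
  rcases hN.2.1.total hp hq with h' | h'
  · exact absurd h' h
  · exact lt_of_le_not_ge h' h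

lemma NR.mem_alg {N : Set (Submodule ℂ H)} (hN : IsNest N) {x y : H} (h : NR N x y) :
    rankOne ℂ x y ∈ nestAlg N := by
  obtain ⟨p, hp, hx, hy⟩ := h
  intro q hq z hz
  rw [rankOne_apply]
  by_cases hpq : p ≤ q
  · exact q.smul_mem _ (hpq hx)
  · rw [hy q hq (nest_lt hN hp hq hpq) z hz, zero_smul]; exact q.zero_mem

lemma NR.mul {N : Set (Submodule ℂ H)} (hN : IsNest N) {x y x' y' : H} (h : NR N x y)
    (h' : NR N x' y') (hne : ⟪y, x'⟫ ≠ 0) : NR N x y' := by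
  obtain ⟨p, hp, hx, hy⟩ := h
  obtain ⟨p', hp', hx', hy'⟩ := h'
  refine ⟨p, hp, hx, fun q hq hqp => hy' q hq (hqp.trans_le ?_)⟩
  by_contra hh
  exact hne (hy p' hp' (nest_lt hN hp hp' hh) x' hx')

/-- Σ ζ_n ⊗ ζ_n^* -/
lemma exists_HS (ζ : L2 H) : ∃ A : H →L[ℂ] H, IsCompactOperator A ∧
    ∀ x y, ⟪y, A x⟫ = ⟪ζ, Amp (rankOne ℂ x y) ζ⟫ := by
  have hs : Summable fun n => rankOne ℂ (ζ n) (ζ n) := by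
    refine Summable.of_norm ?_
    simpa only [norm_rankOne, ← pow_two] using L2_summable ζ
  refine ⟨∑' n, rankOne ℂ (ζ n) (ζ n), ?_, fun x y => ?_⟩
  · have hc := isClosed_setOf_isCompactOperator (𝕜₁ := ℂ) (𝕜₂ := ℂ) (σ₁₂ := RingHom.id ℂ) (M₁ := H) (M₂ := H)
    refine hc.mem_of_tendsto hs.hasSum (Eventually.of_forall fun s => ?_)
    induction s using Finset.cons_induction with
    | empty => simpa using! isCompactOperator_zero
    | cons a s ha ih =>
      rw [Finset.sum_cons]
      refine IsCompactOperator.add ?_ ih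
      rw [rankOne_def']
      exact (isCompactOperator_of_locallyCompactSpace_dom (innerSL ℂ (ζ a))).clm_comp
        (toSpanSingleton ℂ (ζ a))
  · have h1 := (hs.hasSum.mapL (ContinuousLinearMap.apply ℂ H x)).mapL (innerSL ℂ y)
    rw [lp.inner_eq_tsum]
    refine h1.tsum_eq.symm.trans (tsum_congr fun n => ?_)
    simp [inner_smul_right, mul_comm]

lemma inner_HS_self (ζ : L2 H) (h : ∀ x, ⟪ζ, Amp (rankOne ℂ x x) ζ⟫ = 0) : ζ = 0 := by
  ext n
  have h1 := h (ζ n)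
  rw [lp.inner_eq_tsum] at h1
  have h2 : ∀ m, ⟪ζ m, Amp (rankOne ℂ (ζ n) (ζ n)) ζ m⟫ = ((‖⟪ζ n, ζ m⟫‖ ^ 2 : ℝ) : ℂ) := by
    intro m
    rw [Amp_apply, rankOne_apply, inner_smul_right, ← inner_conj_symm (ζ m) (ζ n), Complex.mul_conj,
      Complex.normSq_eq_norm_sq]
  have hsum := lp.summable_inner (𝕜 := ℂ) ζ (Amp (rankOne ℂ (ζ n) (ζ n)) ζ)
  simp only [h2] at h1 hsum
  rw [← Complex.ofReal_tsum] at h1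
  have hs2 := (Complex.summable_ofReal.1 hsum).hasSum
  rw [show ∑' a, ‖⟪ζ n, ζ a⟫‖ ^ 2 = 0 by exact_mod_cast h1] at hs2
  have h3 := congrFun ((hasSum_zero_iff_of_nonneg (fun m => by positivity)).1 hs2) n
  have : ⟪ζ n, ζ n⟫ = 0 := by simpa using h3
  simpa using inner_self_eq_zero.1 this

/-- Erdos density, functional form -/
lemma erdos {N : Set (Submodule ℂ H)} (hN : IsNest N) (ξ η : L2 H)
    (h : ∀ x y, NR N x y → om ξ η (rankOne ℂ x y) = 0) : ⟪η, ξ⟫ = 0 := by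
  set L : Submodule ℂ (L2 H) := Submodule.span ℂ {v | ∃ x y, NR N x y ∧ v = Amp (rankOne ℂ x y) ξ}
    with hL
  set ζ := ξ - pr L ξ with hζ
  have hinv : ∀ x y, NR N x y → ∀ v ∈ L.topologicalClosure,
      Amp (rankOne ℂ x y) v ∈ L.topologicalClosure := by
    intro x y hxy v hv
    refine closure_map (p := L) _ ?_ hv
    intro u hu
    apply L.le_topologicalClosure
    induction hu using Submodule.span_induction with
    | mem u hu =>
      obtain ⟨x', y', h', rfl⟩ := hu
      rw [← Amp_comp_apply, rankOne_comp_rankOne, Amp_smul, smul_apply]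
      by_cases hne : ⟪y, x'⟫ = 0
      · rw [hne, zero_smul]; exact L.zero_mem
      · exact L.smul_mem _ (Submodule.subset_span ⟨x, y', hxy.mul hN h' hne, rfl⟩)
    | zero => rw [map_zero]; exact L.zero_mem
    | add a b _ _ ha hb => rw [map_add]; exact L.add_mem ha hb
    | smul c a _ ha => rw [map_smul]; exact L.smul_mem _ ha
  have hz : ∀ x y, NR N x y → ⟪ζ, Amp (rankOne ℂ x y) ζ⟫ = 0 := by
    intro x y hxy
    have h1 : Amp (rankOne ℂ x y) ζ ∈ L.topologicalClosure := by
      rw [hζ, map_sub]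
      refine Submodule.sub_mem _ (L.le_topologicalClosure (Submodule.subset_span ⟨x, y, hxy, rfl⟩))
        (hinv x y hxy _ (pr_mem L ξ))
    rw [← pr_of_mem h1, ← pr_sa, hζ, map_sub, pr_of_mem (pr_mem L ξ), sub_self, inner_zero_left]
  obtain ⟨A, hAc, hA⟩ := exists_HS ζ
  have hAs : A.IsSymmetric := by
    intro x y
    have := hA x y
    change ⟪A x, y⟫ = ⟪x, A y⟫
    rw [hA, ← inner_conj_symm, hA, ← adjoint_rankOne, Amp_inner_right, inner_conj_symm]
  have hAsa : adjoint A = A := by symm; rw [eq_adjoint_iff]; exact hAs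
  have hcomm : ∀ p ∈ N, A ∘L pr p = pr p ∘L A := by
    intro p hp
    have h1 : ∀ x ∈ p, A x ∈ p.topologicalClosure := by
      intro x hx
      have h2 : ⟪A x - pr p (A x), A x - pr p (A x)⟫ = 0 := by
        have h3 : ∀ z ∈ p, ⟪A x - pr p (A x), z⟫ = 0 := fun z hz => by
          rw [← inner_conj_symm, pr_orth hz, map_zero]
        have h4 := hz x (A x - pr p (A x)) ⟨p, hp, hx, fun q _ hq z hz => h3 z (hq.le hz)⟩
        rw [← hA] at h4
        have h5 : ⟪A x - pr p (A x), pr p (A x)⟫ = 0 := by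
          apply h3
          have := pr_mem p (A x)
          rwa [closed_pr (hN.1 p hp)] at this
        rw [inner_sub_right, h4, h5, sub_zero]
      rw [inner_self_eq_zero, sub_eq_zero] at h2
      rw [h2]; exact pr_mem p _
    exact pr_comm A h1 (by rw [hAsa]; exact h1)
  have hA0 : A = 0 := by
    rw [← eq_zero_of_forall_hasEigenvalue_eq_zero hAc hAs]
    intro μ hμ
    by_contra hne
    haveI := finite_dimensional_eigenspace hAc μ hne
    set F := Module.End.eigenspace A.toLinearMap μ with hF
    have htop : (⊤ : Submodule ℂ H) ∈ N := by simpa using (hN.2.2 ∅ (empty_subset _)).1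
    have hex : ∃ n, ∃ p ∈ N, F ⊓ p ≠ ⊥ ∧ Module.finrank ℂ (F ⊓ p : Submodule ℂ H) = n :=
      ⟨_, ⊤, htop, by rw [inf_top_eq]; exact hμ, rfl⟩
    classical
    obtain ⟨p, hp, hpne, hpn⟩ := Nat.find_spec hex
    have hmin : ∀ q ∈ N, Module.finrank ℂ (F ⊓ q : Submodule ℂ H) <
        Module.finrank ℂ (F ⊓ p : Submodule ℂ H) → F ⊓ q = ⊥ := by
      intro q hq hlt
      by_contra hne
      rw [hpn] at hlt
      exact Nat.find_min hex hlt ⟨q, hq, hne, rfl⟩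
    obtain ⟨x, hx, hx0⟩ := Submodule.exists_mem_ne_zero_of_ne_bot hpne
    set S := {q | q ∈ N ∧ x ∈ q} with hS
    have hI : sInf S ∈ N := (hN.2.2 S (fun q hq => hq.1)).1
    have hxI : x ∈ sInf S := by rw [Submodule.mem_sInf]; exact fun q hq => hq.2
    have hxx : NR N x x := by
      refine ⟨sInf S, hI, hxI, fun q hq hlt z hzq => ?_⟩
      have hxq : x ∉ q := fun hxq => not_le_of_gt hlt (sInf_le ⟨hq, hxq⟩)
      have hlt2 : F ⊓ q < F ⊓ p := by
        refine lt_of_le_of_ne (inf_le_inf_left F (hlt.le.trans (sInf_le ⟨hp, hx.2⟩))) ?_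
        intro e
        rw [← e] at hx
        exact hxq hx.2
      have hbot := hmin q hq (Submodule.finrank_lt_finrank_of_lt hlt2)
      have hpx : pr q x ∈ F ⊓ q := by
        refine ⟨?_, ?_⟩
        · refine Module.End.mem_eigenspace_iff.2 ?_
          have h1 := congrArg (fun B => B x) (hcomm q hq)
          have h2 : A x = μ • x := Module.End.mem_eigenspace_iff.1 hx.1
          simp only [comp_apply, h2, map_smul] at h1
          exact h1
        · have := pr_mem q x
          rwa [closed_pr (hN.1 q hq)] at this
      rw [hbot, Submodule.mem_bot] at hpx
      rw [← pr_of_mem' hzq, ← pr_sa, hpx, inner_zero_left]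
    have h1 := hz x x hxx
    have h2 : A x = μ • x := Module.End.mem_eigenspace_iff.1 hx.1
    rw [← hA, h2, inner_smul_right] at h1
    rcases mul_eq_zero.1 h1 with h1 | h1
    · exact hne h1
    · exact hx0 (inner_self_eq_zero.1 h1)
  have hζ0 : ζ = 0 := by
    apply inner_HS_self
    intro x
    rw [← hA, hA0]; simp
  have hξ : ξ = pr L ξ := sub_eq_zero.1 hζ0
  have : pr L η = 0 := by
    apply pr_zero
    intro v hv
    induction hv using Submodule.span_induction with
    | mem u hu =>
      obtain ⟨x, y, h', rfl⟩ := hu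
      rw [← inner_conj_symm, ← om_apply, h x y h', map_zero]
    | zero => rw [inner_zero_left]
    | add a b _ _ ha hb => rw [inner_add_left, ha, hb, add_zero]
    | smul c a _ ha => rw [inner_smul_left, ha, mul_zero]
  rw [hξ, ← pr_sa, this, inner_zero_left]

end Nest
end OpSynth

namespace OpSynth
open Filter Topology ContinuousLinearMap InnerProductSpace

section Norm
variable {H K : Type*} [NormedAddCommGroup H] [InnerProductSpace ℂ H]
  [NormedAddCommGroup K] [InnerProductSpace ℂ K]

lemma om_cont (ξ : L2 H) (η : L2 K) : Continuous (om ξ η) := by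
  have : ∀ X : H →L[ℂ] K, ‖om ξ η X‖ ≤ (‖η‖ * ‖ξ‖) * ‖X‖ := fun X => by
    rw [om_apply]
    refine (norm_inner_le_norm _ _).trans ?_
    have := (Amp X).le_of_opNorm_le (Amp_norm_le X) ξ
    calc _ ≤ ‖η‖ * (‖X‖ * ‖ξ‖) := by gcongr
      _ = _ := by ring
  exact ((om ξ η).mkContinuous _ this).continuous

lemma isClosed_wkSpan (S : Set (H →L[ℂ] K)) : IsClosed (wkSpan S : Set (H →L[ℂ] K)) := by
  have : (wkSpan S : Set (H →L[ℂ] K)) =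
      ⋂ (ξ : L2 H) (η : L2 K) (_ : ∀ Y ∈ S, om ξ η Y = 0), {X | om ξ η X = 0} := by
    ext X; simp only [mem_iInter]; rfl
  rw [this]
  exact isClosed_iInter fun ξ => isClosed_iInter fun η => isClosed_iInter fun _ =>
    isClosed_eq (om_cont ξ η) continuous_const

end Norm

section Masa
variable {H K : Type*} [NormedAddCommGroup H] [InnerProductSpace ℂ H] [CompleteSpace H]
  [NormedAddCommGroup K] [InnerProductSpace ℂ K] [CompleteSpace K]
  {D : StarSubalgebra ℂ (H →L[ℂ] H)}

lemma adj_mem {a : H →L[ℂ] H} (ha : a ∈ D) : adjoint a ∈ D := star_mem ha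

lemma masa_sa (hD : IsMasa D) {b : H →L[ℂ] H} (hb : adjoint b = b)
    (h : ∀ a ∈ D, a * b = b * a) : b ∈ D := by
  have hs : star b = b := hb
  have h1 : ∀ x ∈ (D : Set (H →L[ℂ] H)) ∪ {b}, ∀ y ∈ (D : Set (H →L[ℂ] H)) ∪ {b},
      x * y = y * x := by
    rintro x (hx | rfl) y (hy | rfl)
    · exact hD.1 x hx y hy
    · exact h x hx
    · exact (h y hy).symm
    · rfl
  have h2 : ∀ x ∈ (D : Set (H →L[ℂ] H)) ∪ {b}, ∀ y ∈ (D : Set (H →L[ℂ] H)) ∪ {b},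
      x * star y = star y * x := by
    rintro x hx y (hy | rfl)
    · exact h1 x hx _ (Or.inl (star_mem hy))
    · rw [hs]; exact h1 x hx _ (Or.inr rfl)
  have h3 := hD.2 (StarAlgebra.adjoin ℂ ((D : Set (H →L[ℂ] H)) ∪ {b})) (by
    intro x hx y hy
    have := (StarAlgebra.adjoinCommSemiringOfComm ℂ h1 h2).mul_comm ⟨x, hx⟩ ⟨y, hy⟩
    exact congrArg Subtype.val this)
    (fun x hx => StarAlgebra.subset_adjoin ℂ _ (Or.inl hx))
  rw [← h3]
  exact StarAlgebra.subset_adjoin ℂ _ (Or.inr rfl)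

lemma masa_mem (hD : IsMasa D) {b : H →L[ℂ] H}
    (h : ∀ a ∈ D, a * b = b * a) : b ∈ D := by
  have h' : ∀ a ∈ D, a * star b = star b * a := fun a ha => by
    have := congrArg star (h (star a) (star_mem ha))
    simpa using this.symm
  have h1 : b + star b ∈ D := masa_sa hD (by rw [← star_eq_adjoint, star_add, star_star, add_comm])
    fun a ha => by rw [mul_add, add_mul, h a ha, h' a ha]
  have h2 : Complex.I • (b - star b) ∈ D := masa_sa hD
    (by rw [← star_eq_adjoint, star_smul, star_sub, star_star]; simp [smul_sub]; abel)
    fun a ha => by rw [mul_smul_comm, smul_mul_assoc, mul_sub, sub_mul, h a ha, h' a ha]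
  have e : b = (1/2 : ℂ) • (b + star b) - (Complex.I / 2) • (Complex.I • (b - star b)) := by
    rw [smul_smul, div_mul_eq_mul_div, Complex.I_mul_I]
    module
  rw [e]
  exact sub_mem (SMulMemClass.smul_mem _ h1) (SMulMemClass.smul_mem _ h2)

/-- projections of a masa -/
def PD (D : StarSubalgebra ℂ (H →L[ℂ] H)) (P : H →L[ℂ] H) : Prop :=
  P ∈ D ∧ P ∘L P = P ∧ adjoint P = P

lemma PD_pr (hD : IsMasa D) {p : Submodule ℂ H} (h : ∀ a ∈ D, ∀ x ∈ p, a x ∈ p.topologicalClosure) :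
    PD D (pr p) :=
  ⟨masa_mem hD fun a ha => pr_comm a (h a ha) (h _ (adj_mem ha)), pr_idem p, pr_adj p⟩

lemma PD.one : PD D 1 := ⟨one_mem _, rfl, by rw [← star_eq_adjoint, star_one]⟩

lemma PD.compl {P : H →L[ℂ] H} (h : PD D P) : PD D (1 - P) := by
  refine ⟨sub_mem (one_mem _) h.1, ?_, ?_⟩
  · have := h.2.1
    rw [← mul_def] at this ⊢
    rw [mul_sub, sub_mul, sub_mul, this]; simp
  · rw [← star_eq_adjoint, star_sub, star_one, star_eq_adjoint, h.2.2]

lemma PD.mul (hD : IsMasa D) {P Q : H →L[ℂ] H} (h : PD D P) (h' : PD D Q) : PD D (P ∘L Q) := by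
  have e : P ∘L Q = Q ∘L P := hD.1 P h.1 Q h'.1
  refine ⟨mul_mem h.1 h'.1, ?_, ?_⟩
  · calc (P ∘L Q) ∘L (P ∘L Q) = P ∘L (Q ∘L P) ∘L Q := rfl
      _ = (P ∘L P) ∘L (Q ∘L Q) := by rw [← e]; rfl
      _ = _ := by rw [h.2.1, h'.2.1]
  · rw [adjoint_comp, h.2.2, h'.2.2, e]

lemma PD.idem {P : H →L[ℂ] H} (h : PD D P) (x : H) : P (P x) = P x :=
  congrArg (fun A => A x) h.2.1

lemma PD.norm_le {P : H →L[ℂ] H} (h : PD D P) : ‖P‖ ≤ 1 := by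
  refine P.opNorm_le_bound zero_le_one fun x => ?_
  rw [one_mul]
  have h1 : ⟪P x, P x⟫ = ⟪P x, x⟫ := by
    rw [← adjoint_inner_left, h.2.2, h.idem]
  have h2 : ‖P x‖ ^ 2 ≤ ‖P x‖ * ‖x‖ := by
    have := norm_inner_le_norm (𝕜 := ℂ) (P x) x
    rw [← h1, inner_self_eq_norm_sq_to_K] at this
    simpa using this
  by_cases h0 : ‖P x‖ = 0
  · rw [h0]; positivity
  · have : 0 < ‖P x‖ := lt_of_le_of_ne (norm_nonneg _) (Ne.symm h0)
    nlinarith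

lemma masa_limit (hD : IsMasa D) {F : Filter (H →L[ℂ] H)} [NeBot F] {T : H →L[ℂ] H}
    (h : ∀ ξ η, Tendsto (fun X => om ξ η X) F (𝓝 (om ξ η T)))
    (hF : ∀ᶠ X in F, X ∈ D) : T ∈ D :=
  masa_mem hD fun a ha => limit_comm h a a (by
    filter_upwards [hF] with X hX
    exact hD.1 a ha X hX)

/-- orbit subspace -/
def orb (D : StarSubalgebra ℂ (H →L[ℂ] H)) (e : H) : Submodule ℂ H where
  carrier := {x | ∃ a ∈ D, x = a e}
  add_mem' := by
    rintro _ _ ⟨a, ha, rfl⟩ ⟨b, hb, rfl⟩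
    exact ⟨a + b, add_mem ha hb, rfl⟩
  zero_mem' := ⟨0, zero_mem _, rfl⟩
  smul_mem' := by
    rintro c _ ⟨a, ha, rfl⟩
    exact ⟨c • a, SMulMemClass.smul_mem c ha, rfl⟩

lemma mem_orb (D : StarSubalgebra ℂ (H →L[ℂ] H)) (e : H) : e ∈ orb D e := ⟨1, one_mem _, rfl⟩

lemma PD_orb (hD : IsMasa D) (e : H) : PD D (pr (orb D e)) := by
  refine PD_pr hD fun a ha x hx => Submodule.le_topologicalClosure _ ?_
  obtain ⟨b, hb, rfl⟩ := hx
  exact ⟨a * b, mul_mem ha hb, rfl⟩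

end Masa

section NestBim
variable {H₁ H₂ : Type*} [NormedAddCommGroup H₁] [InnerProductSpace ℂ H₁] [CompleteSpace H₁]
  [NormedAddCommGroup H₂] [InnerProductSpace ℂ H₂] [CompleteSpace H₂]
  {D₁ : StarSubalgebra ℂ (H₁ →L[ℂ] H₁)} {D₂ : StarSubalgebra ℂ (H₂ →L[ℂ] H₂)}

/-- span of V p -/
def th (V : Set (H₁ →L[ℂ] H₂)) (p : Submodule ℂ H₁) : Submodule ℂ H₂ :=
  Submodule.span ℂ {z | ∃ S ∈ V, ∃ x ∈ p, z = S x}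

lemma th_mono {V : Set (H₁ →L[ℂ] H₂)} {p q : Submodule ℂ H₁} (h : p ≤ q) : th V p ≤ th V q :=
  Submodule.span_mono fun _ ⟨S, hS, x, hx, e⟩ => ⟨S, hS, x, h hx, e⟩

lemma nest_R {V : Set (H₁ →L[ℂ] H₂)} (hV : IsWkClosedSubspace V) {N : Set (Submodule ℂ H₁)}
    (hN : IsNest N) (hb : ∀ X ∈ V, ∀ A ∈ nestAlg N, X ∘L A ∈ V) {T : H₁ →L[ℂ] H₂}
    (hT : ∀ p ∈ N, ∀ x ∈ p, T x ∈ (th V p).topologicalClosure) : T ∈ V := by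
  have hVe := isWk_iff hV
  have key : ∀ x y, NR N x y → rankOne ℂ (T x) y ∈ wkSpan V := by
    rintro x y ⟨p, hp, hx, hy⟩
    have h1 : IsClosed {z : H₂ | rankOne ℂ z y ∈ wkSpan V} :=
      (isClosed_wkSpan V).preimage ((rankOne ℂ (E := H₂) (F := H₁)).flip y).continuous
    refine closure_minimal (s := (th V p : Set H₂)) ?_ h1 (hT p hp x hx)
    intro z hz
    change rankOne ℂ z y ∈ wkSpan V
    induction hz using Submodule.span_induction with
    | mem u hu =>
      obtain ⟨S, hS, x', hx', rfl⟩ := hu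
      rw [← comp_rankOne]
      exact subset_wkSpan V (hb S hS _ (NR.mem_alg hN ⟨p, hp, hx', hy⟩))
    | zero => rw [map_zero, zero_apply]; exact zero_mem _
    | add a b _ _ ha hb => rw [map_add, add_apply]; exact add_mem ha hb
    | smul c a _ ha => rw [map_smul, smul_apply]; exact Submodule.smul_mem _ _ ha
  rw [← hVe]
  intro ξ η hk
  have := erdos hN ξ (Amp (adjoint T) η) fun x y hxy => by
    rw [← om_comp_left, comp_rankOne]
    exact key x y hxy ξ η hk
  rwa [Amp_inner_left] at this

lemma nest_pairs (hD₁ : IsMasa D₁) (hD₂ : IsMasa D₂) {V : Set (H₁ →L[ℂ] H₂)}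
    (hV : IsMasaBimodule D₁ D₂ V) (hn : IsNestBimodule V) :
    ∃ C : Set ((H₂ →L[ℂ] H₂) × (H₁ →L[ℂ] H₁)),
      (∀ c ∈ C, PD D₂ c.1 ∧ PD D₁ c.2 ∧ (∀ X ∈ V, (1 - c.1) ∘L X ∘L c.2 = 0) ∧
        ∀ X, c.1 ∘L X ∘L (1 - c.2) ∈ V) ∧
      ∀ T, (∀ c ∈ C, c.1 ∘L T = T ∘L c.2) → T ∈ V := by
  obtain ⟨hw, N, N₂, hN, hN₂, hb⟩ := hn
  have hb' : ∀ X ∈ V, ∀ A ∈ nestAlg N, X ∘L A ∈ V := fun X hX A hA => by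
    have := hb X hX A hA 1 (fun p _ x hx => hx)
    exact this
  let hat : Submodule ℂ H₁ → Submodule ℂ H₁ := fun p =>
    { carrier := {x | ∀ S ∈ V, S x ∈ (th V p).topologicalClosure}
      add_mem' := fun ha hb S hS => by rw [map_add]; exact add_mem (ha S hS) (hb S hS)
      zero_mem' := fun S hS => by rw [map_zero]; exact zero_mem _
      smul_mem' := fun c x hx S hS => by rw [map_smul]; exact Submodule.smul_mem _ _ (hx S hS) }
  have hle : ∀ p, p ≤ hat p := fun p x hx S hS =>
    Submodule.le_topologicalClosure _ (Submodule.subset_span ⟨S, hS, x, hx, rfl⟩)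
  refine ⟨{c | ∃ p ∈ N, c = (pr (th V p), pr (hat p))}, ?_, ?_⟩
  · rintro _ ⟨p, hp, rfl⟩
    refine ⟨PD_pr hD₂ fun b hb x hx => ?_, PD_pr hD₁ fun a ha x hx => ?_, fun X hX => ?_, fun X => ?_⟩
    · apply Submodule.le_topologicalClosure
      induction hx using Submodule.span_induction with
      | mem u hu =>
        obtain ⟨S, hS, x', hx', rfl⟩ := hu
        exact Submodule.subset_span ⟨b ∘L S ∘L 1, hV.2 S hS 1 (one_mem _) b hb, x', hx', rfl⟩
      | zero => rw [map_zero]; exact zero_mem _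
      | add a b _ _ ha hb => rw [map_add]; exact add_mem ha hb
      | smul c a _ ha => rw [map_smul]; exact Submodule.smul_mem _ _ ha
    · apply Submodule.le_topologicalClosure
      intro S hS
      exact hx (1 ∘L S ∘L a) (hV.2 S hS a ha 1 (one_mem _))
    · ext x
      have : X (pr (hat p) x) ∈ (th V p).topologicalClosure :=
        closure_map (p := hat p) (q := th V p) X (fun z hz => hz X hX) (pr_mem _ x)
      simp [pr_of_mem this]
    · refine nest_R hw hN hb' fun q hq x hx => ?_
      by_cases hqp : q ≤ p
      · have : pr (hat p) x = x := pr_of_mem' (hle p (hqp hx))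
        simp [this]
      · have hpq := nest_lt hN hq hp hqp
        exact Submodule.topologicalClosure_mono (th_mono hpq.le) (pr_mem _ _)
  · intro T hT
    refine nest_R hw hN hb' fun p hp x hx => ?_
    have h1 := congrArg (fun A => A x) (hT _ ⟨p, hp, rfl⟩)
    simp only [comp_apply, pr_of_mem' (hle p hx)] at h1
    rw [← h1]; exact pr_mem _ _

end NestBim
end OpSynth

namespace OpSynth
open Filter Topology ContinuousLinearMap InnerProductSpace

section MaxL
variable {H : Type*} [NormedAddCommGroup H] [InnerProductSpace ℂ H] [CompleteSpace H]
  {D : StarSubalgebra ℂ (H →L[ℂ] H)}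

/-- positive contraction -/
def PC (c : H →L[ℂ] H) : Prop :=
  ∀ x, (⟪x, c x⟫).im = 0 ∧ 0 ≤ (⟪x, c x⟫).re ∧ (⟪x, c x⟫).re ≤ ‖x‖ ^ 2

lemma re_self (x : H) : (⟪x, x⟫).re = ‖x‖ ^ 2 := by
  have := inner_self_eq_norm_sq (𝕜 := ℂ) x
  simpa using this

lemma PC.sq {c : H →L[ℂ] H} (h : PC c) : ∃ C : H →L[ℂ] H, c = adjoint C ∘L C ∧
    ∀ x, ‖C x‖ ≤ ‖x‖ := by
  have h0 : 0 ≤ c := by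
    rw [nonneg_iff_isPositive, isPositive_iff_complex]
    intro x
    obtain ⟨h1, h2, -⟩ := h x
    have e : ⟪c x, x⟫ = ⟪x, c x⟫ := by
      rw [← inner_conj_symm]
      exact Complex.conj_eq_iff_im.2 h1
    rw [e]
    refine ⟨Complex.ext ?_ ?_, h2⟩
    · simp
    · simpa using h1.symm
  obtain ⟨C, rfl⟩ := exists_sq h0
  refine ⟨C, rfl, fun x => ?_⟩
  have := (h x).2.2
  rw [comp_apply, adjoint_inner_right, re_self] at this
  exact (sq_le_sq₀ (norm_nonneg _) (norm_nonneg _)).1 this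

lemma PC.le {c : H →L[ℂ] H} (h : PC c) (x : H) : ‖c x‖ ^ 2 ≤ (⟪x, c x⟫).re := by
  obtain ⟨C, rfl, hC⟩ := h.sq
  rw [comp_apply, adjoint_inner_right, re_self]
  have hn : ‖adjoint C‖ ≤ 1 := by
    rw [LinearIsometryEquiv.norm_map]
    exact C.opNorm_le_bound zero_le_one (by simpa using hC)
  have := (adjoint C).le_of_opNorm_le hn (C x)
  rw [one_mul] at this
  gcongr

lemma max_lemma (hD : IsMasa D) {e : H} {v : L2 H} {K : ℝ} (hK : 0 ≤ K) (hv : ‖v‖ < K * ‖e‖) :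
    ∃ q ∈ D, q e ≠ 0 ∧ ∀ b ∈ D, ‖Amp b (Amp q v)‖ ≤ K * ‖b (q e)‖ := by
  let τ : (H →L[ℂ] H) → ℝ := fun c => K ^ 2 * (⟪e, c e⟫).re - (⟪v, Amp c v⟫).re
  let S : Set (H →L[ℂ] H) := {c | c ∈ D ∧ PC c}
  have h1S : (1 : H →L[ℂ] H) ∈ S := ⟨one_mem _, fun x => by
    have : (⟪x, x⟫).im = 0 := by simpa using inner_self_im (𝕜 := ℂ) x
    change (⟪x, x⟫).im = 0 ∧ 0 ≤ (⟪x, x⟫).re ∧ (⟪x, x⟫).re ≤ ‖x‖ ^ 2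
    exact ⟨this, by rw [re_self]; positivity, by rw [re_self]⟩⟩
  obtain ⟨F, c, hF, -, hl⟩ := fip_limit (ι := S) (fun i => {c | c ∈ S ∧ τ i ≤ τ c}) 1
    ⟨⟨1, h1S⟩, fun X hX => X.opNorm_le_bound zero_le_one fun x => by
      have := (hX.1.2.le x).trans (hX.1.2 x).2.2
      rw [one_mul]
      exact (sq_le_sq₀ (norm_nonneg _) (norm_nonneg _)).1 this⟩
    (fun s => by
      rcases s.eq_empty_or_nonempty with rfl | hs
      · exact ⟨1, by simp⟩
      · obtain ⟨m, hm, hmx⟩ := s.exists_max_image (fun i => τ i) hs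
        exact ⟨m, fun i hi => ⟨m.2, hmx i hi⟩⟩)
  have hFS : ∀ᶠ X in (F : Filter (H →L[ℂ] H)), X ∈ S := by
    filter_upwards [hF ⟨1, h1S⟩] with X hX using hX.1
  have hcD : c ∈ D := masa_limit hD hl (hFS.mono fun X hX => hX.1)
  have hcP : PC c := fun x => by
    have hc : IsClosed {z : ℂ | z.im = 0 ∧ 0 ≤ z.re ∧ z.re ≤ ‖x‖ ^ 2} :=
      (isClosed_eq Complex.continuous_im continuous_const).inter
        ((isClosed_le continuous_const Complex.continuous_re).inter
          (isClosed_le Complex.continuous_re continuous_const))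
    exact hc.mem_of_tendsto (limit_inner hl x x) (hFS.mono fun X hX => hX.2 x)
  have hmax : ∀ i ∈ S, τ i ≤ τ c := fun i hi => by
    have ht : Tendsto τ F (𝓝 (τ c)) :=
      (((Complex.continuous_re.tendsto _).comp (limit_inner hl e e)).const_mul _).sub
        ((Complex.continuous_re.tendsto _).comp (hl v v))
    refine ge_of_tendsto ht ?_
    filter_upwards [hF ⟨i, hi⟩] with X hX using hX.2
  obtain ⟨C, hC, hC1⟩ := hcP.sq
  have hca : adjoint c = c := by rw [hC, adjoint_comp, adjoint_adjoint]
  have hle : ∀ b ∈ D, ‖b‖ ≤ 1 → ‖Amp b (Amp c v)‖ ≤ K * ‖b (c e)‖ := fun b hb hb1 => by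
    have hi : ∀ x, ⟪x, (adjoint (b ∘L c) ∘L (b ∘L c)) x⟫ = ⟪b (c x), b (c x)⟫ := fun x => by
      rw [comp_apply, adjoint_inner_right]; rfl
    have hS : c - adjoint (b ∘L c) ∘L (b ∘L c) ∈ S := by
      refine ⟨sub_mem hcD (mul_mem (adj_mem (mul_mem hb hcD)) (mul_mem hb hcD)), fun x => ?_⟩
      obtain ⟨h1, h2, h3⟩ := hcP x
      have him : (⟪b (c x), b (c x)⟫).im = 0 := by simpa using inner_self_im (𝕜 := ℂ) (b (c x))
      rw [sub_apply, inner_sub_right, hi, Complex.sub_im, Complex.sub_re, h1, him, re_self]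
      have h4 := hcP.le x
      have h5 := b.le_of_opNorm_le hb1 (c x)
      rw [one_mul] at h5
      have h6 : ‖b (c x)‖ ^ 2 ≤ ‖c x‖ ^ 2 := by gcongr
      refine ⟨by simp, by linarith, by nlinarith [sq_nonneg ‖b (c x)‖]⟩
    have hm := hmax _ hS
    have hv2 : (⟪v, Amp (adjoint (b ∘L c) ∘L (b ∘L c)) v⟫).re = ‖Amp b (Amp c v)‖ ^ 2 := by
      rw [Amp_comp_apply, Amp_inner_right, Amp_comp_apply, re_self]
    have hsub : Amp (c - adjoint (b ∘L c) ∘L (b ∘L c)) v =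
      Amp c v - Amp (adjoint (b ∘L c) ∘L (b ∘L c)) v := by ext n; simp
    simp only [τ] at hm
    rw [hsub, sub_apply, inner_sub_right, inner_sub_right, Complex.sub_re, Complex.sub_re, hi, re_self,
      hv2] at hm
    refine (sq_le_sq₀ (norm_nonneg _) (by positivity)).1 ?_
    rw [mul_pow]
    nlinarith
  refine ⟨c, hcD, fun h0 => ?_, fun b hb => ?_⟩
  · have h1 := hmax 1 h1S
    simp only [τ] at h1
    have h1e : (1 : H →L[ℂ] H) e = e := rfl
    rw [h0, inner_zero_right, Complex.zero_re, Amp_one, h1e, re_self, re_self, hC, Amp_comp_apply,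
      Amp_inner_right, re_self] at h1
    have : ‖v‖ ^ 2 < (K * ‖e‖) ^ 2 := by gcongr
    nlinarith [sq_nonneg ‖Amp C v‖]
  · by_cases hb0 : b = 0
    · subst hb0
      have : Amp (0 : H →L[ℂ] H) (Amp c v) = 0 := by ext n; simp
      rw [this]; simp
    · have hbp : 0 < ‖b‖ := norm_pos_iff.2 hb0
      have h := hle (((‖b‖ : ℂ))⁻¹ • b) (SMulMemClass.smul_mem _ hb) (by
        rw [norm_smul, norm_inv]; simp [hbp.ne'])
      rw [Amp_smul, smul_apply, smul_apply, norm_smul, norm_smul] at h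
      have h7 : 0 < ‖((‖b‖ : ℂ))⁻¹‖ := by rw [norm_inv]; simp [hb0]
      refine le_of_mul_le_mul_left ?_ h7
      linarith

end MaxL
end OpSynth

namespace OpSynth
open Filter Topology ContinuousLinearMap InnerProductSpace

section ConstL
variable {H : Type*} [NormedAddCommGroup H] [InnerProductSpace ℂ H] [CompleteSpace H]
  {D : StarSubalgebra ℂ (H →L[ℂ] H)}

lemma scal (hD : IsMasa D) {e : H} (he : e ≠ 0) {a : H →L[ℂ] H} (ha : a ∈ D) {ε : ℝ} (hε : 0 < ε) :
    ∃ α : ℂ, ∃ r ∈ D, ‖a (r e) - α • (r e)‖ < ε * ‖r e‖ := by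
  by_contra hcon
  push Not at hcon
  let G := (orb D e).topologicalClosure
  haveI : CompleteSpace G := (orb D e).isClosed_topologicalClosure.completeSpace_coe
  have heG : e ∈ G := Submodule.le_topologicalClosure _ (mem_orb D e)
  haveI : Nontrivial G := ⟨⟨e, heG⟩, 0, fun h => he (congrArg Subtype.val h)⟩
  have hinv : ∀ b ∈ D, ∀ x ∈ G, b x ∈ G := fun b hb x hx =>
    closure_map b (fun y hy => by
      obtain ⟨c, hc, rfl⟩ := hy
      exact Submodule.le_topologicalClosure _ ⟨b * c, mul_mem hb hc, rfl⟩) hx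
  let T : G →L[ℂ] G := a.restrict (hinv a ha)
  have hun : ∀ α : ℂ, IsUnit (algebraMap ℂ (G →L[ℂ] G) α - T) := fun α => by
    have haα : algebraMap ℂ (H →L[ℂ] H) α - a ∈ D := sub_mem (algebraMap_mem _ _) ha
    set c := algebraMap ℂ (H →L[ℂ] H) α - a with hc
    let T' : G →L[ℂ] G := c.restrict (hinv c haα)
    let S' : G →L[ℂ] G := (adjoint c).restrict (hinv _ (adj_mem haα))
    have hT : algebraMap ℂ (G →L[ℂ] G) α - T = T' := by
      ext x; simp [T, T', hc, Algebra.algebraMap_eq_smul_one]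
    have hcomm : Commute S' T' := by
      ext x
      have := congrArg (fun A : H →L[ℂ] H => A x) (hD.1 _ (adj_mem haα) _ haα)
      exact this
    have hb : ∀ x ∈ G, ε * ‖x‖ ≤ ‖c x‖ := by
      have hcl : IsClosed {x : H | ε * ‖x‖ ≤ ‖c x‖} :=
        isClosed_le (by fun_prop) (by fun_prop)
      intro x hx
      refine closure_minimal (s := (orb D e : Set H)) ?_ hcl hx
      rintro _ ⟨r, hr, rfl⟩
      have := hcon α r hr
      change ε * ‖r e‖ ≤ ‖c (r e)‖
      rw [hc]
      rw [norm_sub_rev] at this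
      simpa [Algebra.algebraMap_eq_smul_one] using this
    have hU : IsUnit (S' * T') := by
      refine isUnit_of_forall_le_norm_inner_map (S' * T') (c := ⟨ε ^ 2, by positivity⟩)
        (by change (0:ℝ) < ε ^ 2; positivity) fun x => ?_
      have h1 : ⟪(S' * T') x, x⟫ = ⟪c x, c x⟫ := by
        change ⟪adjoint c (c x), (x : H)⟫ = _
        rw [adjoint_inner_left]
      rw [h1]
      have h2 := hb x x.2
      have h3 : ‖⟪c (x : H), c x⟫‖ = ‖c (x : H)‖ ^ 2 := by
        rw [inner_self_eq_norm_sq_to_K]; simp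
      rw [h3]
      change ‖(x : H)‖ ^ 2 * ε ^ 2 ≤ _
      rw [← mul_pow, mul_comm]
      gcongr
    rw [hT]
    exact (hcomm.isUnit_mul_iff.1 hU).2
  obtain ⟨α, hα⟩ := spectrum.nonempty T
  exact hα (hun α)

lemma Amp_single (b : H →L[ℂ] H) (n : ℕ) (x : H) :
    Amp b (lp.single 2 n x) = lp.single 2 n (b x) := by
  ext m
  rw [Amp_apply, lp.single_apply, lp.single_apply]
  by_cases h : m = n
  · subst h; simp
  · simp [h]

lemma norm_single (n : ℕ) (x : H) : ‖(lp.single 2 n x : L2 H)‖ = ‖x‖ :=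
  lp.norm_single (E := fun _ : ℕ => H) (by norm_num) n x

lemma const_fin (hD : IsMasa D) {e : H} (he : e ≠ 0) {a : ℕ → H →L[ℂ] H} (ha : ∀ n, a n ∈ D)
    {ε : ℝ} (hε : 0 < ε) (N : ℕ) : ∃ α : ℕ → ℂ, ∃ q ∈ D, q e ≠ 0 ∧ ∀ n < N, ∀ b ∈ D,
      ‖b (q (a n e - α n • e))‖ ≤ ε * ‖b (q e)‖ := by
  induction N with
  | zero => exact ⟨0, 1, one_mem _, he, by simp⟩
  | succ N ih =>
    obtain ⟨α, q, hq, hqe, h⟩ := ih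
    obtain ⟨β, r, hr, hβ⟩ := scal hD hqe (ha N) hε
    obtain ⟨q', hq', hq'e, h'⟩ := max_lemma hD (e := r (q e))
      (v := lp.single 2 0 (a N (r (q e)) - β • (r (q e)))) hε.le (by rwa [norm_single])
    refine ⟨fun n => if n = N then β else α n, q' * r * q, mul_mem (mul_mem hq' hr) hq, hq'e, ?_⟩
    intro n hn b hb
    by_cases hnN : n = N
    · subst hnN
      have := h' b hb
      rw [Amp_single, Amp_single, norm_single] at this
      simp only [if_true]
      have e1 : (q' * r * q) (a n e - β • e) = q' (a n (r (q e)) - β • (r (q e))) := by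
        have c1 : q (a n e) = a n (q e) := congrArg (fun A : H →L[ℂ] H => A e) (hD.1 q hq _ (ha n))
        have c2 : r (a n (q e)) = a n (r (q e)) :=
          congrArg (fun A : H →L[ℂ] H => A (q e)) (hD.1 r hr _ (ha n))
        change q' (r (q _)) = _
        rw [map_sub, map_smul, c1, map_sub, map_smul, c2]
      rw [e1]; exact this
    · simp only [hnN, if_false]
      exact h n (by omega) (b * q' * r) (mul_mem (mul_mem hb hq') hr)

lemma const_approx (hD : IsMasa D) {e : H} (he : e ≠ 0) (ξ : L2 H) {ε : ℝ} (hε : 0 < ε) :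
    ∃ (N : ℕ) (a : ℕ → H →L[ℂ] H), (∀ n, a n ∈ D) ∧ ∃ q ∈ D, q e ≠ 0 ∧ ∀ b ∈ D,
      ‖Amp b (Amp q (ξ - ∑ n ∈ Finset.range N, lp.single 2 n (a n e)))‖ ≤ ε * ‖b (q e)‖ := by
  have hep : 0 < ‖e‖ := norm_pos_iff.2 he
  obtain ⟨q₀, hq₀, hq₀e, h₀⟩ := max_lemma hD (e := e) (v := ξ) (K := ‖ξ‖ / ‖e‖ + 1) (by positivity) (by
    rw [add_mul, div_mul_cancel₀ _ hep.ne']; linarith)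
  set δ := ε * ‖q₀ e‖ with hδ
  have hδp : 0 < δ := mul_pos hε (norm_pos_iff.2 hq₀e)
  have hcl : ∀ n, q₀ (ξ n) ∈ (orb D (q₀ e)).topologicalClosure := fun n => by
    have h1 := h₀ (1 - pr (orb D (q₀ e))) (PD_orb hD _).compl.1
    have h2 : (1 - pr (orb D (q₀ e))) (q₀ e) = 0 := by
      simp [pr_of_mem' (mem_orb D (q₀ e))]
    rw [h2, norm_zero, mul_zero] at h1
    have h3 := norm_le_zero_iff.1 h1
    have h4 := congrArg (fun v : L2 H => v n) h3
    have h5 : q₀ (ξ n) - pr (orb D (q₀ e)) (q₀ (ξ n)) = 0 := h4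
    rw [sub_eq_zero.1 h5]
    exact pr_mem _ _
  have hs := (lp.hasSum_single (E := fun _ : ℕ => H) (p := 2) (by norm_num) (Amp q₀ ξ)).tendsto_sum_nat
  obtain ⟨N, hN⟩ := ((Metric.tendsto_nhds.1 hs) (δ / 2) (by positivity)).exists
  have hch : ∀ n, ∃ a ∈ D, ‖q₀ (ξ n) - a (q₀ e)‖ < δ / (2 * (N + 1)) := fun n => by
    obtain ⟨y, ⟨a, ha, rfl⟩, hy⟩ := Metric.mem_closure_iff.1 (hcl n) (δ / (2 * (N + 1))) (by positivity)
    exact ⟨a, ha, by rwa [dist_eq_norm] at hy⟩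
  choose a ha hay using hch
  have hv : ‖Amp q₀ (ξ - ∑ n ∈ Finset.range N, lp.single 2 n (a n e))‖ < ε * ‖q₀ e‖ := by
    have e1 : Amp q₀ (ξ - ∑ n ∈ Finset.range N, lp.single 2 n (a n e)) =
        (Amp q₀ ξ - ∑ n ∈ Finset.range N, lp.single 2 n (Amp q₀ ξ n)) +
        ∑ n ∈ Finset.range N, lp.single 2 n (q₀ (ξ n) - a n (q₀ e)) := by
      rw [map_sub, map_sum]
      have : ∀ n, Amp q₀ (lp.single 2 n (a n e)) = lp.single 2 n (a n (q₀ e)) := fun n => by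
        rw [Amp_single]
        congr 1
        exact congrArg (fun A : H →L[ℂ] H => A e) (hD.1 q₀ hq₀ _ (ha n))
      simp only [this, Amp_apply]
      have h2 : ∀ n, (lp.single 2 n (q₀ (ξ n) - a n (q₀ e)) : L2 H) =
        lp.single 2 n (q₀ (ξ n)) - lp.single 2 n (a n (q₀ e)) := fun n => lp.single_sub _ _ _ _
      simp only [h2, Finset.sum_sub_distrib]
      abel
    rw [e1, ← hδ]
    rw [dist_comm, dist_eq_norm] at hN
    have h3 : ‖∑ n ∈ Finset.range N, (lp.single 2 n (q₀ (ξ n) - a n (q₀ e)) : L2 H)‖ ≤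
        N * (δ / (2 * (N + 1))) := by
      refine (norm_sum_le _ _).trans ?_
      refine (Finset.sum_le_card_nsmul _ _ (δ / (2 * (N + 1))) fun n _ => ?_).trans ?_
      · rw [norm_single]; exact (hay n).le
      · simp
    have h4 : N * (δ / (2 * (N + 1))) ≤ δ / 2 := by
      rw [mul_div_assoc', div_le_div_iff₀ (by positivity) (by norm_num)]
      nlinarith
    refine (norm_add_le _ _).trans_lt ?_
    linarith
  obtain ⟨q₁, hq₁, hq₁e, h₁⟩ := max_lemma hD hε.le hv
  exact ⟨N, a, ha, q₁ * q₀, mul_mem hq₁ hq₀, hq₁e, h₁⟩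

lemma const_lemma (hD : IsMasa D) {e : H} (he : e ≠ 0) (ξ : L2 H) {ε : ℝ} (hε : 0 < ε) :
    ∃ (N : ℕ) (α : ℕ → ℂ), ∃ q ∈ D, q e ≠ 0 ∧ ∀ b ∈ D,
      ‖Amp b (Amp q (ξ - ∑ n ∈ Finset.range N, lp.single 2 n (α n • e)))‖ ≤ ε * ‖b (q e)‖ := by
  obtain ⟨N, a, ha, q, hq, hqe, h⟩ := const_approx hD he ξ (half_pos hε)
  obtain ⟨α, q', hq', hq'e, h'⟩ := const_fin hD hqe ha (ε := ε / (2 * (N + 1))) (by positivity) N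
  refine ⟨N, α, q' * q, mul_mem hq' hq, hq'e, fun b hb => ?_⟩
  have e1 : Amp b (Amp (q' * q) (ξ - ∑ n ∈ Finset.range N, lp.single 2 n (α n • e))) =
      Amp (b * q') (Amp q (ξ - ∑ n ∈ Finset.range N, lp.single 2 n (a n e))) +
      ∑ n ∈ Finset.range N, lp.single 2 n (b (q' (a n (q e) - α n • (q e)))) := by
    have h1 : ∀ n, (lp.single 2 n (b (q' (a n (q e) - α n • (q e)))) : L2 H) =
        Amp (b * q') (Amp q (lp.single 2 n (a n e) - lp.single 2 n (α n • e))) := fun n => by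
      have c1 : q (a n e) = a n (q e) := congrArg (fun A : H →L[ℂ] H => A e) (hD.1 q hq _ (ha n))
      rw [← lp.single_sub, Amp_single, Amp_single, map_sub q, c1, map_smul q]; rfl
    simp only [h1]
    rw [← map_sum, ← map_sum, ← map_add, ← map_add, Finset.sum_sub_distrib, sub_add_sub_cancel]
    rfl
  rw [e1]
  have h3 : ‖∑ n ∈ Finset.range N, (lp.single 2 n (b (q' (a n (q e) - α n • (q e)))) : L2 H)‖ ≤
      N * (ε / (2 * (N + 1)) * ‖b (q' (q e))‖) := by
    refine (norm_sum_le _ _).trans ?_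
    refine (Finset.sum_le_card_nsmul _ _ (ε / (2 * (N + 1)) * ‖b (q' (q e))‖) fun n hn => ?_).trans ?_
    · rw [norm_single]; exact h' n (Finset.mem_range.1 hn) b hb
    · simp
  have h4 : N * (ε / (2 * (N + 1))) ≤ ε / 2 := by
    rw [mul_div_assoc', div_le_div_iff₀ (by positivity) (by norm_num)]
    nlinarith
  have h5 := h (b * q') (mul_mem hb hq')
  change _ ≤ ε / 2 * ‖b (q' (q e))‖ at h5
  change _ ≤ ε * ‖b (q' (q e))‖
  refine (norm_add_le _ _).trans ?_
  have h6 := mul_le_mul_of_nonneg_right h4 (norm_nonneg (b (q' (q e))))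
  linarith

lemma L2_sum_apply {ι : Type*} (s : Finset ι) (f : ι → L2 H) (n : ℕ) :
    (∑ i ∈ s, f i) n = ∑ i ∈ s, f i n := by
  rw [lp.coeFn_sum, Finset.sum_apply]

lemma const_one (hD : IsMasa D) {e : H} (he : e ≠ 0) (h : H) {ε : ℝ} (hε : 0 < ε) :
    ∃ (α : ℂ), ∃ q ∈ D, q e ≠ 0 ∧ ∀ b ∈ D, ‖b (q (h - α • e))‖ ≤ ε * ‖b (q e)‖ := by
  obtain ⟨N, α, q, hq, hqe, hh⟩ := const_lemma hD he (lp.single 2 0 h) hε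
  refine ⟨if 0 < N then α 0 else 0, q, hq, hqe, fun b hb => le_trans ?_ (hh b hb)⟩
  refine le_trans (le_of_eq ?_) (lp.norm_apply_le_norm (by norm_num) _ 0)
  rw [Amp_apply, Amp_apply]
  have e1 : (lp.single 2 0 h - ∑ n ∈ Finset.range N, lp.single 2 n (α n • e) : L2 H) 0 =
      h - (if 0 < N then α 0 else 0) • e := by
    change (lp.single 2 0 h : L2 H) 0 - (∑ n ∈ Finset.range N, lp.single 2 n (α n • e) : L2 H) 0 = _
    rw [L2_sum_apply]
    simp only [lp.single_apply]
    rw [Pi.single_eq_same]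
    congr 1
    by_cases hN : 0 < N
    · rw [Finset.sum_eq_single 0]
      · simp [hN]
      · intro n _ hn
        exact Pi.single_eq_of_ne hn.symm _
      · intro hn; simp at hn; omega
    · have : N = 0 := by omega
      subst this; simp
  rw [e1]

end ConstL
end OpSynth

namespace OpSynth
open Filter Topology ContinuousLinearMap InnerProductSpace

section Supp
variable {H : Type*} [NormedAddCommGroup H] [InnerProductSpace ℂ H] [CompleteSpace H]
  {D : StarSubalgebra ℂ (H →L[ℂ] H)}

lemma masa_apply (hD : IsMasa D) {a b : H →L[ℂ] H} (ha : a ∈ D) (hb : b ∈ D) (x : H) :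
    a (b x) = b (a x) := congrArg (fun A : H →L[ℂ] H => A x) (hD.1 a ha b hb)

lemma supp_lemma (hD : IsMasa D) {W : Set H} (hW : ∀ a ∈ D, ∀ w ∈ W, a w ∈ W) (f₀ : H)
    (h : ∃ w ∈ W, ⟪f₀, w⟫ ≠ 0) : ∃ R ∈ D, R f₀ ≠ 0 ∧
      ∀ q ∈ D, q (R f₀) ≠ 0 → ∃ w ∈ W, ⟪w, q (R f₀)⟫ ≠ 0 := by
  have hR : PD D (pr (Submodule.span ℂ W)) := by
    refine PD_pr hD fun a ha x hx => Submodule.le_topologicalClosure _ ?_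
    induction hx using Submodule.span_induction with
    | mem u hu => exact Submodule.subset_span (hW a ha u hu)
    | zero => rw [map_zero]; exact zero_mem _
    | add a b _ _ ha hb => rw [map_add]; exact add_mem ha hb
    | smul c a _ ha => rw [map_smul]; exact Submodule.smul_mem _ _ ha
  refine ⟨_, hR.1, ?_, fun q hq hne => ?_⟩
  · intro h0
    obtain ⟨w, hw, hwn⟩ := h
    apply hwn
    have := pr_orth (p := Submodule.span ℂ W) (x := f₀) (y := w) (Submodule.subset_span hw)
    rw [h0, sub_zero] at this
    rw [← inner_conj_symm, this, map_zero]
  · by_contra hcon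
    push Not at hcon
    apply hne
    have h1 : pr (Submodule.span ℂ W) (q (pr (Submodule.span ℂ W) f₀)) = 0 := by
      apply pr_zero
      intro y hy
      induction hy using Submodule.span_induction with
      | mem u hu => exact hcon u hu
      | zero => simp
      | add a b _ _ ha hb => rw [inner_add_left, ha, hb, add_zero]
      | smul c a _ ha => rw [inner_smul_left, ha, mul_zero]
    rw [masa_apply hD hR.1 hq, hR.idem] at h1
    exact h1

lemma pr_orb_le (hD : IsMasa D) {P : H →L[ℂ] H} (hP : P ∈ D) {f : H} (hf : P f = f) :
    P ∘L pr (orb D f) = pr (orb D f) := by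
  ext x
  have hcl : IsClosed {y | P y = y} := isClosed_eq P.continuous continuous_id
  refine closure_minimal (s := (orb D f : Set H)) ?_ hcl (pr_mem (orb D f) x)
  rintro _ ⟨b, hb, rfl⟩
  change P (b f) = b f
  rw [masa_apply hD hP hb, hf]

lemma pr_orb_ne {f : H} (hf : f ≠ 0) : pr (orb D f) ≠ 0 := fun h => hf (by
  rw [← pr_of_mem' (mem_orb D f), h]; rfl)

end Supp

section Claim
variable {H₁ H₂ : Type*} [NormedAddCommGroup H₁] [InnerProductSpace ℂ H₁] [CompleteSpace H₁]
  [NormedAddCommGroup H₂] [InnerProductSpace ℂ H₂] [CompleteSpace H₂]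
  {D₁ : StarSubalgebra ℂ (H₁ →L[ℂ] H₁)} {D₂ : StarSubalgebra ℂ (H₂ →L[ℂ] H₂)}

lemma norm_prod_le {T : H₁ →L[ℂ] H₂} {P : H₂ →L[ℂ] H₂} {Q : H₁ →L[ℂ] H₁}
    (hPa : ∀ x y, ⟪P x, y⟫ = ⟪P x, P y⟫) (hQ : ∀ x, ‖Q x‖ ≤ ‖x‖) {c : ℝ} (hc : 0 ≤ c)
    (h : ∀ y x, ‖⟪P y, T (Q x)⟫‖ ≤ c * ‖P y‖ * ‖Q x‖) : ‖P ∘L T ∘L Q‖ ≤ c := by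
  refine opNorm_le_bound _ hc fun x => ?_
  have h1 := h (T (Q x)) x
  rw [hPa, inner_self_eq_norm_sq_to_K] at h1
  have h2 : ‖P (T (Q x))‖ ^ 2 ≤ c * ‖P (T (Q x))‖ * ‖Q x‖ := by simpa using h1
  have h3 := hQ x
  change ‖P (T (Q x))‖ ≤ _
  by_cases h0 : ‖P (T (Q x))‖ = 0
  · rw [h0]; positivity
  · have hp : 0 < ‖P (T (Q x))‖ := lt_of_le_of_ne (norm_nonneg _) (Ne.symm h0)
    have : ‖P (T (Q x))‖ ≤ c * ‖Q x‖ := by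
      refine le_of_mul_le_mul_left ?_ hp
      nlinarith
    exact this.trans (by gcongr)

lemma orb_norm {f : H₂} {e : H₁} {T : H₁ →L[ℂ] H₂} {c : ℝ} (hc : 0 ≤ c)
    (h : ∀ b ∈ D₂, ∀ a ∈ D₁, ‖⟪b f, T (a e)⟫‖ ≤ c * ‖b f‖ * ‖a e‖) :
    ‖pr (orb D₂ f) ∘L T ∘L pr (orb D₁ e)‖ ≤ c := by
  have h1 : ∀ b ∈ D₂, ∀ x ∈ (orb D₁ e).topologicalClosure, ‖⟪b f, T x⟫‖ ≤ c * ‖b f‖ * ‖x‖ := by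
    intro b hb x hx
    have hcl : IsClosed {x | ‖⟪b f, T x⟫‖ ≤ c * ‖b f‖ * ‖x‖} :=
      isClosed_le (by fun_prop) (by fun_prop)
    refine closure_minimal (s := (orb D₁ e : Set H₁)) ?_ hcl hx
    rintro _ ⟨a, ha, rfl⟩
    exact h b hb a ha
  have h2 : ∀ y ∈ (orb D₂ f).topologicalClosure, ∀ x ∈ (orb D₁ e).topologicalClosure,
      ‖⟪y, T x⟫‖ ≤ c * ‖y‖ * ‖x‖ := by
    intro y hy x hx
    have hcl : IsClosed {y | ‖⟪y, T x⟫‖ ≤ c * ‖y‖ * ‖x‖} :=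
      isClosed_le (by fun_prop) (by fun_prop)
    refine closure_minimal (s := (orb D₂ f : Set H₂)) ?_ hcl hy
    rintro _ ⟨b, hb, rfl⟩
    exact h1 b hb x hx
  refine norm_prod_le (fun x y => ?_) (fun x => ?_) hc fun y x => h2 _ (pr_mem _ _) _ (pr_mem _ _)
  · have := adjoint_inner_left (pr (orb D₂ f)) y (pr (orb D₂ f) x)
    rw [pr_adj, ← comp_apply, pr_idem] at this
    exact this
  · have := (pr (orb D₁ e)).le_of_opNorm_le (pr_norm _) x
    simpa using this

/-- normal idempotent bimodule map -/
def BI (D₁ : StarSubalgebra ℂ (H₁ →L[ℂ] H₁)) (D₂ : StarSubalgebra ℂ (H₂ →L[ℂ] H₂))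
    (φ : (H₁ →L[ℂ] H₂) →ₗ[ℂ] (H₁ →L[ℂ] H₂)) : Prop :=
  (∀ ξ η, ∃ ξ' η', ∀ X, om ξ η (φ X) = om ξ' η' X) ∧ (∀ X, φ (φ X) = φ X) ∧
    ∀ X, ∀ A ∈ D₁, ∀ B ∈ D₂, φ (B ∘L X ∘L A) = B ∘L φ X ∘L A

variable {φ : (H₁ →L[ℂ] H₂) →ₗ[ℂ] (H₁ →L[ℂ] H₂)}

lemma BI.apply (hφ : BI D₁ D₂ φ) {a : H₁ →L[ℂ] H₁} {b : H₂ →L[ℂ] H₂} (ha : a ∈ D₁) (hb : b ∈ D₂)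
    (X : H₁ →L[ℂ] H₂) (x : H₁) : b (φ X (a x)) = φ (b ∘L X ∘L a) x := by
  rw [hφ.2.2 X a ha b hb]; rfl

/-- local estimate -/
lemma claim_local (hD₁ : IsMasa D₁) (hD₂ : IsMasa D₂) (hφ : BI D₁ D₂ φ) {f₀ : H₂} {e₀ : H₁}
    (X₀ : H₁ →L[ℂ] H₂) (h₀ : ⟪f₀, φ X₀ e₀⟫ ≠ 0) :
    ∃ R ∈ D₂, ∃ r ∈ D₁, ∃ h : H₂, (∃ X, ⟪R f₀, φ X (r e₀)⟫ ≠ 0) ∧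
      ∀ a ∈ D₁, ∀ b ∈ D₂, ∀ X : H₁ →L[ℂ] H₂, ‖⟪b (R f₀), φ X (a (r e₀))⟫ - ⟪b h, X (a (r e₀))⟫‖ ≤
        1 / 8 * (‖b (R f₀)‖ * ‖X‖ * ‖a (r e₀)‖) := by
  obtain ⟨R₁, hR₁, hR₁f, hR₁s⟩ := supp_lemma hD₂ (W := {w | ∃ X, w = φ X e₀}) (by
    rintro b hb _ ⟨X, rfl⟩
    exact ⟨b ∘L X ∘L 1, hφ.apply (one_mem _) hb X e₀⟩) f₀ ⟨_, ⟨X₀, rfl⟩, h₀⟩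
  obtain ⟨ξ, η, hom⟩ := hφ.1 (lp.single 2 0 e₀) (lp.single 2 0 (R₁ f₀))
  have hf1 : ∀ a ∈ D₁, ∀ b ∈ D₂, ∀ X : H₁ →L[ℂ] H₂,
      ⟪b (R₁ f₀), φ X (a e₀)⟫ = om (Amp a ξ) (Amp b η) X := fun a ha b hb X => by
    have h1 := hom (adjoint b ∘L X ∘L a)
    rw [om_single, ← hφ.apply ha (adj_mem hb), adjoint_inner_right, om_comp_left, om_comp_right,
      adjoint_adjoint] at h1
    exact h1
  have hp : 0 < ‖R₁ f₀‖ := norm_pos_iff.2 hR₁f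
  obtain ⟨C, hC⟩ : ∃ C, C = ‖η‖ / ‖R₁ f₀‖ + 1 := ⟨_, rfl⟩
  have hCp : 0 < C := by rw [hC]; positivity
  obtain ⟨q₂, hq₂, hq₂f, hq₂n⟩ := max_lemma hD₂ (e := R₁ f₀) (v := η) hCp.le (by
    rw [hC, add_mul, div_mul_cancel₀ _ hp.ne']; linarith)
  obtain ⟨_, ⟨X₁, rfl⟩, hX₁⟩ := hR₁s q₂ hq₂ hq₂f
  set f := q₂ (R₁ f₀) with hf
  obtain ⟨R₂, hR₂, hR₂e, hR₂s⟩ := supp_lemma hD₁ (W := {w | ∃ X, w = adjoint (φ X) f}) (by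
    rintro a ha _ ⟨X, rfl⟩
    refine ⟨1 ∘L X ∘L adjoint a, ?_⟩
    rw [hφ.2.2 X _ (adj_mem ha) 1 (one_mem _), adjoint_comp, adjoint_comp, adjoint_adjoint]
    have : adjoint (1 : H₂ →L[ℂ] H₂) = 1 := star_one _
    rw [this]; rfl) e₀ ⟨_, ⟨X₁, rfl⟩, by rwa [adjoint_inner_right]⟩
  obtain ⟨N, α, q₁, hq₁, hq₁e, hq₁n⟩ := const_lemma hD₁ hR₂e (Amp R₂ ξ) (ε := 1 / (8 * C)) (by positivity)
  obtain ⟨_, ⟨X₂, rfl⟩, hX₂⟩ := hR₂s q₁ hq₁ hq₁e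
  refine ⟨q₂ * R₁, mul_mem hq₂ hR₁, q₁ * R₂, mul_mem hq₁ hR₂,
    ∑ n ∈ Finset.range N, (starRingEnd ℂ (α n)) • (Amp q₂ η) n, ⟨X₂, ?_⟩, ?_⟩
  · rw [adjoint_inner_left] at hX₂; exact hX₂
  · intro a ha b hb X
    change ‖⟪b f, φ X (a (q₁ (R₂ e₀)))⟫ - _‖ ≤ 1 / 8 * (‖b f‖ * ‖X‖ * ‖a (q₁ (R₂ e₀))‖)
    have h1 := hf1 (a * q₁ * R₂) (mul_mem (mul_mem ha hq₁) hR₂) (b * q₂) (mul_mem hb hq₂) X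
    have h2 : ⟪b (∑ n ∈ Finset.range N, (starRingEnd ℂ (α n)) • (Amp q₂ η) n), X (a (q₁ (R₂ e₀)))⟫ =
        ⟪Amp b (Amp q₂ η), Amp X (Amp a (Amp q₁ (∑ n ∈ Finset.range N, lp.single 2 n (α n • (R₂ e₀)))))⟫ := by
      simp only [map_sum]
      rw [inner_sum, sum_inner]
      refine Finset.sum_congr rfl fun n _ => ?_
      rw [Amp_single, Amp_single]
      have : Amp X (lp.single 2 n (a (q₁ (α n • R₂ e₀)))) = lp.single 2 n (X (a (q₁ (α n • R₂ e₀)))) := by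
        ext m
        rw [Amp_apply, lp.single_apply, lp.single_apply]
        by_cases h : m = n
        · subst h; simp
        · simp [h]
      rw [this, lp.inner_single_right]
      simp only [map_smul, inner_smul_left, inner_smul_right, Amp_apply]
      simp
    have h3 : ⟪b f, φ X (a (q₁ (R₂ e₀)))⟫ -
        ⟪b (∑ n ∈ Finset.range N, (starRingEnd ℂ (α n)) • (Amp q₂ η) n), X (a (q₁ (R₂ e₀)))⟫ =
        ⟪Amp b (Amp q₂ η), Amp X (Amp a (Amp q₁ (Amp R₂ ξ -
          ∑ n ∈ Finset.range N, lp.single 2 n (α n • (R₂ e₀)))))⟫ := by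
      rw [h2]
      simp only [map_sub, inner_sub_right]
      rw [show ⟪b f, φ X (a (q₁ (R₂ e₀)))⟫ = _ from h1]
      rfl
    change ‖⟪b f, φ X (a (q₁ (R₂ e₀)))⟫ - ⟪b _, X (a (q₁ (R₂ e₀)))⟫‖ ≤ _
    rw [h3]
    refine (norm_inner_le_norm _ _).trans ?_
    have h4 := hq₂n b hb
    have h5 := hq₁n a ha
    have h6 := (Amp X).le_of_opNorm_le (Amp_norm_le X) (Amp a (Amp q₁ (Amp R₂ ξ -
          ∑ n ∈ Finset.range N, lp.single 2 n (α n • (R₂ e₀)))))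
    calc _ ≤ (C * ‖b f‖) * (‖X‖ * (1 / (8 * C) * ‖a (q₁ (R₂ e₀))‖)) := by
            gcongr
            exact h6.trans (by gcongr)
      _ = _ := by field_simp

lemma BI.fix {P : H₂ →L[ℂ] H₂} {Q : H₁ →L[ℂ] H₁} (hφ : BI D₁ D₂ φ) (hP : PD D₂ P) (hQ : PD D₁ Q)
    (X : H₁ →L[ℂ] H₂) : P ∘L φ (P ∘L X ∘L Q) ∘L Q = φ (P ∘L X ∘L Q) := by
  rw [← hφ.2.2 _ Q hQ.1 P hP.1]
  congr 1
  ext x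
  simp [hP.idem, hQ.idem]

lemma claim1 (hD₁ : IsMasa D₁) (hD₂ : IsMasa D₂) (hφ : BI D₁ D₂ φ) {P₀ : H₂ →L[ℂ] H₂}
    {Q₀ : H₁ →L[ℂ] H₁} (hP₀ : PD D₂ P₀) (hQ₀ : PD D₁ Q₀) (X₀ : H₁ →L[ℂ] H₂)
    (h₀ : P₀ ∘L φ X₀ ∘L Q₀ ≠ 0) :
    ∃ P Q, PD D₂ P ∧ PD D₁ Q ∧ P ≠ 0 ∧ Q ≠ 0 ∧ P₀ ∘L P = P ∧ Q₀ ∘L Q = Q ∧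
      ∀ Y, φ (P ∘L Y ∘L Q) = P ∘L Y ∘L Q := by
  obtain ⟨x, hx⟩ : ∃ x, P₀ (φ X₀ (Q₀ x)) ≠ 0 := by
    by_contra hcon
    push Not at hcon
    exact h₀ (by ext x; exact hcon x)
  obtain ⟨R, hR, r, hr, h, ⟨X₁, hX₁⟩, hest⟩ := claim_local hD₁ hD₂ hφ (f₀ := P₀ (φ X₀ (Q₀ x)))
    (e₀ := Q₀ x) X₀ (by
      rw [← hP₀.idem, ← adjoint_inner_right, hP₀.2.2]
      exact inner_self_ne_zero.2 hx)
  have hPf : P₀ (R (P₀ (φ X₀ (Q₀ x)))) = R (P₀ (φ X₀ (Q₀ x))) := by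
    rw [masa_apply hD₂ hP₀.1 hR, hP₀.idem]
  have hQe : Q₀ (r (Q₀ x)) = r (Q₀ x) := by
    rw [masa_apply hD₁ hQ₀.1 hr, hQ₀.idem]
  set f := R (P₀ (φ X₀ (Q₀ x)))
  set e := r (Q₀ x)
  clear_value f e
  have he : e ≠ 0 := fun h0 => hX₁ (by rw [h0, map_zero, inner_zero_right])
  by_cases hA : ∀ b ∈ D₂, ‖b h‖ ≤ 1 / 2 * ‖b f‖
  · exfalso
    have hb : ∀ X, ‖pr (orb D₂ f) ∘L φ X ∘L pr (orb D₁ e)‖ ≤ 5 / 8 * ‖X‖ := fun X => by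
      refine orb_norm (by positivity) fun b hb a ha => ?_
      have h1 := hest a ha b hb X
      have h2 : ‖⟪b h, X (a e)⟫‖ ≤ (1 / 2 * ‖b f‖) * (‖X‖ * ‖a e‖) := by
        refine (norm_inner_le_norm _ _).trans ?_
        have := hA b hb
        have := X.le_opNorm (a e)
        gcongr
      have h3 := norm_sub_norm_le ⟪b f, φ X (a e)⟫ ⟪b h, X (a e)⟫
      linarith
    have h1 := hb (φ (pr (orb D₂ f) ∘L X₁ ∘L pr (orb D₁ e)))
    rw [hφ.2.1, hφ.fix (PD_orb hD₂ f) (PD_orb hD₁ e)] at h1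
    have h2 : φ (pr (orb D₂ f) ∘L X₁ ∘L pr (orb D₁ e)) = 0 := by
      rw [← norm_le_zero_iff]
      linarith [norm_nonneg (φ (pr (orb D₂ f) ∘L X₁ ∘L pr (orb D₁ e)))]
    rw [hφ.2.2 _ _ (PD_orb hD₁ e).1 _ (PD_orb hD₂ f).1] at h2
    have h3 := congrArg (fun A => ⟪f, A e⟫) h2
    simp only [comp_apply, zero_apply, inner_zero_right] at h3
    rw [pr_of_mem' (mem_orb D₁ e), ← adjoint_inner_left, pr_adj, pr_of_mem' (mem_orb D₂ f)] at h3
    exact hX₁ h3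
  · push Not at hA
    obtain ⟨b₀, hb₀, hb₀n⟩ := hA
    obtain ⟨q, hq, hqh, hqn⟩ := max_lemma hD₂ (e := b₀ h) (v := lp.single 2 0 (b₀ f)) (K := 2)
      (by norm_num) (by rw [norm_single]; linarith)
    have hf1 : q (b₀ f) ≠ 0 := fun h0 => by
      have h1 := hest 1 (one_mem _) (q * b₀) (mul_mem hq hb₀) (rankOne ℂ (q (b₀ h)) e)
      change ‖⟪q (b₀ f), φ _ _⟫ - ⟪q (b₀ h), rankOne ℂ (q (b₀ h)) e e⟫‖ ≤
        1 / 8 * (‖q (b₀ f)‖ * _ * _) at h1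
      rw [h0, norm_zero, inner_zero_left, zero_sub, norm_neg, rankOne_apply, inner_smul_right,
        inner_self_eq_norm_sq_to_K, inner_self_eq_norm_sq_to_K] at h1
      have h2 : ‖e‖ ^ 2 * ‖q (b₀ h)‖ ^ 2 ≤ 0 := by simpa using h1
      have h3 : 0 < ‖e‖ ^ 2 * ‖q (b₀ h)‖ ^ 2 := by
        have := norm_pos_iff.2 he
        have := norm_pos_iff.2 hqh
        positivity
      linarith
    obtain ⟨β, q₂, hq₂, hq₂f, hq₂n⟩ := const_one hD₂ hf1 (q (b₀ h)) (ε := 1 / 8) (by norm_num)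
    have hβ : 3 / 8 ≤ ‖β‖ := by
      have h1 := hqn q₂ hq₂
      rw [Amp_single, Amp_single, norm_single] at h1
      have h2 := hq₂n 1 (one_mem _)
      change ‖q₂ _‖ ≤ 1 / 8 * ‖q₂ _‖ at h2
      rw [map_sub, map_smul] at h2
      have h3 := norm_sub_norm_le (q₂ (q (b₀ h))) (β • q₂ (q (b₀ f)))
      rw [norm_smul] at h3
      have h4 := norm_pos_iff.2 hq₂f
      refine le_of_mul_le_mul_right ?_ h4
      linarith
    set f₂ := q₂ (q (b₀ f)) with hf₂
    have hP := PD_orb hD₂ f₂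
    have hQ := PD_orb hD₁ e
    refine ⟨pr (orb D₂ f₂), pr (orb D₁ e), hP, hQ, pr_orb_ne hq₂f,
      pr_orb_ne he, pr_orb_le hD₂ hP₀.1 ?_, pr_orb_le hD₁ hQ₀.1 hQe, fun X => ?_⟩
    · rw [hf₂, masa_apply hD₂ hP₀.1 hq₂, masa_apply hD₂ hP₀.1 hq, masa_apply hD₂ hP₀.1 hb₀, hPf]
    · have hb : ∀ Y, ‖pr (orb D₂ f₂) ∘L (φ Y - (starRingEnd ℂ β) • Y) ∘L pr (orb D₁ e)‖ ≤ 1 / 4 * ‖Y‖ :=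
        fun Y => by
        refine orb_norm (by positivity) fun b hb a ha => ?_
        have h1 := hest a ha (b * q₂ * q * b₀) (mul_mem (mul_mem (mul_mem hb hq₂) hq) hb₀) Y
        change ‖⟪b f₂, φ Y (a e)⟫ - ⟪b (q₂ (q (b₀ h))), Y (a e)⟫‖ ≤ 1 / 8 * (‖b f₂‖ * _ * _) at h1
        have h2 := hq₂n b hb
        have e1 : ⟪b f₂, (φ Y - (starRingEnd ℂ β) • Y) (a e)⟫ =
            (⟪b f₂, φ Y (a e)⟫ - ⟪b (q₂ (q (b₀ h))), Y (a e)⟫) +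
            ⟪b (q₂ (q (b₀ h) - β • q (b₀ f))), Y (a e)⟫ := by
          simp only [map_sub, map_smul, inner_sub_left, inner_smul_left, sub_apply, inner_sub_right,
            smul_apply, inner_smul_right]
          rw [hf₂]; ring
        rw [e1]
        refine (norm_add_le _ _).trans ?_
        have h3 : ‖⟪b (q₂ (q (b₀ h) - β • q (b₀ f))), Y (a e)⟫‖ ≤ (1 / 8 * ‖b f₂‖) * (‖Y‖ * ‖a e‖) := by
          refine (norm_inner_le_norm _ _).trans ?_
          have := Y.le_opNorm (a e)
          gcongr
        linarith
      have hY := hb (pr (orb D₂ f₂) ∘L X ∘L pr (orb D₁ e) - φ (pr (orb D₂ f₂) ∘L X ∘L pr (orb D₁ e)))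
      set Z := pr (orb D₂ f₂) ∘L X ∘L pr (orb D₁ e) with hZ
      have h1 : φ (Z - φ Z) = 0 := by rw [map_sub, hφ.2.1, sub_self]
      have h2 : pr (orb D₂ f₂) ∘L (Z - φ Z) ∘L pr (orb D₁ e) = Z - φ Z := by
        rw [sub_comp, comp_sub, hZ, hφ.fix hP hQ]
        congr 1
        ext x; simp [hP.idem, hQ.idem]
      rw [h1, zero_sub, neg_comp, comp_neg, smul_comp, comp_smul, h2, norm_neg, norm_smul,
        RCLike.norm_conj] at hY
      have h3 : ‖Z - φ Z‖ ≤ 0 := by nlinarith [norm_nonneg (Z - φ Z)]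
      exact (sub_eq_zero.1 (norm_le_zero_iff.1 h3)).symm

end Claim
end OpSynth

namespace OpSynth
open Filter Topology ContinuousLinearMap InnerProductSpace

section Str
variable {H₁ H₂ : Type*} [NormedAddCommGroup H₁] [InnerProductSpace ℂ H₁] [CompleteSpace H₁]
  [NormedAddCommGroup H₂] [InnerProductSpace ℂ H₂] [CompleteSpace H₂]
  {D₁ : StarSubalgebra ℂ (H₁ →L[ℂ] H₁)} {D₂ : StarSubalgebra ℂ (H₂ →L[ℂ] H₂)}
  {φ ψ : (H₁ →L[ℂ] H₂) →ₗ[ℂ] (H₁ →L[ℂ] H₂)}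

lemma BI.compl (hφ : BI D₁ D₂ φ) : BI D₁ D₂ (LinearMap.id - φ) := by
  refine ⟨fun ξ η => ?_, fun X => ?_, fun X A hA B hB => ?_⟩
  · obtain ⟨ξ', η', h⟩ := hφ.1 ξ η
    have hm : om ξ η - om ξ' η' ∈ Pre H₁ H₂ := sub_mem ⟨ξ, η, rfl⟩ ⟨ξ', η', rfl⟩
    obtain ⟨ξ'', η'', h''⟩ := hm
    refine ⟨ξ'', η'', fun X => ?_⟩
    rw [← h'']
    simp [h]
  · simp [hφ.2.1]
  · simp [hφ.2.2 X A hA B hB, sub_comp, comp_sub]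

lemma PD.exists_unit {D : StarSubalgebra ℂ (H₁ →L[ℂ] H₁)} {P : H₁ →L[ℂ] H₁} (h : PD D P) (h0 : P ≠ 0) :
    ∃ f, ‖f‖ = 1 ∧ P f = f := by
  obtain ⟨x, hx⟩ : ∃ x, P x ≠ 0 := by
    by_contra hc
    push Not at hc
    exact h0 (by ext x; exact hc x)
  refine ⟨((‖P x‖ : ℂ))⁻¹ • P x, ?_, by rw [map_smul, h.idem]⟩
  rw [norm_smul, norm_inv]
  have : ‖P x‖ ≠ 0 := norm_ne_zero_iff.2 hx
  simp [this]

lemma rankOne_ne {f : H₂} {e : H₁} (hf : ‖f‖ = 1) (he : ‖e‖ = 1) : rankOne ℂ f e ≠ 0 := fun h => by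
  have := norm_rankOne (𝕜 := ℂ) f e
  rw [h, hf, he] at this
  simp at this

lemma comp_rankOne_comp {P : H₂ →L[ℂ] H₂} {Q : H₁ →L[ℂ] H₁} (hQ : adjoint Q = Q) (f : H₂) (e : H₁) :
    P ∘L rankOne ℂ f e ∘L Q = rankOne ℂ (P f) (Q e) := by
  ext x
  simp only [comp_apply, rankOne_apply, map_smul]
  rw [← adjoint_inner_left, hQ]

/-- no 2x2 corner -/
lemma two_by_two (hc : ∀ X, ‖ψ X‖ ≤ ‖X‖) {f₁ f₂ : H₂} {e₁ e₂ : H₁} (hf₁ : ‖f₁‖ = 1) (hf₂ : ‖f₂‖ = 1)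
    (he₁ : ‖e₁‖ = 1) (he₂ : ‖e₂‖ = 1) (hf : ⟪f₁, f₂⟫ = 0) (he : ⟪e₁, e₂⟫ = 0)
    (h11 : ψ (rankOne ℂ f₁ e₁) = rankOne ℂ f₁ e₁) (h12 : ψ (rankOne ℂ f₁ e₂) = rankOne ℂ f₁ e₂)
    (h21 : ψ (rankOne ℂ f₂ e₁) = rankOne ℂ f₂ e₁) (h22 : ψ (rankOne ℂ f₂ e₂) = 0) : False := by
  have hnorm : ∀ a b : ℂ, ‖a • f₁ + b • f₂‖ ^ 2 = ‖a‖ ^ 2 + ‖b‖ ^ 2 := fun a b => by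
    have := norm_add_sq_eq_norm_sq_add_norm_sq_of_inner_eq_zero (𝕜 := ℂ) (a • f₁) (b • f₂)
      (by rw [inner_smul_left, inner_smul_right, hf]; simp)
    rw [norm_smul, norm_smul, hf₁, hf₂] at this
    rw [sq, this]; ring
  have he' : ⟪e₂, e₁⟫ = 0 := by rw [← inner_conj_symm, he, map_zero]
  have ho : Orthonormal ℂ ![e₁, e₂] := by
    rw [orthonormal_iff_ite]
    intro i j
    fin_cases i <;> fin_cases j <;>
      simp [inner_self_eq_norm_sq_to_K, he₁, he₂, he, he']
  have hb : ∀ v, ‖⟪e₁, v⟫‖ ^ 2 + ‖⟪e₂, v⟫‖ ^ 2 ≤ ‖v‖ ^ 2 := fun v => by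
    have := ho.sum_inner_products_le v (s := Finset.univ)
    simpa [Fin.sum_univ_two] using this
  set X := rankOne ℂ f₁ e₁ + rankOne ℂ f₁ e₂ + rankOne ℂ f₂ e₁ - rankOne ℂ f₂ e₂ with hX
  have hXn : ‖X‖ ≤ √2 := by
    refine opNorm_le_bound _ (by positivity) fun v => ?_
    refine (sq_le_sq₀ (norm_nonneg _) (by positivity)).1 ?_
    have e1 : X v = (⟪e₁, v⟫ + ⟪e₂, v⟫) • f₁ + (⟪e₁, v⟫ - ⟪e₂, v⟫) • f₂ := by
      simp only [hX, add_apply, sub_apply, rankOne_apply]; module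
    rw [e1, hnorm, mul_pow, Real.sq_sqrt (by norm_num)]
    have h1 := parallelogram_law_with_norm ℂ (⟪e₁, v⟫) (⟪e₂, v⟫)
    nlinarith [hb v]
  have h1 := (ψ X).le_of_opNorm_le ((hc X).trans hXn) ((3 : ℂ) • e₁ + (2 : ℂ) • e₂)
  have hψX : ψ X = rankOne ℂ f₁ e₁ + rankOne ℂ f₁ e₂ + rankOne ℂ f₂ e₁ := by
    rw [hX, map_sub, map_add, map_add, h11, h12, h21, h22, sub_zero]
  have e2 : ψ X ((3 : ℂ) • e₁ + (2 : ℂ) • e₂) = (5 : ℂ) • f₁ + (3 : ℂ) • f₂ := by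
    rw [hψX]
    simp only [add_apply, sub_zero, rankOne_apply, inner_add_right, inner_smul_right, he, he',
      inner_self_eq_norm_sq_to_K, he₁, he₂]
    simp only [RCLike.ofReal_one]
    module
  rw [e2] at h1
  have h2 := (sq_le_sq₀ (norm_nonneg _) (by positivity)).2 h1
  rw [hnorm, mul_pow, Real.sq_sqrt (by norm_num)] at h2
  have h3 := norm_add_sq_eq_norm_sq_add_norm_sq_of_inner_eq_zero (𝕜 := ℂ) ((3 : ℂ) • e₁) ((2 : ℂ) • e₂)
      (by rw [inner_smul_left, inner_smul_right, he]; simp)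
  rw [norm_smul, norm_smul, he₁, he₂] at h3
  rw [sq ‖(3 : ℂ) • e₁ + (2 : ℂ) • e₂‖, h3] at h2
  norm_num at h2

/-- full rectangle -/
def Full (ψ : (H₁ →L[ℂ] H₂) →ₗ[ℂ] (H₁ →L[ℂ] H₂)) (P : H₂ →L[ℂ] H₂) (Q : H₁ →L[ℂ] H₁) : Prop :=
  ∀ f e, P f = f → Q e = e → ψ (rankOne ℂ f e) = rankOne ℂ f e

lemma Full.mono {P P' : H₂ →L[ℂ] H₂} {Q Q' : H₁ →L[ℂ] H₁} (h : Full ψ P Q) (hP : P ∘L P' = P')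
    (hQ : Q ∘L Q' = Q') : Full ψ P' Q' := fun f e hf he => h f e
  (by rw [← hf, ← comp_apply, hP]) (by rw [← he, ← comp_apply, hQ])

lemma full_of {P : H₂ →L[ℂ] H₂} {Q : H₁ →L[ℂ] H₁} (hQ : PD D₁ Q)
    (h : ∀ Y, ψ (P ∘L Y ∘L Q) = P ∘L Y ∘L Q) : Full ψ P Q := fun f e hf he => by
  have := h (rankOne ℂ f e)
  rwa [comp_rankOne_comp hQ.2.2, hf, he] at this

lemma exists_zero (hD₁ : IsMasa D₁) (hD₂ : IsMasa D₂) (hψ : BI D₁ D₂ ψ) {P : H₂ →L[ℂ] H₂}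
    {Q : H₁ →L[ℂ] H₁} (hP : PD D₂ P) (hQ : PD D₁ Q) {Y : H₁ →L[ℂ] H₂}
    (h : ψ (P ∘L Y ∘L Q) ≠ P ∘L Y ∘L Q) : ∃ P' Q', PD D₂ P' ∧ PD D₁ Q' ∧ P' ≠ 0 ∧ Q' ≠ 0 ∧
      P ∘L P' = P' ∧ Q ∘L Q' = Q' ∧ ∀ f e, P' f = f → Q' e = e → ψ (rankOne ℂ f e) = 0 := by
  obtain ⟨P', Q', hP', hQ', h1, h2, h3, h4, h5⟩ := claim1 hD₁ hD₂ hψ.compl hP hQ Y (by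
    rw [← hψ.compl.2.2 Y Q hQ.1 P hP.1]
    intro h0
    apply h
    simp only [LinearMap.sub_apply, LinearMap.id_apply] at h0
    exact (sub_eq_zero.1 h0).symm)
  refine ⟨P', Q', hP', hQ', h1, h2, h3, h4, fun f e hf he => ?_⟩
  have := h5 (rankOne ℂ f e)
  rw [comp_rankOne_comp hQ'.2.2, hf, he] at this
  simpa using this

lemma Full.all (hD₁ : IsMasa D₁) (hD₂ : IsMasa D₂) (hψ : BI D₁ D₂ ψ) {P : H₂ →L[ℂ] H₂}
    {Q : H₁ →L[ℂ] H₁} (hP : PD D₂ P) (hQ : PD D₁ Q) (h : Full ψ P Q) (Y : H₁ →L[ℂ] H₂) :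
    ψ (P ∘L Y ∘L Q) = P ∘L Y ∘L Q := by
  by_contra hc
  obtain ⟨P', Q', hP', hQ', h1, h2, h3, h4, h5⟩ := exists_zero hD₁ hD₂ hψ hP hQ hc
  obtain ⟨f, hf, hPf⟩ := hP'.exists_unit h1
  obtain ⟨e, he, hQe⟩ := hQ'.exists_unit h2
  have := h.mono h3 h4 f e hPf hQe
  rw [h5 f e hPf hQe] at this
  exact rankOne_ne hf he this.symm

/-- commuting pairs -/
def CP (D₁ : StarSubalgebra ℂ (H₁ →L[ℂ] H₁)) (D₂ : StarSubalgebra ℂ (H₂ →L[ℂ] H₂))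
    (M : Set (H₁ →L[ℂ] H₂)) : Set ((H₂ →L[ℂ] H₂) × (H₁ →L[ℂ] H₁)) :=
  {c | PD D₂ c.1 ∧ PD D₁ c.2 ∧ ∀ X ∈ M, c.1 ∘L X = X ∘L c.2}

lemma ortho_of {D : StarSubalgebra ℂ (H₁ →L[ℂ] H₁)} {P : H₁ →L[ℂ] H₁} (h : PD D P) {x y : H₁}
    (hx : P x = x) (hy : P y = 0) : ⟪x, y⟫ = 0 := by
  rw [← hx, ← adjoint_inner_right, h.2.2, hy, inner_zero_right]

lemma compl_le {P P' : H₁ →L[ℂ] H₁} (h : (1 - P) ∘L P' = P') {x : H₁} (hx : P' x = x) : P x = 0 := by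
  have := congrArg (fun A => A x) h
  simp only [comp_apply, hx, sub_apply] at this
  have h2 : x - P x = x := this
  simpa using h2

lemma isClosed_fix (hc : ∀ X, ‖ψ X‖ ≤ ‖X‖) : IsClosed {X | ψ X = X} := by
  have : Continuous ψ := (ψ.mkContinuous 1 (by simpa using hc)).continuous
  exact isClosed_eq this continuous_id

/-- the key lemma about maximal rectangles -/
lemma exists_hat (hD₁ : IsMasa D₁) (hD₂ : IsMasa D₂) (hψ : BI D₁ D₂ ψ) (hc : ∀ X, ‖ψ X‖ ≤ ‖X‖)
    {P₀ : H₂ →L[ℂ] H₂} {Q₀ : H₁ →L[ℂ] H₁} (hP₀ : PD D₂ P₀) (hQ₀ : PD D₁ Q₀) (hP0 : P₀ ≠ 0) (hQ0 : Q₀ ≠ 0)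
    (h : Full ψ P₀ Q₀) : ∃ P Q, (P, Q) ∈ CP D₁ D₂ (range ψ) ∧ P ∘L P₀ = P₀ ∧
      ∀ Y, ψ (P ∘L Y ∘L Q) = P ∘L Y ∘L Q := by
  have hcl := isClosed_fix hc
  let p : Submodule ℂ H₂ :=
    { carrier := {f | ∀ e, Q₀ e = e → ψ (rankOne ℂ f e) = rankOne ℂ f e}
      add_mem' := fun ha hb e he => by simp only [map_add, add_apply]; rw [ha e he, hb e he]
      zero_mem' := fun e he => by simp
      smul_mem' := fun c x hx e he => by simp only [map_smul, smul_apply]; rw [hx e he] }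
  let q : Submodule ℂ H₁ :=
    { carrier := {e | ∀ f ∈ p, ψ (rankOne ℂ f e) = rankOne ℂ f e}
      add_mem' := fun ha hb f hf => by simp only [map_add]; rw [ha f hf, hb f hf]
      zero_mem' := fun f hf => by simp
      smul_mem' := fun c x hx f hf => by simp only [map_smulₛₗ, map_smul]; rw [hx f hf]; rfl }
  have hpc : IsClosed (p : Set H₂) := by
    have : (p : Set H₂) = ⋂ (e) (_ : Q₀ e = e), (fun f => rankOne ℂ f e) ⁻¹' {X | ψ X = X} := by
      ext f; simp only [mem_iInter]; rfl
    rw [this]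
    exact isClosed_iInter fun e => isClosed_iInter fun _ =>
      hcl.preimage ((rankOne ℂ (E := H₂) (F := H₁)).flip e).continuous
  have hqc : IsClosed (q : Set H₁) := by
    have : (q : Set H₁) = ⋂ (f) (_ : f ∈ p), (fun e => rankOne ℂ f e) ⁻¹' {X | ψ X = X} := by
      ext f; simp only [mem_iInter]; rfl
    rw [this]
    exact isClosed_iInter fun f => isClosed_iInter fun _ =>
      hcl.preimage ((rankOne ℂ (E := H₂) (F := H₁)) f).continuous
  have hrk : ∀ f e, ∀ b ∈ D₂, ∀ a ∈ D₁, ψ (rankOne ℂ f e) = rankOne ℂ f e →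
      ψ (rankOne ℂ (b f) (a e)) = rankOne ℂ (b f) (a e) := by
    intro f e b hb a ha hfe
    have e1 : rankOne ℂ (b f) (a e) = b ∘L rankOne ℂ f e ∘L adjoint a := by
      ext x; simp only [comp_apply, rankOne_apply, map_smul, adjoint_inner_right]
    rw [e1, hψ.2.2 _ _ (adj_mem ha) _ hb, hfe]
  have hpD : PD D₂ (pr p) := PD_pr hD₂ fun b hb f hf => Submodule.le_topologicalClosure _ fun e he =>
    hrk f e b hb 1 (one_mem _) (hf e he)
  have hqD : PD D₁ (pr q) := PD_pr hD₁ fun a ha e he => Submodule.le_topologicalClosure _ fun f hf =>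
    hrk f e 1 (one_mem _) a ha (he f hf)
  have hpm : ∀ f, pr p f = f ↔ f ∈ p := fun f => ⟨fun hf => by
    have := pr_mem p f
    rwa [hpc.submodule_topologicalClosure_eq, hf] at this, fun hf => pr_of_mem' hf⟩
  have hqm : ∀ f, pr q f = f ↔ f ∈ q := fun f => ⟨fun hf => by
    have := pr_mem q f
    rwa [hqc.submodule_topologicalClosure_eq, hf] at this, fun hf => pr_of_mem' hf⟩
  have hfull : Full ψ (pr p) (pr q) := fun f e hf he => (hqm e).1 he f ((hpm f).1 hf)
  have hP₀p : ∀ f, P₀ f = f → f ∈ p := fun f hf e he => h f e hf he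
  have hQ₀q : ∀ e, Q₀ e = e → e ∈ q := fun e he f hf => hf e he
  obtain ⟨f₀, hf₀, hf₀P⟩ := hP₀.exists_unit hP0
  obtain ⟨e₀, he₀, he₀Q⟩ := hQ₀.exists_unit hQ0
  have z1 : ∀ X, pr p ∘L ψ X ∘L (1 - pr q) = 0 := fun X => by
    by_contra hne
    obtain ⟨P', Q', hP', hQ', hP'0, hQ'0, hP'l, hQ'l, hfu⟩ := claim1 hD₁ hD₂ hψ hpD hqD.compl X hne
    have hfu' := full_of hQ' hfu
    have hff : ∀ Y, ψ (pr p ∘L Y ∘L Q') = pr p ∘L Y ∘L Q' := fun Y => by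
      by_contra hcon
      obtain ⟨P'', Q'', hP'', hQ'', hP''0, hQ''0, hP''l, hQ''l, hz⟩ := exists_zero hD₁ hD₂ hψ hpD hQ' hcon
      obtain ⟨f₁, hf₁, hf₁P⟩ := hP'.exists_unit hP'0
      obtain ⟨f₂, hf₂, hf₂P⟩ := hP''.exists_unit hP''0
      obtain ⟨e₂, he₂, he₂Q⟩ := hQ''.exists_unit hQ''0
      have he₂Q' : Q' e₂ = e₂ := by rw [← he₂Q, ← comp_apply, hQ''l]
      have hf₁p : pr p f₁ = f₁ := by rw [← hf₁P, ← comp_apply, hP'l]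
      have hf₂p : pr p f₂ = f₂ := by rw [← hf₂P, ← comp_apply, hP''l]
      have horth : P' f₂ = 0 := by
        by_contra hn
        have e1 : P'' (P' f₂) = P' f₂ := by rw [masa_apply hD₂ hP''.1 hP'.1, hf₂P]
        have e2 := hfu' (P' f₂) e₂ (hP'.idem _) he₂Q'
        rw [hz _ _ e1 he₂Q] at e2
        have := norm_rankOne (𝕜 := ℂ) (P' f₂) e₂
        rw [← e2, he₂, norm_zero, mul_one] at this
        exact hn (norm_eq_zero.1 this.symm)
      exact two_by_two hc hf₁ hf₂ he₀ he₂ (ortho_of hP' hf₁P horth)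
        (ortho_of hqD ((hqm _).2 (hQ₀q _ he₀Q)) (compl_le hQ'l he₂Q'))
        (hfull _ _ hf₁p ((hqm _).2 (hQ₀q _ he₀Q))) (hfu' _ _ hf₁P he₂Q')
        (hfull _ _ hf₂p ((hqm _).2 (hQ₀q _ he₀Q))) (hz _ _ hf₂P he₂Q)
    obtain ⟨e, he, heQ⟩ := hQ'.exists_unit hQ'0
    have h1 : e ∈ q := fun f hf => full_of hQ' hff f e ((hpm f).2 hf) heQ
    have h2 := compl_le hQ'l heQ
    rw [(hqm e).2 h1] at h2
    rw [h2, norm_zero] at he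
    exact zero_ne_one he
  have z2 : ∀ X, (1 - pr p) ∘L ψ X ∘L pr q = 0 := fun X => by
    by_contra hne
    obtain ⟨P', Q', hP', hQ', hP'0, hQ'0, hP'l, hQ'l, hfu⟩ := claim1 hD₁ hD₂ hψ hpD.compl hqD X hne
    have hfu' := full_of hQ' hfu
    have hff : ∀ Y, ψ (P' ∘L Y ∘L Q₀) = P' ∘L Y ∘L Q₀ := fun Y => by
      by_contra hcon
      obtain ⟨P'', Q'', hP'', hQ'', hP''0, hQ''0, hP''l, hQ''l, hz⟩ := exists_zero hD₁ hD₂ hψ hP' hQ₀ hcon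
      obtain ⟨e₁, he₁, he₁P⟩ := hQ'.exists_unit hQ'0
      obtain ⟨f₂, hf₂, hf₂P⟩ := hP''.exists_unit hP''0
      obtain ⟨e₂, he₂, he₂Q⟩ := hQ''.exists_unit hQ''0
      have hf₂P' : P' f₂ = f₂ := by rw [← hf₂P, ← comp_apply, hP''l]
      have he₁q : pr q e₁ = e₁ := by rw [← he₁P, ← comp_apply, hQ'l]
      have he₂Q₀ : Q₀ e₂ = e₂ := by rw [← he₂Q, ← comp_apply, hQ''l]
      have hf₀p := (hpm _).2 (hP₀p _ hf₀P)
      have horth : Q' e₂ = 0 := by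
        by_contra hn
        have e1 : Q'' (Q' e₂) = Q' e₂ := by rw [masa_apply hD₁ hQ''.1 hQ'.1, he₂Q]
        have e2 := hfu' f₂ (Q' e₂) hf₂P' (hQ'.idem _)
        rw [hz _ _ hf₂P e1] at e2
        have := norm_rankOne (𝕜 := ℂ) f₂ (Q' e₂)
        rw [← e2, hf₂, norm_zero, one_mul] at this
        exact hn (norm_eq_zero.1 this.symm)
      exact two_by_two hc hf₀ hf₂ he₁ he₂
        (ortho_of hpD hf₀p (compl_le hP'l hf₂P')) (ortho_of hQ' he₁P horth)
        (hfull _ _ hf₀p he₁q) (hfull _ _ hf₀p ((hqm _).2 (hQ₀q _ he₂Q₀)))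
        (hfu' _ _ hf₂P' he₁P) (hz _ _ hf₂P he₂Q)
    obtain ⟨f, hf, hfP⟩ := hP'.exists_unit hP'0
    have h1 : f ∈ p := fun e he => full_of hQ₀ hff f e hfP he
    have h2 := compl_le hP'l hfP
    rw [(hpm f).2 h1] at h2
    rw [h2, norm_zero] at hf
    exact zero_ne_one hf
  refine ⟨pr p, pr q, ⟨hpD, hqD, ?_⟩, ?_, hfull.all hD₁ hD₂ hψ hpD hqD⟩
  · rintro _ ⟨X, rfl⟩
    ext x
    have h1 := congrArg (fun A => A x) (z1 X)
    have h2 := congrArg (fun A => A x) (z2 X)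
    have h1' : pr p (ψ X (x - pr q x)) = 0 := h1
    have h2' : ψ X (pr q x) - pr p (ψ X (pr q x)) = 0 := h2
    rw [map_sub, map_sub] at h1'
    change pr p (ψ X x) = ψ X (pr q x)
    exact (sub_eq_zero.1 h1').trans (sub_eq_zero.1 h2').symm
  · ext x
    exact (hpm _).2 (hP₀p _ (hP₀.idem x))

lemma schur_struct (hD₁ : IsMasa D₁) (hD₂ : IsMasa D₂) (hψ : BI D₁ D₂ ψ) (hc : ∀ X, ‖ψ X‖ ≤ ‖X‖)
    {X : H₁ →L[ℂ] H₂} (hX : ∀ c ∈ CP D₁ D₂ (range ψ), c.1 ∘L X = X ∘L c.2) : ψ X = X := by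
  set Z := X - ψ X with hZ
  have hZψ : ψ Z = 0 := by rw [hZ, map_sub, hψ.2.1, sub_self]
  have hZc : ∀ c ∈ CP D₁ D₂ (range ψ), c.1 ∘L Z = Z ∘L c.2 := fun c hcc => by
    rw [hZ, comp_sub, sub_comp, hX c hcc, hcc.2.2 _ ⟨X, rfl⟩]
  have hk : ∀ P₀ Q₀, PD D₂ P₀ → PD D₁ Q₀ → P₀ ≠ 0 → Q₀ ≠ 0 → Full ψ P₀ Q₀ → P₀ ∘L Z = 0 := by
    intro P₀ Q₀ hP₀ hQ₀ hP0 hQ0 hf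
    obtain ⟨P, Q, hPQ, hPP, hY⟩ := exists_hat hD₁ hD₂ hψ hc hP₀ hQ₀ hP0 hQ0 hf
    have h1 : P ∘L Z ∘L Q = 0 := by
      rw [← hY, hψ.2.2 _ _ hPQ.2.1.1 _ hPQ.1.1, hZψ]; simp
    have h2 : P ∘L Z ∘L Q = P ∘L Z := by
      rw [← hZc _ hPQ, ← comp_assoc, hPQ.1.2.1]
    have h3 : P₀ ∘L P = P₀ := by
      have := hD₂.1 P hPQ.1.1 P₀ hP₀.1
      exact this.symm.trans hPP
    rw [← h3, comp_assoc, ← h2, h1, comp_zero]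
  let R : Submodule ℂ H₂ :=
    { carrier := {y | ∀ P₀ Q₀, PD D₂ P₀ → PD D₁ Q₀ → P₀ ≠ 0 → Q₀ ≠ 0 → Full ψ P₀ Q₀ → P₀ y = 0}
      add_mem' := fun ha hb P Q h1 h2 h3 h4 h5 => by
        rw [map_add, ha P Q h1 h2 h3 h4 h5, hb P Q h1 h2 h3 h4 h5, add_zero]
      zero_mem' := fun P Q h1 h2 h3 h4 h5 => map_zero _
      smul_mem' := fun c x hx P Q h1 h2 h3 h4 h5 => by
        rw [map_smul, hx P Q h1 h2 h3 h4 h5, smul_zero] }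
  have hRD : PD D₂ (pr R) := PD_pr hD₂ fun b hb y hy => Submodule.le_topologicalClosure _
    fun P Q h1 h2 h3 h4 h5 => by rw [masa_apply hD₂ h1.1 hb, hy P Q h1 h2 h3 h4 h5, map_zero]
  have hR0 : ∀ Y, pr R ∘L ψ Y = 0 := fun Y => by
    by_contra hne
    obtain ⟨P', Q', hP', hQ', hP'0, hQ'0, hP'l, -, hfu⟩ := claim1 hD₁ hD₂ hψ hRD PD.one Y hne
    obtain ⟨f, hf, hfP⟩ := hP'.exists_unit hP'0
    have h1 : f ∈ R.topologicalClosure := by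
      have := pr_mem R f
      rwa [← hfP, ← comp_apply, hP'l, hfP] at this
    have h2 : P' f ∈ (⊥ : Submodule ℂ H₂).topologicalClosure :=
      closure_map (p := R) P' (fun y hy => by
        rw [hy P' Q' hP' hQ' hP'0 hQ'0 (full_of hQ' hfu)]; exact zero_mem _) h1
    rw [hfP, (isClosed_singleton (x := (0:H₂))).submodule_topologicalClosure_eq] at h2
    rw [(Submodule.mem_bot ℂ).1 h2, norm_zero] at hf
    exact zero_ne_one hf
  have h0 := hZc (pr R, 0) ⟨hRD, ⟨zero_mem _, by simp, by simp⟩, by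
    rintro _ ⟨Y, rfl⟩
    simp [hR0]⟩
  have hZ0 : Z = 0 := by
    ext x
    have h1 : Z x ∈ R := fun P₀ Q₀ h1 h2 h3 h4 h5 =>
      congrArg (fun A => A x) (hk P₀ Q₀ h1 h2 h3 h4 h5)
    rw [← pr_of_mem' h1, ← comp_apply]
    change (pr R ∘L Z) x = 0
    rw [show pr R ∘L Z = Z ∘L 0 from h0]
    simp
  rw [hZ] at hZ0
  exact (sub_eq_zero.1 hZ0).symm

end Str
end OpSynth

namespace OpSynth
open Filter Topology ContinuousLinearMap InnerProductSpace

section Diag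
variable {H K : Type*} [NormedAddCommGroup H] [InnerProductSpace ℂ H] [CompleteSpace H]
  [NormedAddCommGroup K] [InnerProductSpace ℂ K] [CompleteSpace K]

lemma proj_pyth {p : H →L[ℂ] H} (hi : p ∘L p = p) (ha : adjoint p = p) (a b : H) :
    ‖p a + (1 - p) b‖ ^ 2 = ‖p a‖ ^ 2 + ‖(1 - p) b‖ ^ 2 := by
  have h : ⟪p a, (1 - p) b⟫ = 0 := by
    rw [← adjoint_inner_right, ha]
    change ⟪a, p (b - p b)⟫ = 0
    have : p (p b) = p b := congrArg (fun A => A b) hi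
    rw [map_sub, this, sub_self, inner_zero_right]
  have := norm_add_sq_eq_norm_sq_add_norm_sq_of_inner_eq_zero _ _ h
  nlinarith

lemma norm_diag {p : H →L[ℂ] H} (hi : p ∘L p = p) (ha : adjoint p = p)
    {q : K →L[ℂ] K} (hqi : q ∘L q = q) (hqa : adjoint q = q)
    {Z₁ Z₂ : H →L[ℂ] K} {r : ℝ} (h₁ : ‖Z₁‖ ≤ r) (h₂ : ‖Z₂‖ ≤ r) :
    ‖q ∘L Z₁ ∘L p + (1 - q) ∘L Z₂ ∘L (1 - p)‖ ≤ r := by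
  have hr : 0 ≤ r := (norm_nonneg _).trans h₁
  refine opNorm_le_bound _ hr fun x => ?_
  rw [← sq_le_sq₀ (norm_nonneg _) (by positivity)]
  change ‖q (Z₁ (p x)) + (1 - q) (Z₂ ((1 - p) x))‖ ^ 2 ≤ _
  rw [proj_pyth hqi hqa]
  have e1 : ∀ y, ‖q y‖ ≤ ‖y‖ ∧ ‖(1 - q) y‖ ≤ ‖y‖ := fun y => by
    have := proj_pyth hqi hqa y y
    have e : q y + (1 - q) y = y := by change q y + (y - q y) = y; abel
    rw [e] at this
    constructor <;> refine (sq_le_sq₀ (norm_nonneg _) (norm_nonneg _)).1 ?_ <;>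
      nlinarith [sq_nonneg ‖q y‖, sq_nonneg ‖(1 - q) y‖]
  have e2 : ‖x‖ ^ 2 = ‖p x‖ ^ 2 + ‖(1 - p) x‖ ^ 2 := by
    rw [← proj_pyth hi ha]
    congr 2
    change x = p x + (x - p x); abel
  have e3 : ‖q (Z₁ (p x))‖ ≤ r * ‖p x‖ := ((e1 _).1).trans (le_of_opNorm_le _ h₁ _)
  have e4 : ‖(1 - q) (Z₂ ((1 - p) x))‖ ≤ r * ‖(1 - p) x‖ := ((e1 _).2).trans (le_of_opNorm_le _ h₂ _)
  have e5 := (sq_le_sq₀ (norm_nonneg _) (by positivity)).2 e3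
  have e6 := (sq_le_sq₀ (norm_nonneg _) (by positivity)).2 e4
  rw [mul_pow, e2]
  nlinarith

lemma span_ortho {S : Set H} {S' : Set K} {R : H →L[ℂ] K} (h : ∀ a ∈ S', ∀ b ∈ S, ⟪a, R b⟫ = 0)
    (x : H) (y : K) : ⟪pr (Submodule.span ℂ S') y, R (pr (Submodule.span ℂ S) x)⟫ = 0 := by
  have h1 : ∀ a ∈ S', ∀ b ∈ (Submodule.span ℂ S).topologicalClosure, ⟪a, R b⟫ = 0 := by
    intro a ha b hb
    refine closure_minimal (s := (Submodule.span ℂ S : Set H)) (t := {b | ⟪a, R b⟫ = 0}) ?_ ?_ hb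
    · intro b hb
      refine Submodule.span_induction (p := fun b _ => ⟪a, R b⟫ = 0) (fun b hb => h a ha b hb) ?_ ?_ ?_ hb
      · simp
      · intro x y _ _ hx hy; rw [map_add, inner_add_right, hx, hy, add_zero]
      · intro c x _ hx; rw [map_smul, inner_smul_right, hx, mul_zero]
    · exact isClosed_eq (by fun_prop) continuous_const
  have hb := fun a ha => h1 a ha _ (pr_mem (Submodule.span ℂ S) x)
  set b := R (pr (Submodule.span ℂ S) x)
  refine closure_minimal (s := (Submodule.span ℂ S' : Set K)) (t := {a | ⟪a, b⟫ = 0}) ?_ ?_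
    (pr_mem (Submodule.span ℂ S') y)
  · intro a ha
    refine Submodule.span_induction (p := fun a _ => ⟪a, b⟫ = 0) (fun a ha => hb a ha) ?_ ?_ ?_ ha
    · simp
    · intro x y _ _ hx hy; rw [inner_add_left, hx, hy, add_zero]
    · intro c x _ hx; rw [inner_smul_left, hx, mul_zero]
  · exact isClosed_eq (by fun_prop) continuous_const
end Diag

/-- commutant -/
def Cm {H : Type*} [NormedAddCommGroup H] [InnerProductSpace ℂ H] (G : Set (H →L[ℂ] H)) :
    Set (H →L[ℂ] H) := {z | ∀ g ∈ G, z ∘L g = g ∘L z}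

section StepA
variable {H K₁ K₂ T₁ T₃ : Type*} [NormedAddCommGroup H] [InnerProductSpace ℂ H] [CompleteSpace H]
  [NormedAddCommGroup K₁] [InnerProductSpace ℂ K₁] [CompleteSpace K₁]
  [NormedAddCommGroup K₂] [InnerProductSpace ℂ K₂] [CompleteSpace K₂]
  [NormedAddCommGroup T₁] [InnerProductSpace ℂ T₁] [CompleteSpace T₁]
  [NormedAddCommGroup T₃] [InnerProductSpace ℂ T₃] [CompleteSpace T₃]
  {t₁ : H → K₁ → T₁} {t₃ : H → K₂ → T₃}
  (ht₁ : IsTensorEmbedding t₁) (ht₃ : IsTensorEmbedding t₃)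

lemma ten_idem {g : H →L[ℂ] H} (h : g ∘L g = g) :
    ten ht₁ ht₁ g 1 ∘L ten ht₁ ht₁ g 1 = ten ht₁ ht₁ g 1 := by
  rw [ten_comp, h]; rfl

lemma ten_sa {g : H →L[ℂ] H} (h : adjoint g = g) :
    adjoint (ten ht₁ ht₁ g 1) = ten ht₁ ht₁ g 1 := by
  rw [ten_adjoint, h, ← star_eq_adjoint, star_one]

lemma ten_compl (g : H →L[ℂ] H) : ten ht₁ ht₁ (1 - g) 1 = 1 - ten ht₁ ht₁ g 1 := by
  rw [ten_sub_left, ten_one]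

lemma inner_ten_left {H₂ K₂ T₂ : Type*} [NormedAddCommGroup H₂] [InnerProductSpace ℂ H₂] [CompleteSpace H₂]
    [NormedAddCommGroup K₂] [InnerProductSpace ℂ K₂] [CompleteSpace K₂]
    [NormedAddCommGroup T₂] [InnerProductSpace ℂ T₂] [CompleteSpace T₂]
    {t₂ : H₂ → K₂ → T₂} (ht₂ : IsTensorEmbedding t₂)
    (A : H →L[ℂ] H₂) (v : H₂) (x : K₂) (w : T₁) (B : K₁ →L[ℂ] K₂) :
    ⟪t₂ v x, ten ht₁ ht₂ A B w⟫ = ⟪t₁ (adjoint A v) (adjoint B x), w⟫ := by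
  rw [← adjoint_inner_left, ten_adjoint, ten_apply]

lemma adj_one {H : Type*} [NormedAddCommGroup H] [InnerProductSpace ℂ H] [CompleteSpace H] :
    adjoint (1 : H →L[ℂ] H) = 1 := by rw [← star_eq_adjoint, star_one]

lemma stepA_fin {G : Set (H →L[ℂ] H)} (hG : ∀ g ∈ G, g ∘L g = g ∧ adjoint g = g)
    (hGc : ∀ g ∈ G, ∀ g' ∈ G, g ∘L g' = g' ∘L g) {U : Set (K₁ →L[ℂ] K₂)}
    (hU : ∀ (c : ℂ), ∀ u ∈ U, c • u ∈ U) {Y : T₁ →L[ℂ] T₃}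
    (hY : ∀ g ∈ G, ten ht₃ ht₃ g 1 ∘L Y = Y ∘L ten ht₁ ht₁ g 1)
    (hs : ∀ x x', adjoint (ht₃.I x') ∘L Y ∘L ht₁.I x ∈ U) (F : List (H →L[ℂ] H))
    (hF : ∀ g ∈ F, g ∈ G) : ∀ e : H, ∃ Z ∈ wkSpan (image2 (ten ht₁ ht₃) (Cm G) U), ‖Z‖ ≤ ‖Y‖ ∧
      ∀ v v', (v = 0 ∨ v = e ∨ ∃ g ∈ F, v = g e) → (v' = 0 ∨ v' = e ∨ ∃ g ∈ F, v' = g e) →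
        ∀ x x', ⟪t₃ v x', (Z - Y) (t₁ v' x)⟫ = 0 := by
  have z1 : ∀ x, t₁ 0 x = 0 := fun x => map_zero (ht₁.J x)
  have z3 : ∀ x, t₃ 0 x = 0 := fun x => map_zero (ht₃.J x)
  induction F with
  | nil =>
    intro e
    set S := adjoint (ht₃.I e) ∘L Y ∘L ht₁.I e with hS
    have hSn : ‖S‖ ≤ ‖e‖ ^ 2 * ‖Y‖ := by
      have h3 : ‖ht₃.I e‖ ≤ ‖e‖ := opNorm_le_bound _ (norm_nonneg _) fun y => by
        rw [ht₃.I_apply, ht₃.norm]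
      have h1 : ‖ht₁.I e‖ ≤ ‖e‖ := opNorm_le_bound _ (norm_nonneg _) fun y => by
        rw [ht₁.I_apply, ht₁.norm]
      calc ‖S‖ ≤ ‖adjoint (ht₃.I e)‖ * ‖Y ∘L ht₁.I e‖ := opNorm_comp_le _ _
        _ ≤ ‖adjoint (ht₃.I e)‖ * (‖Y‖ * ‖ht₁.I e‖) := by gcongr; exact opNorm_comp_le _ _
        _ ≤ ‖e‖ * (‖Y‖ * ‖e‖) := by
          rw [show ‖adjoint (ht₃.I e)‖ = ‖ht₃.I e‖ from LinearIsometryEquiv.norm_map _ _]; gcongr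
        _ = _ := by ring
    set c : ℂ := ((‖e‖ ^ 2 : ℝ) : ℂ)⁻¹ with hc
    refine ⟨ten ht₁ ht₃ 1 (c • S), subset_wkSpan _ ⟨1, fun g _ => rfl, c • S, hU _ _ (hs _ _), rfl⟩, ?_, ?_⟩
    · refine (norm_ten_le _ _ _ _).trans ?_
      have h1 : ‖c • S‖ ≤ ‖Y‖ := by
        rw [norm_smul, hc, norm_inv, Complex.norm_real, Real.norm_of_nonneg (by positivity)]
        rcases eq_or_ne e 0 with h | h
        · simp [h]
        · rw [inv_mul_le_iff₀ (by positivity)]; exact hSn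
      have h2 : ‖(1 : H →L[ℂ] H)‖ ≤ 1 := norm_id_le
      nlinarith [norm_nonneg (c • S), norm_nonneg (1 : H →L[ℂ] H)]
    · have key : ∀ x x', ⟪t₃ e x', (ten ht₁ ht₃ 1 (c • S) - Y) (t₁ e x)⟫ = 0 := by
        intro x x'
        rw [sub_apply, inner_sub_right, ten_apply, ht₃.inner]
        have h1 : ⟪t₃ e x', Y (t₁ e x)⟫ = ⟪x', S x⟫ := by
          rw [hS]; simp only [comp_apply]; rw [adjoint_inner_right]; rfl
        have h2 : (1 : H →L[ℂ] H) e = e := rfl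
        rw [h1, h2, smul_apply, inner_smul_right, inner_self_eq_norm_sq_to_K]
        rcases eq_or_ne e 0 with h | h
        · have : S = 0 := by
            rw [← norm_le_zero_iff]; simpa [h] using hSn
          simp [this]
        · have : ((‖e‖ : ℂ)) ≠ 0 := by exact_mod_cast norm_ne_zero_iff.2 h
          rw [hc]; push_cast
          rw [← mul_assoc]
          have : (RCLike.ofReal ‖e‖ : ℂ) = (‖e‖ : ℂ) := rfl
          rw [this]; field_simp; ring
      rintro v v' (rfl | rfl | ⟨g, hg, -⟩) (rfl | rfl | ⟨g', hg', -⟩) x x'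
      · rw [z3, inner_zero_left]
      · rw [z3, inner_zero_left]
      · cases hg'
      · rw [z1, map_zero, inner_zero_right]
      · exact key x x'
      · cases hg'
      all_goals cases hg
  | cons Q F ih =>
    intro e
    have ih := ih fun g hg => hF g (List.mem_cons_of_mem _ hg)
    have hQ : Q ∈ G := hF Q (List.mem_cons_self)
    obtain ⟨Z₁, hZ₁, hn₁, hr₁⟩ := ih (Q e)
    obtain ⟨Z₂, hZ₂, hn₂, hr₂⟩ := ih ((1 - Q) e)
    have hQQ : ∀ x, Q (Q x) = Q x := fun x => congrArg (fun A => A x) (hG Q hQ).1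
    have hcQ : ∀ g ∈ G, ∀ x, g (Q x) = Q (g x) := fun g hg x => congrArg (fun A => A x) (hGc g hg Q hQ)
    set q₁ := ten ht₁ ht₁ Q 1 with hq₁
    set q₃ := ten ht₃ ht₃ Q 1 with hq₃
    have hc1 := ten_compl ht₁ Q
    have hc3 := ten_compl ht₃ Q
    have hQsa := (hG Q hQ).2
    refine ⟨q₃ ∘L Z₁ ∘L q₁ + (1 - q₃) ∘L Z₂ ∘L (1 - q₁), add_mem ?_ ?_, ?_, ?_⟩
    · refine wkSpan_comp _ _ ?_ hZ₁
      rintro _ ⟨z, hz, u, hu, rfl⟩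
      rw [hq₁, hq₃, ten_comp, ten_comp]
      refine subset_wkSpan _ ⟨_, ?_, u, hu, rfl⟩
      intro g hg
      ext x
      change Q (z (Q (g x))) = g (Q (z (Q x)))
      rw [hcQ g hg, ← hcQ g hg, show z (g (Q x)) = g (z (Q x)) from congrArg (fun A => A (Q x)) (hz g hg)]
    · refine wkSpan_comp _ _ ?_ hZ₂
      rintro _ ⟨z, hz, u, hu, rfl⟩
      rw [← hc1, ← hc3, ten_comp, ten_comp]
      refine subset_wkSpan _ ⟨_, ?_, u, hu, rfl⟩
      intro g hg
      have hz' : ∀ x, z (g x) = g (z x) := fun x => congrArg (fun A => A x) (hz g hg)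
      ext x
      change z (g x - Q (g x)) - Q (z (g x - Q (g x))) = g (z (x - Q x) - Q (z (x - Q x)))
      rw [← hcQ g hg, ← map_sub g, hz', ← hcQ g hg, map_sub g]
    · exact norm_diag (ten_idem ht₁ (hG Q hQ).1) (ten_sa ht₁ hQsa) (ten_idem ht₃ (hG Q hQ).1)
        (ten_sa ht₃ hQsa) hn₁ hn₂
    · have hR : ∀ v, (v = 0 ∨ v = e ∨ ∃ g ∈ Q :: F, v = g e) →
          (Q v = 0 ∨ Q v = Q e ∨ ∃ g ∈ F, Q v = g (Q e)) ∧
          ((1 - Q) v = 0 ∨ (1 - Q) v = (1 - Q) e ∨ ∃ g ∈ F, (1 - Q) v = g ((1 - Q) e)) := by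
        rintro v (rfl | rfl | ⟨g, hg, rfl⟩)
        · exact ⟨Or.inl (map_zero _), Or.inl (map_zero _)⟩
        · exact ⟨Or.inr (Or.inl rfl), Or.inr (Or.inl rfl)⟩
        · rcases List.mem_cons.1 hg with rfl | hg'
          · refine ⟨Or.inr (Or.inl (hQQ e)), Or.inl ?_⟩
            change g e - g (g e) = 0
            rw [hQQ, sub_self]
          · refine ⟨Or.inr (Or.inr ⟨g, hg', (hcQ g (hF g hg) e).symm⟩), Or.inr (Or.inr ⟨g, hg', ?_⟩)⟩
            change g e - Q (g e) = g (e - Q e)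
            rw [map_sub, hcQ g (hF g hg)]
      intro v v' hv hv' x x'
      have hYd : ∀ w, Y w = q₃ (Y (q₁ w)) + (1 - q₃) (Y ((1 - q₁) w)) := by
        intro w
        have h1 : ∀ w, q₃ (Y w) = Y (q₁ w) := fun w => congrArg (fun A => A w) (hY Q hQ)
        have h2 : q₁ (q₁ w) = q₁ w := congrArg (fun A => A w) (ten_idem ht₁ (hG Q hQ).1)
        change Y w = q₃ (Y (q₁ w)) + (Y (w - q₁ w) - q₃ (Y (w - q₁ w)))
        rw [h1, h1, h2, ← map_sub, map_sub q₁, h2, sub_self, sub_zero, ← map_add]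
        congr 1; abel
      have h := hr₁ (Q v) (Q v') (hR v hv).1 (hR v' hv').1 x x'
      have h' := hr₂ ((1 - Q) v) ((1 - Q) v') (hR v hv).2 (hR v' hv').2 x x'
      have h : ⟪t₃ (Q v) x', Z₁ (t₁ (Q v') x)⟫ = ⟪t₃ (Q v) x', Y (t₁ (Q v') x)⟫ := by
        rw [← sub_eq_zero, ← inner_sub_right]; exact h
      have h' : ⟪t₃ ((1 - Q) v) x', Z₂ (t₁ ((1 - Q) v') x)⟫ = ⟪t₃ ((1 - Q) v) x', Y (t₁ ((1 - Q) v') x)⟫ := by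
        rw [← sub_eq_zero, ← inner_sub_right]; exact h'
      rw [sub_apply, inner_sub_right, hYd]
      simp only [add_apply, comp_apply, inner_add_right]
      rw [← hc1, ← hc3]
      rw [inner_ten_left, inner_ten_left, inner_ten_left, inner_ten_left]
      rw [adj_one, map_sub, adj_one, hQsa, ten_apply, ten_apply]
      change ⟪t₃ (Q v) x', Z₁ (t₁ (Q v') x)⟫ + ⟪t₃ ((1 - Q) v) x', Z₂ (t₁ ((1 - Q) v') x)⟫ -
        (⟪t₃ (Q v) x', Y (t₁ (Q v') x)⟫ + ⟪t₃ ((1 - Q) v) x', Y (t₁ ((1 - Q) v') x)⟫) = 0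
      rw [h, h', sub_self]

lemma stepA {G : Set (H →L[ℂ] H)} (hG : ∀ g ∈ G, g ∘L g = g ∧ adjoint g = g)
    (hGc : ∀ g ∈ G, ∀ g' ∈ G, g ∘L g' = g' ∘L g) {U : Set (K₁ →L[ℂ] K₂)}
    (hU : ∀ (c : ℂ), ∀ u ∈ U, c • u ∈ U) {Y : T₁ →L[ℂ] T₃}
    (hY : ∀ g ∈ G, ten ht₃ ht₃ g 1 ∘L Y = Y ∘L ten ht₁ ht₁ g 1)
    (hs : ∀ x x', adjoint (ht₃.I x') ∘L Y ∘L ht₁.I x ∈ U) (e : H) :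
    ∃ Z ∈ wkSpan (image2 (ten ht₁ ht₃) (Cm G) U),
      ten ht₃ ht₃ (pr (Submodule.span ℂ ((fun g : H →L[ℂ] H => g e) '' G))) 1 ∘L Z ∘L
        ten ht₁ ht₁ (pr (Submodule.span ℂ ((fun g : H →L[ℂ] H => g e) '' G))) 1 =
      ten ht₃ ht₃ (pr (Submodule.span ℂ ((fun g : H →L[ℂ] H => g e) '' G))) 1 ∘L Y ∘L
        ten ht₁ ht₁ (pr (Submodule.span ℂ ((fun g : H →L[ℂ] H => g e) '' G))) 1 := by
  set C : {F : List (H →L[ℂ] H) // ∀ g ∈ F, g ∈ G} → Set (T₁ →L[ℂ] T₃) := fun F =>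
    {Z | Z ∈ wkSpan (image2 (ten ht₁ ht₃) (Cm G) U) ∧ ‖Z‖ ≤ ‖Y‖ ∧
      ∀ g ∈ F.1, ∀ g' ∈ F.1, ∀ x x', ⟪t₃ (g e) x', Z (t₁ (g' e) x)⟫ = ⟪t₃ (g e) x', Y (t₁ (g' e) x)⟫} with hC
  obtain ⟨F, Z, hF, hZn, hl⟩ := fip_limit C ‖Y‖ ⟨⟨[], by simp⟩, fun X hX => hX.2.1⟩ (by
    intro s
    obtain ⟨Z, hZ, hn, hr⟩ := stepA_fin ht₁ ht₃ hG hGc hU hY hs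
      ((s.toList.map (fun F => F.1)).flatten) (by
        intro g hg
        obtain ⟨l, hl, hgl⟩ := List.mem_flatten.1 hg
        obtain ⟨F, _, rfl⟩ := List.mem_map.1 hl
        exact F.2 g hgl) e
    refine ⟨Z, fun F hF => ⟨hZ, hn, fun g hg g' hg' x x' => ?_⟩⟩
    have hm : ∀ g ∈ F.1, g ∈ (s.toList.map (fun F => F.1)).flatten := fun g hg =>
      List.mem_flatten.2 ⟨F.1, List.mem_map.2 ⟨F, Finset.mem_toList.2 hF, rfl⟩, hg⟩
    have := hr (g e) (g' e) (Or.inr (Or.inr ⟨g, hm g hg, rfl⟩)) (Or.inr (Or.inr ⟨g', hm g' hg', rfl⟩)) x x'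
    rwa [sub_apply, inner_sub_right, sub_eq_zero] at this)
  refine ⟨Z, limit_mem_wkSpan hl (mem_of_superset (hF ⟨[], by simp⟩) fun X hX => hX.1), ?_⟩
  have key : ∀ g ∈ G, ∀ g' ∈ G, ∀ x x', ⟪t₃ (g e) x', Z (t₁ (g' e) x)⟫ = ⟪t₃ (g e) x', Y (t₁ (g' e) x)⟫ := by
    intro g hg g' hg' x x'
    have h1 := limit_inner hl (t₁ (g' e) x) (t₃ (g e) x')
    have h2 : Tendsto (fun X : T₁ →L[ℂ] T₃ => ⟪t₃ (g e) x', X (t₁ (g' e) x)⟫) F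
        (𝓝 ⟪t₃ (g e) x', Y (t₁ (g' e) x)⟫) := by
      refine (tendsto_const_nhds).congr' ?_
      refine mem_of_superset (hF ⟨[g, g'], by simp [hg, hg']⟩) fun X hX => ?_
      exact (hX.2.2 g (by simp) g' (by simp) x x').symm
    exact tendsto_nhds_unique h1 h2
  set p := Submodule.span ℂ ((fun g : H →L[ℂ] H => g e) '' G) with hp
  refine ht₁.ext fun b x => ht₃.ext_vec fun a x' => ?_
  simp only [comp_apply]
  rw [inner_ten_left, inner_ten_left, ten_apply, adj_one, pr_adj]
  change ⟪t₃ (pr p a) x', Z (t₁ (pr p b) x)⟫ = ⟪t₃ (pr p a) x', Y (t₁ (pr p b) x)⟫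
  rw [← sub_eq_zero, ← inner_sub_right, ← sub_apply]
  have := span_ortho (S := (fun g : H →L[ℂ] H => g e) '' G) (S' := (fun g : H →L[ℂ] H => g e) '' G)
    (R := adjoint (ht₃.J x') ∘L (Z - Y) ∘L ht₁.J x) (by
      rintro _ ⟨g, hg, rfl⟩ _ ⟨g', hg', rfl⟩
      simp only [comp_apply]
      rw [adjoint_inner_right, ht₃.J_apply, ht₁.J_apply, sub_apply, inner_sub_right, key g hg g' hg', sub_self]) b a
  simp only [comp_apply] at this
  rw [adjoint_inner_right] at this
  exact this
end StepA
end OpSynth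

namespace OpSynth
open Filter Topology ContinuousLinearMap InnerProductSpace

section StepC
variable {H K : Type*} [NormedAddCommGroup H] [InnerProductSpace ℂ H] [CompleteSpace H]
  [NormedAddCommGroup K] [InnerProductSpace ℂ K] [CompleteSpace K]

lemma one_comp' (X : H →L[ℂ] K) : (1 : K →L[ℂ] K) ∘L X = X := by ext; rfl
lemma comp_one' (X : H →L[ℂ] K) : X ∘L (1 : H →L[ℂ] H) = X := by ext; rfl

lemma pr_of_perp {p : Submodule ℂ H} {u : H}
    (h : ∀ η, (∀ y ∈ p, ⟪y, η⟫ = 0) → ⟪η, u⟫ = 0) : pr p u = u := by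
  have h1 := h (u - pr p u) fun y hy => pr_orth hy
  have h2 : ⟪u - pr p u, pr p u⟫ = 0 := by
    rw [← pr_sa, map_sub, pr_of_mem (pr_mem p u), sub_self, inner_zero_left]
  have h3 : ⟪u - pr p u, u - pr p u⟫ = 0 := by
    rw [inner_sub_right, h1, h2, sub_zero]
  exact (sub_eq_zero.1 (inner_self_eq_zero.1 h3)).symm

lemma pr_wkSpan {S : Set (H →L[ℂ] K)} {X : H →L[ℂ] K} (hX : X ∈ wkSpan S) (ξ : L2 H) :
    pr (Submodule.span ℂ ((fun X => Amp X ξ) '' S)) (Amp X ξ) = Amp X ξ := by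
  refine pr_of_perp fun η hη => ?_
  refine mem_wkSpan.1 hX ξ η fun Z hZ => ?_
  rw [om_apply, ← inner_conj_symm, hη _ (Submodule.subset_span ⟨Z, hZ, rfl⟩), map_zero]

lemma wkSpan_of_pr {S : Set (H →L[ℂ] K)} {X : H →L[ℂ] K}
    (h : ∀ ξ, pr (Submodule.span ℂ ((fun X => Amp X ξ) '' S)) (Amp X ξ) = Amp X ξ) : X ∈ wkSpan S := by
  refine mem_wkSpan.2 fun ξ η hk => ?_
  rw [om_apply, ← h ξ, ← pr_sa, pr_zero, inner_zero_left]
  intro y hy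
  refine Submodule.span_induction (p := fun y _ => ⟪y, η⟫ = 0) ?_ ?_ ?_ ?_ hy
  · rintro _ ⟨Z, hZ, rfl⟩
    change ⟪Amp Z ξ, η⟫ = 0
    rw [← inner_conj_symm, ← om_apply, hk Z hZ, map_zero]
  · simp
  · intro x y _ _ hx hy; rw [inner_add_left, hx, hy, add_zero]
  · intro c x _ hx; rw [inner_smul_left, hx, mul_zero]

end StepC

section Slice
variable {H₁ H₂ K₁ K₂ T₁ T₂ : Type*}
    [NormedAddCommGroup H₁] [InnerProductSpace ℂ H₁] [CompleteSpace H₁]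
    [NormedAddCommGroup H₂] [InnerProductSpace ℂ H₂] [CompleteSpace H₂]
    [NormedAddCommGroup K₁] [InnerProductSpace ℂ K₁] [CompleteSpace K₁]
    [NormedAddCommGroup K₂] [InnerProductSpace ℂ K₂] [CompleteSpace K₂]
    [NormedAddCommGroup T₁] [InnerProductSpace ℂ T₁] [CompleteSpace T₁]
    [NormedAddCommGroup T₂] [InnerProductSpace ℂ T₂] [CompleteSpace T₂]
    {D₁ : StarSubalgebra ℂ (H₁ →L[ℂ] H₁)} {D₂ : StarSubalgebra ℂ (H₂ →L[ℂ] H₂)}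
    {t₁ : H₁ → K₁ → T₁} {t₂ : H₂ → K₂ → T₂}
    (ht₁ : IsTensorEmbedding t₁) (ht₂ : IsTensorEmbedding t₂)
    {T₃ : Type*} [NormedAddCommGroup T₃] [InnerProductSpace ℂ T₃] [CompleteSpace T₃]
    {t₃ : H₁ → K₂ → T₃}

/-- intertwiners -/
def Tw (Q : Set ((H₂ →L[ℂ] H₂) × (H₁ →L[ℂ] H₁))) : Set (H₁ →L[ℂ] H₂) :=
  {T | ∀ c ∈ Q, c.1 ∘L T = T ∘L c.2}

lemma stepB (ht₃ : IsTensorEmbedding t₃) (hD₁ : IsMasa D₁) (hD₂ : IsMasa D₂) {M : Set (H₁ →L[ℂ] H₂)} {G : Set (H₁ →L[ℂ] H₁)}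
    (hG : ∀ g ∈ G, PD D₁ g) {Y : T₁ →L[ℂ] T₂}
    (hGP : ∀ g ∈ G, ∃ P, PD D₂ P ∧ ten ht₂ ht₂ P 1 ∘L Y = Y ∘L ten ht₁ ht₁ g 1 ∧
      ∀ T ∈ M, P ∘L T = T ∘L g)
    (hMz : ∀ T ∈ M, ∀ z ∈ Cm G, T ∘L z ∈ M)
    {U : Set (K₁ →L[ℂ] K₂)} (hU : ∀ (c : ℂ), ∀ u ∈ U, c • u ∈ U)
    (hs : ∀ x x', adjoint (ht₂.I x') ∘L Y ∘L ht₁.I x ∈ U) (e : H₁) {E : H₁ →L[ℂ] H₁}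
    (hE : E = pr (Submodule.span ℂ ((fun g : H₁ →L[ℂ] H₁ => g e) '' G))) (hEC : E ∈ Cm G)
    {T S : H₁ →L[ℂ] H₂} (hT : T ∈ M) (hS : S ∈ M) :
    ten ht₂ ht₂ (T ∘L E ∘L adjoint S) 1 ∘L Y ∘L ten ht₁ ht₁ E 1 ∈ wkSpan (image2 (ten ht₁ ht₂) M U) := by
  obtain ⟨Z, hZ, hZe⟩ := stepA (Y := ten ht₂ ht₃ (adjoint S) 1 ∘L Y) ht₁ ht₃ (G := G)
    (fun g hg => (hG g hg).2) (fun g hg g' hg' => hD₁.1 g (hG g hg).1 g' (hG g' hg').1) hU (by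
      intro g hg
      obtain ⟨P, hP, h1, h2⟩ := hGP g hg
      have h3 : g ∘L adjoint S = adjoint S ∘L P := by
        have := congrArg adjoint (h2 S hS)
        rw [adjoint_comp, adjoint_comp, hP.2.2, (hG g hg).2.2] at this
        exact this.symm
      rw [← comp_assoc, ten_comp, h3, comp_assoc, ← h1, ← comp_assoc, ten_comp]) (by
      intro x x'
      have := hs x (S x')
      convert this using 1
      ext y
      refine ext_inner_left ℂ fun k => ?_
      simp only [comp_apply]
      rw [adjoint_inner_right, adjoint_inner_right, ht₂.I_apply]
      have h4 := inner_ten_left ht₂ ht₃ (adjoint S) x' k (Y (ht₁.I x y)) 1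
      rw [adjoint_adjoint, adj_one] at h4
      exact h4) e
  rw [← hE] at hZe
  have h1 : ten ht₂ ht₂ (T ∘L E ∘L adjoint S) 1 ∘L Y ∘L ten ht₁ ht₁ E 1 =
      ten ht₃ ht₂ (T ∘L E) 1 ∘L Z ∘L ten ht₁ ht₁ E 1 := by
    have e1 : ten ht₃ ht₂ (T ∘L E) 1 = ten ht₃ ht₂ T 1 ∘L ten ht₃ ht₃ E 1 := by rw [ten_comp]; rfl
    have e2 : ten ht₂ ht₂ (T ∘L E ∘L adjoint S) 1 =
      ten ht₃ ht₂ T 1 ∘L ten ht₃ ht₃ E 1 ∘L ten ht₂ ht₃ (adjoint S) 1 := by rw [ten_comp, ten_comp]; rfl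
    rw [e1, e2]
    change ten ht₃ ht₂ T 1 ∘L (ten ht₃ ht₃ E 1 ∘L (ten ht₂ ht₃ (adjoint S) 1 ∘L Y) ∘L ten ht₁ ht₁ E 1) =
      ten ht₃ ht₂ T 1 ∘L (ten ht₃ ht₃ E 1 ∘L Z ∘L ten ht₁ ht₁ E 1)
    rw [hZe]
  rw [h1]
  refine wkSpan_comp _ _ ?_ hZ
  rintro _ ⟨z, hz, u, hu, rfl⟩
  rw [ten_comp, ten_comp]
  exact subset_wkSpan _ ⟨_, hMz _ (hMz _ hT E hEC) _ (fun g hg => by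
    rw [comp_assoc, hEC g hg, ← comp_assoc, hz g hg]; rfl), u, hu, rfl⟩

lemma support_lemma {M : Set (H₁ →L[ℂ] H₂)} {Y : T₁ →L[ℂ] T₂}
    (hYM : ∀ k k', adjoint (ht₂.J k) ∘L Y ∘L ht₁.J k' ∈ M) {E : H₁ →L[ℂ] H₁} (hEa : adjoint E = E)
    {w : T₂} (hw' : ∀ T ∈ M, ∀ a k, ⟪t₂ (T (E a)) k, w⟫ = 0) :
    adjoint (Y ∘L ten ht₁ ht₁ E 1) w = 0 := by
  refine ht₁.ext_vec fun a k' => ?_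
  rw [inner_zero_right, adjoint_inner_right, comp_apply, ten_apply]
  set p := Submodule.span ℂ {x | ∃ T ∈ M, ∃ a, x = T (E a)} with hp
  have h1 : ten ht₂ ht₂ (pr p) 1 w = 0 := by
    refine ht₂.ext_vec fun x k => ?_
    rw [inner_ten_left, pr_adj, inner_zero_right, adj_one]
    change ⟪ht₂.J k (pr p x), w⟫ = 0
    rw [← adjoint_inner_right, pr_sa, pr_zero, inner_zero_right]
    intro y hy
    refine Submodule.span_induction (p := fun y _ => ⟪y, adjoint (ht₂.J k) w⟫ = 0) ?_ ?_ ?_ ?_ hy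
    · rintro _ ⟨T, hT, a, rfl⟩
      rw [adjoint_inner_right]; exact hw' T hT a k
    · simp
    · intro x y _ _ hx hy; rw [inner_add_left, hx, hy, add_zero]
    · intro c x _ hx; rw [inner_smul_left, hx, mul_zero]
  have h2 : ten ht₂ ht₂ (pr p) 1 (Y (t₁ (E a) k')) = Y (t₁ (E a) k') := by
    refine ht₂.ext_vec fun x k => ?_
    rw [inner_ten_left, pr_adj, adj_one]
    change ⟪ht₂.J k (pr p x), Y (ht₁.J k' (E a))⟫ = ⟪ht₂.J k x, Y (ht₁.J k' (E a))⟫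
    rw [← adjoint_inner_right, pr_sa, pr_of_mem', adjoint_inner_right]
    exact Submodule.subset_span ⟨_, hYM k k', a, rfl⟩
  change ⟪Y (t₁ (E a) k'), w⟫ = 0
  rw [← h2, ← adjoint_inner_right, ten_sa ht₂ (pr_adj p), h1, inner_zero_right]

lemma stepC (ht₃ : IsTensorEmbedding t₃) {M : Set (H₁ →L[ℂ] H₂)} {Y : T₁ →L[ℂ] T₂}
    (hYM : ∀ k k', adjoint (ht₂.J k) ∘L Y ∘L ht₁.J k' ∈ M) {E : H₁ →L[ℂ] H₁} (hEi : E ∘L E = E)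
    (hEa : adjoint E = E) {U : Set (K₁ →L[ℂ] K₂)}
    (hM : ∀ T ∈ M, ∀ S ∈ M, T ∘L E ∘L adjoint T ∘L S ∈ M)
    (hB : ∀ T ∈ M, ten ht₂ ht₂ (T ∘L E ∘L adjoint T) 1 ∘L Y ∘L ten ht₁ ht₁ E 1 ∈
      wkSpan (image2 (ten ht₁ ht₂) M U)) :
    Y ∘L ten ht₁ ht₁ E 1 ∈ wkSpan (image2 (ten ht₁ ht₂) M U) := by
  refine wkSpan_of_pr fun ξ => ?_
  set p := Submodule.span ℂ ((fun X => Amp X ξ) '' image2 (ten ht₁ ht₂) M U) with hp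
  set X := Y ∘L ten ht₁ ht₁ E 1 with hX
  set v := Amp X ξ with hv
  set w := v - pr p v with hw
  have h1 : ∀ T ∈ M, Amp (ten ht₂ ht₂ (T ∘L E ∘L adjoint T) 1) w = 0 := by
    intro T hT
    have hsa : adjoint (T ∘L E ∘L adjoint T) = T ∘L E ∘L adjoint T := by
      rw [adjoint_comp, adjoint_comp, adjoint_adjoint, hEa]; rfl
    have hinv : ∀ x ∈ p, Amp (ten ht₂ ht₂ (T ∘L E ∘L adjoint T) 1) x ∈ p.topologicalClosure := by
      intro x hx
      apply Submodule.le_topologicalClosure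
      refine Submodule.span_induction (p := fun x _ => Amp (ten ht₂ ht₂ (T ∘L E ∘L adjoint T) 1) x ∈ p)
        ?_ ?_ ?_ ?_ hx
      · rintro _ ⟨_, ⟨S, hS, u, hu, rfl⟩, rfl⟩
        refine Submodule.subset_span ⟨_, ⟨_, hM T hT S hS, u, hu, rfl⟩, ?_⟩
        change Amp _ ξ = Amp _ (Amp _ ξ)
        rw [← Amp_comp_apply, ten_comp]; rfl
      · rw [map_zero]; exact zero_mem _
      · intro x y _ _ hx hy; rw [map_add]; exact add_mem hx hy
      · intro c x _ hx; rw [map_smul]; exact p.smul_mem c hx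
    have hc := pr_comm (p := p) (Amp (ten ht₂ ht₂ (T ∘L E ∘L adjoint T) 1)) hinv (by
      rw [Amp_adjoint, ten_sa ht₂ hsa]; exact hinv)
    have hc' : Amp (ten ht₂ ht₂ (T ∘L E ∘L adjoint T) 1) (pr p v) =
      pr p (Amp (ten ht₂ ht₂ (T ∘L E ∘L adjoint T) 1) v) := congrArg (fun A => A v) hc
    rw [hw, map_sub, hc', hv, ← Amp_comp_apply, pr_wkSpan (hB T hT), sub_self]
  have h2 : ∀ T ∈ M, ∀ a k n, ⟪t₂ (T (E a)) k, w n⟫ = 0 := by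
    intro T hT a k n
    have e0 : ten ht₂ ht₂ (T ∘L E ∘L adjoint T) 1 (w n) = 0 := by
      have := congrArg (fun z : L2 T₂ => z n) (h1 T hT)
      exact this
    have e1 : ten ht₂ ht₂ (T ∘L E ∘L adjoint T) 1 =
        adjoint (ten ht₂ ht₃ (E ∘L adjoint T) 1) ∘L ten ht₂ ht₃ (E ∘L adjoint T) 1 := by
      rw [ten_adjoint, ten_comp, adj_one, adjoint_comp, adjoint_adjoint, hEa]
      congr 1
      change T ∘L E ∘L adjoint T = T ∘L (E ∘L E) ∘L adjoint T
      rw [hEi]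
    have e2 : ten ht₂ ht₃ (E ∘L adjoint T) 1 (w n) = 0 := by
      rw [← inner_self_eq_zero (𝕜 := ℂ), ← adjoint_inner_right]
      have : adjoint (ten ht₂ ht₃ (E ∘L adjoint T) 1) (ten ht₂ ht₃ (E ∘L adjoint T) 1 (w n)) = 0 := by
        rw [← e0, e1]; rfl
      rw [this, inner_zero_right]
    have e3 := inner_ten_left ht₂ ht₃ (E ∘L adjoint T) a k (w n) 1
    rw [e2, inner_zero_right, adjoint_comp, adjoint_adjoint, hEa, adj_one] at e3
    exact e3.symm
  have h3 : Amp (adjoint X) w = 0 := by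
    ext n
    rw [Amp_apply]
    exact support_lemma ht₁ ht₂ hYM hEa fun T hT a k => h2 T hT a k n
  have h4 : ⟪v, w⟫ = 0 := by rw [hv, ← Amp_inner_right, h3, inner_zero_right]
  have h5 : ⟪pr p v, w⟫ = 0 := by
    rw [pr_sa, hw, map_sub, pr_of_mem (pr_mem p v), sub_self, inner_zero_right]
  have h6 : ⟪w, w⟫ = 0 := by
    nth_rewrite 1 [hw]
    rw [inner_sub_left, h4, h5, sub_zero]
  exact (sub_eq_zero.1 (inner_self_eq_zero.1 h6)).symm

lemma stepD {M : Set (H₁ →L[ℂ] H₂)} {Y : T₁ →L[ℂ] T₂} {U : Set (K₁ →L[ℂ] K₂)}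
    {E : H₁ → (H₁ →L[ℂ] H₁)} (hEa : ∀ e, adjoint (E e) = E e) (hEe : ∀ e, E e e = e)
    (hME : ∀ T ∈ M, ∀ e, T ∘L E e ∈ M)
    (hC : ∀ e, Y ∘L ten ht₁ ht₁ (E e) 1 ∈ wkSpan (image2 (ten ht₁ ht₂) M U)) :
    Y ∈ wkSpan (image2 (ten ht₁ ht₂) M U) := by
  refine mem_wkSpan.2 fun ξ η hk => ?_
  set p : Submodule ℂ (L2 T₁) :=
    { carrier := {ξ | ∀ X ∈ image2 (ten ht₁ ht₂) M U, om ξ η X = 0}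
      add_mem' := fun {a b} ha hb X hX => by
        have h1 := ha X hX
        have h2 := hb X hX
        rw [om_apply] at h1 h2 ⊢
        rw [map_add, inner_add_right, h1, h2, add_zero]
      zero_mem' := fun X hX => by rw [om_apply, map_zero, inner_zero_right]
      smul_mem' := fun c a ha X hX => by
        have h1 := ha X hX
        rw [om_apply] at h1 ⊢
        rw [map_smul, inner_smul_right, h1, mul_zero] } with hp
  set η' := Amp (adjoint Y) η with hη'
  have hinv : ∀ e, ∀ x ∈ p, Amp (ten ht₁ ht₁ (E e) 1) x ∈ p := by
    rintro e x hx _ ⟨T, hT, u, hu, rfl⟩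
    rw [← om_comp_right, ten_comp]
    exact hx _ ⟨_, hME T hT e, u, hu, rfl⟩
  have h1 : ∀ e, Amp (ten ht₁ ht₁ (E e) 1) (pr p η') = 0 := by
    intro e
    have hc := pr_comm (p := p) (Amp (ten ht₁ ht₁ (E e) 1))
      (fun x hx => Submodule.le_topologicalClosure _ (hinv e x hx)) (by
        rw [Amp_adjoint, ten_sa ht₁ (hEa e)]
        exact fun x hx => Submodule.le_topologicalClosure _ (hinv e x hx))
    refine (congrArg (fun A => A η') hc).trans ?_
    refine pr_zero fun ξ hξ => ?_
    have h2 := mem_wkSpan.1 (hC e) ξ η hξ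
    rw [om_apply, Amp_comp_apply, ← Amp_inner_left] at h2
    change ⟪ξ, Amp (ten ht₁ ht₁ (E e) 1) η'⟫ = 0
    rw [← ten_sa ht₁ (hEa e), Amp_inner_right, ← inner_conj_symm, h2, map_zero]
  have h2 : pr p η' = 0 := by
    ext n
    refine ht₁.ext_vec fun x k => ?_
    change ⟪ht₁.J k x, _⟫ = ⟪_, (0 : T₁)⟫
    rw [inner_zero_right, ← adjoint_inner_right]
    set e := adjoint (ht₁.J k) ((pr p η') n) with he
    have e1 : ten ht₁ ht₁ (E e) 1 ((pr p η') n) = 0 :=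
      congrArg (fun z : L2 T₁ => z n) (h1 e)
    have e2 : E e e = 0 := by
      refine ext_inner_left ℂ fun y => ?_
      nth_rewrite 2 [he]
      rw [inner_zero_right, ← hEa, adjoint_inner_right, adjoint_inner_right]
      have := inner_ten_left ht₁ ht₁ (E e) y k ((pr p η') n) 1
      rw [e1, inner_zero_right, hEa, adj_one] at this
      exact this.symm
    rw [← hEe e, e2, inner_zero_right]
  rw [om_apply, ← Amp_inner_left]
  change ⟪η', ξ⟫ = 0
  have h3 : pr p ξ = ξ := pr_of_mem' (show ξ ∈ p from hk)
  rw [← h3, ← pr_sa, h2, inner_zero_left]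

lemma slice_S₃ (ht₃ : IsTensorEmbedding t₃) (hD₁ : IsMasa D₁) (hD₂ : IsMasa D₂) {Q : Set ((H₂ →L[ℂ] H₂) × (H₁ →L[ℂ] H₁))}
    (hQ : ∀ c ∈ Q, PD D₂ c.1 ∧ PD D₁ c.2) {Y : T₁ →L[ℂ] T₂}
    (hY : ∀ c ∈ Q, ten ht₂ ht₂ c.1 1 ∘L Y = Y ∘L ten ht₁ ht₁ c.2 1)
    {U : Set (K₁ →L[ℂ] K₂)} (hU : ∀ (c : ℂ), ∀ u ∈ U, c • u ∈ U)
    (hs : ∀ x x', adjoint (ht₂.I x') ∘L Y ∘L ht₁.I x ∈ U) :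
    Y ∈ wkSpan (image2 (ten ht₁ ht₂) (Tw Q) U) := by
  set M := Tw Q with hM
  set G : Set (H₁ →L[ℂ] H₁) := {g | PD D₁ g ∧ ∃ P, PD D₂ P ∧
    ten ht₂ ht₂ P 1 ∘L Y = Y ∘L ten ht₁ ht₁ g 1 ∧ ∀ T ∈ M, P ∘L T = T ∘L g} with hG
  have hQG : ∀ c ∈ Q, c.2 ∈ G := fun c hc => ⟨(hQ c hc).2, c.1, (hQ c hc).1, hY c hc, fun T hT => hT c hc⟩
  have h1G : (1 : H₁ →L[ℂ] H₁) ∈ G := ⟨PD.one, 1, PD.one, by rw [ten_one, ten_one, one_comp', comp_one'], fun T _ => by rw [one_comp', comp_one']⟩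
  have hmG : ∀ g ∈ G, ∀ g' ∈ G, g ∘L g' ∈ G := by
    rintro g ⟨hg, P, hP, h1, h2⟩ g' ⟨hg', P', hP', h1', h2'⟩
    refine ⟨PD.mul hD₁ hg hg', P ∘L P', PD.mul hD₂ hP hP', ?_, fun T hT => ?_⟩
    · have e1 : ten ht₂ ht₂ (P ∘L P') 1 = ten ht₂ ht₂ P 1 ∘L ten ht₂ ht₂ P' 1 := by rw [ten_comp, one_comp']
      have e2 : ten ht₁ ht₁ (g ∘L g') 1 = ten ht₁ ht₁ g 1 ∘L ten ht₁ ht₁ g' 1 := by rw [ten_comp, one_comp']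
      rw [e1, e2, comp_assoc, h1', ← comp_assoc, h1, comp_assoc]
    · rw [comp_assoc, h2' T hT, ← comp_assoc, h2 T hT, comp_assoc]
  set E : H₁ → (H₁ →L[ℂ] H₁) := fun e =>
    pr (Submodule.span ℂ ((fun g : H₁ →L[ℂ] H₁ => g e) '' G)) with hE
  have hEC : ∀ e, E e ∈ Cm G := by
    intro e g hg
    have hinv : ∀ x ∈ Submodule.span ℂ ((fun g : H₁ →L[ℂ] H₁ => g e) '' G),
        g x ∈ (Submodule.span ℂ ((fun g : H₁ →L[ℂ] H₁ => g e) '' G)).topologicalClosure := by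
      intro x hx
      apply Submodule.le_topologicalClosure
      refine Submodule.span_induction (p := fun x _ => g x ∈ Submodule.span ℂ ((fun g : H₁ →L[ℂ] H₁ => g e) '' G))
        ?_ ?_ ?_ ?_ hx
      · rintro _ ⟨g', hg', rfl⟩
        exact Submodule.subset_span ⟨g ∘L g', hmG g hg g' hg', rfl⟩
      · rw [map_zero]; exact zero_mem _
      · intro x y _ _ hx hy; rw [map_add]; exact add_mem hx hy
      · intro c x _ hx; rw [map_smul]; exact Submodule.smul_mem _ c hx
    exact (pr_comm g hinv (by rw [hg.1.2.2]; exact hinv)).symm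
  have hMz : ∀ T ∈ M, ∀ z ∈ Cm G, T ∘L z ∈ M := by
    intro T hT z hz c hc
    rw [← comp_assoc, hT c hc, comp_assoc, ← hz c.2 (hQG c hc), comp_assoc]
  have hMt : ∀ T ∈ M, ∀ S ∈ M, ∀ z ∈ Cm G, T ∘L z ∘L adjoint T ∘L S ∈ M := by
    intro T hT S hS z hz
    refine hMz T hT (z ∘L adjoint T ∘L S) fun g hg => ?_
    obtain ⟨hg', P, hP, h1, h2⟩ := id hg
    have h3 : g ∘L adjoint T = adjoint T ∘L P := by
      have := congrArg adjoint (h2 T hT)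
      rw [adjoint_comp, adjoint_comp, hP.2.2, hg'.2.2] at this
      exact this.symm
    calc (z ∘L adjoint T ∘L S) ∘L g = z ∘L adjoint T ∘L (S ∘L g) := by simp only [comp_assoc]
      _ = z ∘L (adjoint T ∘L P) ∘L S := by rw [← h2 S hS]; simp only [comp_assoc]
      _ = (z ∘L g) ∘L adjoint T ∘L S := by rw [← h3]; simp only [comp_assoc]
      _ = g ∘L z ∘L adjoint T ∘L S := by rw [hz g hg]; simp only [comp_assoc]
  have hYM : ∀ k k', adjoint (ht₂.J k) ∘L Y ∘L ht₁.J k' ∈ M := by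
    intro k k' c hc
    ext x
    refine ext_inner_left ℂ fun y => ?_
    simp only [comp_apply]
    rw [← adjoint_inner_left, (hQ c hc).1.2.2, adjoint_inner_right, adjoint_inner_right]
    have h1 : Y (ten ht₁ ht₁ c.2 1 (t₁ x k')) = ten ht₂ ht₂ c.1 1 (Y (t₁ x k')) :=
      (congrArg (fun A => A (t₁ x k')) (hY c hc)).symm
    rw [ten_apply] at h1
    change ⟪t₂ (c.1 y) k, Y (t₁ x k')⟫ = ⟪t₂ y k, Y (t₁ (c.2 x) k')⟫
    change Y (t₁ (c.2 x) k') = _ at h1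
    rw [h1, inner_ten_left, (hQ c hc).1.2.2, adj_one]; rfl
  refine stepD ht₁ ht₂ (E := E) (fun e => pr_adj _) (fun e => pr_of_mem' (Submodule.subset_span ⟨1, h1G, rfl⟩))
    (fun T hT e => hMz T hT _ (hEC e)) fun e => ?_
  refine stepC ht₁ ht₂ ht₃ hYM (pr_idem _) (pr_adj _) (fun T hT S hS => hMt T hT S hS _ (hEC e)) fun T hT => ?_
  exact stepB ht₁ ht₂ ht₃ hD₁ hD₂ (fun g hg => hg.1) (fun g hg => hg.2) hMz hU hs e rfl (hEC e) hT hT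

lemma slice_S (hD₁ : IsMasa D₁) (hD₂ : IsMasa D₂) {Q : Set ((H₂ →L[ℂ] H₂) × (H₁ →L[ℂ] H₁))}
    (hQ : ∀ c ∈ Q, PD D₂ c.1 ∧ PD D₁ c.2) {Y : T₁ →L[ℂ] T₂}
    (hY : ∀ c ∈ Q, ten ht₂ ht₂ c.1 1 ∘L Y = Y ∘L ten ht₁ ht₁ c.2 1)
    {U : Set (K₁ →L[ℂ] K₂)} (hU : ∀ (c : ℂ), ∀ u ∈ U, c • u ∈ U)
    (hs : ∀ x x', adjoint (ht₂.I x') ∘L Y ∘L ht₁.I x ∈ U) :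
    Y ∈ wkSpan (image2 (ten ht₁ ht₂) (Tw Q) U) :=
  slice_S₃ ht₁ ht₂ (exists_tensor H₁ K₂) hD₁ hD₂ hQ hY hU hs

end Slice
end OpSynth

namespace OpSynth
open Filter Topology ContinuousLinearMap InnerProductSpace

section OmTen
variable {H K : Type*} [NormedAddCommGroup H] [InnerProductSpace ℂ H] [CompleteSpace H]
  [NormedAddCommGroup K] [InnerProductSpace ℂ K] [CompleteSpace K]

lemma summ_ext {ι G : Type*} [NormedAddCommGroup G] {S : Set ι} {f : S → ℕ} (hf : Function.Injective f)
    (z : ι → G) (hz : Summable fun i => ‖z i‖ ^ 2) :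
    Summable fun n => ‖Function.extend f (fun i : S => z i) 0 n‖ ^ 2 := by
  rw [← hf.summable_iff]
  · have := hz.comp_injective (Subtype.val_injective (p := fun i => i ∈ S))
    refine this.congr fun i => ?_
    simp [Function.comp, hf.extend_apply]
  · intro n hn
    rw [Function.extend_apply' _ _ _ (by simpa using hn)]
    simp

lemma om_of_family {ι : Type*} (x : ι → H) (y : ι → K) (hx : Summable fun i => ‖x i‖ ^ 2)
    (hy : Summable fun i => ‖y i‖ ^ 2) :
    ∃ ξ η, ∀ X, om ξ η X = ∑' i, ⟪y i, X (x i)⟫ := by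
  set S := Function.support fun i => ‖x i‖ ^ 2 with hS
  haveI : Countable S := hx.countable_support
  obtain ⟨f, hf⟩ := exists_injective_nat S
  have hx' := summ_ext hf x hx
  have hy' := summ_ext hf y hy
  refine ⟨mkL2 _ hx', mkL2 _ hy', fun X => ?_⟩
  rw [om_tsum]
  have h1 : ∑' i : S, ⟪y i, X (x i)⟫ = ∑' i, ⟪y i, X (x i)⟫ := by
    refine tsum_subtype_eq_of_support_subset (f := fun i => ⟪y i, X (x i)⟫) fun i hi => ?_
    rw [hS, Function.mem_support]
    intro h
    apply hi
    have : x i = 0 := by simpa using h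
    change ⟪y i, X (x i)⟫ = 0
    rw [this, map_zero, inner_zero_right]
  rw [← h1, ← hf.tsum_eq]
  · refine tsum_congr fun i => ?_
    simp [hf.extend_apply]
  · intro n hn
    by_contra h
    apply hn
    simp only [mkL2_apply]
    rw [Function.extend_apply' _ _ _ (by simpa using h)]
    simp

variable {H₁ H₂ K₁ K₂ T₁ T₂ T₃ : Type*}
    [NormedAddCommGroup H₁] [InnerProductSpace ℂ H₁] [CompleteSpace H₁]
    [NormedAddCommGroup H₂] [InnerProductSpace ℂ H₂] [CompleteSpace H₂]
    [NormedAddCommGroup K₁] [InnerProductSpace ℂ K₁] [CompleteSpace K₁]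
    [NormedAddCommGroup K₂] [InnerProductSpace ℂ K₂] [CompleteSpace K₂]
    [NormedAddCommGroup T₁] [InnerProductSpace ℂ T₁] [CompleteSpace T₁]
    [NormedAddCommGroup T₂] [InnerProductSpace ℂ T₂] [CompleteSpace T₂]
    [NormedAddCommGroup T₃] [InnerProductSpace ℂ T₃] [CompleteSpace T₃]
    {t₁ : H₁ → K₁ → T₁} {t₂ : H₂ → K₂ → T₂} {t₃ : H₁ → K₂ → T₃}
    (ht₁ : IsTensorEmbedding t₁) (ht₂ : IsTensorEmbedding t₂)

lemma parseval {ι : Type*} (b : HilbertBasis ι ℂ H₁) (v w : T₁) :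
    HasSum (fun i => ⟪adjoint (ht₁.I (b i)) v, adjoint (ht₁.I (b i)) w⟫) ⟪v, w⟫ := by
  classical
  have hb := b.orthonormal
  have hin : ∀ i j y y', ⟪ht₁.I (b i) y, ht₁.I (b j) y'⟫ = (if i = j then 1 else 0) * ⟪y, y'⟫ := by
    intro i j y y'
    rw [ht₁.I_apply, ht₁.I_apply, ht₁.inner, orthonormal_iff_ite.1 hb]
  set V : ι → (K₁ →ₗᵢ[ℂ] T₁) := fun i => ⟨(ht₁.I (b i)).toLinearMap, fun y => by
    have h := hin i i y y
    rw [if_pos rfl, one_mul] at h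
    change ‖ht₁.I (b i) y‖ = ‖y‖
    rw [@norm_eq_sqrt_re_inner ℂ, h, ← @norm_eq_sqrt_re_inner ℂ]⟩ with hV
  have hV' : ∀ i y, V i y = ht₁.I (b i) y := fun i y => rfl
  have hO : OrthogonalFamily ℂ (fun _ : ι => K₁) V := by
    intro i j hij y y'
    rw [hV', hV', hin, if_neg hij, zero_mul]
  have hH : IsHilbertSum ℂ (fun _ : ι => K₁) V := by
    refine IsHilbertSum.mk hO ?_
    set q := ⨆ i, LinearMap.range (V i).toLinearMap with hq
    have h2 : ∀ y x, ht₁.J y x ∈ q.topologicalClosure := by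
      intro y x
      have h3 : x ∈ (Submodule.span ℂ (Set.range b)).topologicalClosure := by rw [b.dense_span]; trivial
      have h4 : ∀ z ∈ Submodule.span ℂ (Set.range b), ht₁.J y z ∈ q := by
        intro z hz
        refine Submodule.span_induction (p := fun z _ => ht₁.J y z ∈ q) ?_ ?_ ?_ ?_ hz
        · rintro _ ⟨i, rfl⟩
          refine Submodule.mem_iSup_of_mem i ⟨y, ?_⟩
          change ht₁.I (b i) y = _
          rw [ht₁.I_apply, ht₁.J_apply]
        · rw [map_zero]; exact zero_mem _
        · intro x y _ _ hx hy; rw [map_add]; exact add_mem hx hy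
        · intro c x _ hx; rw [map_smul]; exact Submodule.smul_mem _ c hx
      exact map_mem_closure (ht₁.J y).continuous h3 h4
    intro v _
    have h5 : (Submodule.span ℂ { z | ∃ x y, z = t₁ x y }).topologicalClosure ≤ q.topologicalClosure := by
      refine Submodule.topologicalClosure_minimal _ ?_ q.isClosed_topologicalClosure
      refine Submodule.span_le.2 ?_
      rintro _ ⟨x, y, rfl⟩
      rw [← ht₁.J_apply]; exact h2 y x
    rw [ht₁.2.2.2.2.2] at h5
    exact h5 trivial
  set W := hH.linearIsometryEquiv with hW
  have hWi : ∀ v i, W v i = adjoint (ht₁.I (b i)) v := by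
    intro v i
    refine ext_inner_left ℂ fun y => ?_
    rw [adjoint_inner_right]
    refine (lp.inner_single_left (𝕜 := ℂ) (G := fun _ : ι => K₁) i y (W v)).symm.trans ?_
    have : ht₁.I (b i) y = W.symm (lp.single 2 i y) := by
      rw [hW, hH.linearIsometryEquiv_symm_apply_single]; rfl
    rw [this, ← W.inner_map_map, W.apply_symm_apply]
  have := lp.hasSum_inner (𝕜 := ℂ) (G := fun _ : ι => K₁) (W v) (W w)
  rw [W.inner_map_map] at this
  have e : (fun i => ⟪adjoint (ht₁.I (b i)) v, adjoint (ht₁.I (b i)) w⟫) = fun i => ⟪W v i, W w i⟫ := by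
    funext i
    exact congrArg₂ (fun a b : K₁ => ⟪a, b⟫) (hWi v i).symm (hWi w i).symm
  rw [e]
  exact this

lemma parseval_sq {ι : Type*} (b : HilbertBasis ι ℂ H₁) (v : T₁) :
    HasSum (fun i => ‖adjoint (ht₁.I (b i)) v‖ ^ 2) (‖v‖ ^ 2) := by
  have h := parseval ht₁ b v v
  have := Complex.reCLM.hasSum h
  simp only [inner_self_eq_norm_sq_to_K] at this
  convert this using 1
  · ext i; simp [← Complex.ofReal_pow]
  · simp [← Complex.ofReal_pow]

lemma summ_sq {ι : Type*} (b : HilbertBasis ι ℂ H₁) (ξ : L2 T₁) :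
    Summable fun c : ℕ × ι => ‖adjoint (ht₁.I (b c.2)) (ξ c.1)‖ ^ 2 := by
  refine (summable_prod_of_nonneg fun _ => by positivity).2 ⟨fun n => (parseval_sq ht₁ b (ξ n)).summable, ?_⟩
  simp only [(parseval_sq ht₁ b _).tsum_eq]
  exact L2_summable ξ

lemma om_ten₃ (ht₃ : IsTensorEmbedding t₃) (T : H₁ →L[ℂ] H₂) (ξ : L2 T₁) (η : L2 T₂) :
    ∃ ξ' η', ∀ u, om ξ η (ten ht₁ ht₂ T u) = om ξ' η' u := by
  obtain ⟨w, b, -⟩ := exists_hilbertBasis ℂ H₁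
  set ζ := Amp (adjoint (ten ht₃ ht₂ T 1)) η with hζ
  obtain ⟨ξ', η', h⟩ := om_of_family _ _ (summ_sq ht₁ b ξ) (summ_sq ht₃ b ζ)
  refine ⟨ξ', η', fun u => ?_⟩
  have e1 : ten ht₁ ht₂ T u = ten ht₃ ht₂ T 1 ∘L ten ht₁ ht₃ 1 u := by
    rw [ten_comp, one_comp', comp_one']
  have e2 : ∀ i v, u (adjoint (ht₁.I (b i)) v) = adjoint (ht₃.I (b i)) (ten ht₁ ht₃ 1 u v) := by
    intro i v
    refine ext_inner_left ℂ fun k => ?_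
    rw [adjoint_inner_right, ht₃.I_apply, inner_ten_left, adj_one, ← adjoint_inner_left, adjoint_inner_right,
      ht₁.I_apply]; rfl
  rw [h, e1, om_comp_left, ← hζ, om_tsum]
  simp only [e2]
  rw [Summable.tsum_prod]
  · refine tsum_congr fun n => ?_
    exact (parseval ht₃ b _ _).tsum_eq.symm
  · have h1 := summ_sq ht₃ b ζ
    have h2 := summ_sq ht₃ b (Amp (ten ht₁ ht₃ 1 u) ξ)
    refine Summable.of_norm_bounded (h1.add h2) fun c => ?_
    refine (norm_inner_le_norm _ _).trans ?_
    change _ ≤ _ + ‖adjoint (ht₃.I (b c.2)) (ten ht₁ ht₃ 1 u (ξ c.1))‖ ^ 2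
    set p := ‖adjoint (ht₃.I (b c.2)) (ζ c.1)‖
    set q := ‖adjoint (ht₃.I (b c.2)) (ten ht₁ ht₃ 1 u (ξ c.1))‖
    nlinarith [sq_nonneg (p - q), sq_nonneg p, sq_nonneg q]

lemma ten_wkSpan {T : H₁ →L[ℂ] H₂} {G : Set (K₁ →L[ℂ] K₂)} {S : Set (T₁ →L[ℂ] T₂)}
    (h : ∀ u ∈ G, ten ht₁ ht₂ T u ∈ wkSpan S) {u : K₁ →L[ℂ] K₂} (hu : u ∈ wkSpan G) :
    ten ht₁ ht₂ T u ∈ wkSpan S := by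
  refine mem_wkSpan.2 fun ξ η hk => ?_
  obtain ⟨ξ', η', h'⟩ := om_ten₃ ht₁ ht₂ (exists_tensor H₁ K₂) T ξ η
  rw [h']
  refine mem_wkSpan.1 hu ξ' η' fun u hu => ?_
  rw [← h']
  exact mem_wkSpan.1 (h u hu) ξ η hk
end OmTen
end OpSynth

namespace OpSynth
open Filter Topology ContinuousLinearMap InnerProductSpace

section Main
variable {H₁ H₂ K₁ K₂ T₁ T₂ : Type*}
    [NormedAddCommGroup H₁] [InnerProductSpace ℂ H₁] [CompleteSpace H₁]
    [NormedAddCommGroup H₂] [InnerProductSpace ℂ H₂] [CompleteSpace H₂]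
    [NormedAddCommGroup K₁] [InnerProductSpace ℂ K₁] [CompleteSpace K₁]
    [NormedAddCommGroup K₂] [InnerProductSpace ℂ K₂] [CompleteSpace K₂]
    [NormedAddCommGroup T₁] [InnerProductSpace ℂ T₁] [CompleteSpace T₁]
    [NormedAddCommGroup T₂] [InnerProductSpace ℂ T₂] [CompleteSpace T₂]

/-- block diagonal part -/
def dg (p : T₂ →L[ℂ] T₂) (q : T₁ →L[ℂ] T₁) (Y : T₁ →L[ℂ] T₂) : T₁ →L[ℂ] T₂ :=
  p ∘L Y ∘L q + (1 - p) ∘L Y ∘L (1 - q)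

lemma dg_apply (p : T₂ →L[ℂ] T₂) (q : T₁ →L[ℂ] T₁) (Y : T₁ →L[ℂ] T₂) (x : T₁) :
    dg p q Y x = p (Y (q x)) + (Y (x - q x) - p (Y (x - q x))) := rfl

lemma dg_comm {p p' : T₂ →L[ℂ] T₂} {q q' : T₁ →L[ℂ] T₁} {Y : T₁ →L[ℂ] T₂}
    (hp : p' ∘L p = p ∘L p') (hq : q' ∘L q = q ∘L q') (h : p' ∘L Y = Y ∘L q') :
    p' ∘L dg p q Y = dg p q Y ∘L q' := by
  have hp' : ∀ x, p' (p x) = p (p' x) := fun x => congrArg (fun A => A x) hp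
  have hq' : ∀ x, q' (q x) = q (q' x) := fun x => congrArg (fun A => A x) hq
  have h' : ∀ x, p' (Y x) = Y (q' x) := fun x => congrArg (fun A => A x) h
  ext x
  change p' (dg p q Y x) = dg p q Y (q' x)
  rw [dg_apply, dg_apply, map_add, map_sub, hp', hp', h', h', hq', map_sub q', hq']

lemma dg_self {p : T₂ →L[ℂ] T₂} {q : T₁ →L[ℂ] T₁} (hp : p ∘L p = p) (hq : q ∘L q = q)
    (Y : T₁ →L[ℂ] T₂) : p ∘L dg p q Y = dg p q Y ∘L q := by
  have hp' : ∀ x, p (p x) = p x := fun x => congrArg (fun A => A x) hp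
  have hq' : ∀ x, q (q x) = q x := fun x => congrArg (fun A => A x) hq
  ext x
  change p (dg p q Y x) = dg p q Y (q x)
  rw [dg_apply, dg_apply, hq', sub_self, map_zero, map_zero, sub_zero, add_zero, map_add, map_sub, hp', hp',
    sub_self, add_zero]

lemma dg_sub (p : T₂ →L[ℂ] T₂) (q : T₁ →L[ℂ] T₁) (Y : T₁ →L[ℂ] T₂) :
    Y - dg p q Y = p ∘L Y ∘L (1 - q) + (1 - p) ∘L Y ∘L q := by
  ext x
  change Y x - dg p q Y x = p (Y (x - q x)) + (Y (q x) - p (Y (q x)))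
  rw [dg_apply, map_sub Y]
  abel

variable {D₁ : StarSubalgebra ℂ (H₁ →L[ℂ] H₁)} {D₂ : StarSubalgebra ℂ (H₂ →L[ℂ] H₂)}
    {t₁ : H₁ → K₁ → T₁} {t₂ : H₂ → K₂ → T₂}
    (ht₁ : IsTensorEmbedding t₁) (ht₂ : IsTensorEmbedding t₂)

lemma ten_cc (hD₁ : IsMasa D₁) {P P' : H₁ →L[ℂ] H₁} (h : PD D₁ P) (h' : PD D₁ P') :
    ten ht₁ ht₁ P 1 ∘L ten ht₁ ht₁ P' 1 = ten ht₁ ht₁ P' 1 ∘L ten ht₁ ht₁ P 1 := by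
  have e : P ∘L P' = P' ∘L P := hD₁.1 P h.1 P' h'.1
  rw [ten_comp, ten_comp, e]

/-- generators -/
def Gn {r : ℕ} (M : Set (H₁ →L[ℂ] H₂)) (U : Set (K₁ →L[ℂ] K₂)) (Bs : Fin r → Set (H₁ →L[ℂ] H₂))
    (Us : Fin r → Set (K₁ →L[ℂ] K₂)) : Set (T₁ →L[ℂ] T₂) :=
  image2 (ten ht₁ ht₂) M U ∪ ⋃ a, image2 (ten ht₁ ht₂) (Bs a) (Us a)

lemma Gn_mono {r : ℕ} {M M' : Set (H₁ →L[ℂ] H₂)} (h : M ⊆ M') (U : Set (K₁ →L[ℂ] K₂))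
    (Bs : Fin r → Set (H₁ →L[ℂ] H₂)) (Us : Fin r → Set (K₁ →L[ℂ] K₂)) :
    Gn ht₁ ht₂ M U Bs Us ⊆ Gn ht₁ ht₂ M' U Bs Us :=
  union_subset_union_left _ (image2_subset_right h)

lemma Gn_comp {r : ℕ} {M M' : Set (H₁ →L[ℂ] H₂)} {U : Set (K₁ →L[ℂ] K₂)}
    {Bs : Fin r → Set (H₁ →L[ℂ] H₂)} {Us : Fin r → Set (K₁ →L[ℂ] K₂)}
    {P : H₂ →L[ℂ] H₂} {Q : H₁ →L[ℂ] H₁} (h : ∀ S ∈ M, P ∘L S ∘L Q ∈ M' ∨ P ∘L S ∘L Q = 0)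
    (hB : ∀ a, ∀ S ∈ Bs a, P ∘L S ∘L Q ∈ Bs a) {X : T₁ →L[ℂ] T₂} (hX : X ∈ wkSpan (Gn ht₁ ht₂ M U Bs Us)) :
    ten ht₂ ht₂ P 1 ∘L X ∘L ten ht₁ ht₁ Q 1 ∈ wkSpan (Gn ht₁ ht₂ M' U Bs Us) := by
  have e : ∀ S u, ten ht₂ ht₂ P 1 ∘L ten ht₁ ht₂ S u ∘L ten ht₁ ht₁ Q 1 = ten ht₁ ht₂ (P ∘L S ∘L Q) u := by
    intro S u
    rw [ten_comp, ten_comp, one_comp', comp_one']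
  refine wkSpan_comp _ _ ?_ hX
  rintro _ (⟨S, hS, u, hu, rfl⟩ | hh)
  · rw [e]
    rcases h S hS with h | h
    · exact subset_wkSpan _ (Or.inl ⟨_, h, u, hu, rfl⟩)
    · rw [h, ten_zero_left]; exact zero_mem _
  · obtain ⟨a, S, hS, u, hu, rfl⟩ := mem_iUnion.1 hh
    rw [e]
    exact subset_wkSpan _ (Or.inr (mem_iUnion.2 ⟨a, _, hB a S hS, u, hu, rfl⟩))

/-- the finite/compactness step -/
lemma limit_step (hD₁ : IsMasa D₁) (hD₂ : IsMasa D₂) {S : Set (T₁ →L[ℂ] T₂)}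
    {Q : Set ((H₂ →L[ℂ] H₂) × (H₁ →L[ℂ] H₁))} (hQ : ∀ c ∈ Q, PD D₂ c.1 ∧ PD D₁ c.2)
    (Q₀ : Set ((H₂ →L[ℂ] H₂) × (H₁ →L[ℂ] H₁))) (hQ₀ : ∀ c ∈ Q₀, PD D₂ c.1 ∧ PD D₁ c.2) (hQQ : Q₀ ⊆ Q)
    (hne : Q.Nonempty) {X : T₁ →L[ℂ] T₂}
    (hX : ∀ c ∈ Q₀, ten ht₂ ht₂ c.1 1 ∘L X = X ∘L ten ht₁ ht₁ c.2 1)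
    (hS : ∀ Y, X - Y ∈ wkSpan S → (∀ c ∈ Q₀, ten ht₂ ht₂ c.1 1 ∘L Y = Y ∘L ten ht₁ ht₁ c.2 1) →
      ∀ c ∈ Q, ten ht₂ ht₂ c.1 1 ∘L Y ∘L ten ht₁ ht₁ (1 - c.2) 1 ∈ wkSpan S ∧
        ten ht₂ ht₂ (1 - c.1) 1 ∘L Y ∘L ten ht₁ ht₁ c.2 1 ∈ wkSpan S) :
    ∃ Y, X - Y ∈ wkSpan S ∧ ∀ c ∈ Q, ten ht₂ ht₂ c.1 1 ∘L Y = Y ∘L ten ht₁ ht₁ c.2 1 := by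
  classical
  obtain ⟨c₀, hc₀⟩ := hne
  obtain ⟨F, Y, hF, -, hlim⟩ := fip_limit (ι := Q) (fun c => {Y | ‖Y‖ ≤ ‖X‖ ∧ X - Y ∈ wkSpan S ∧
      ten ht₂ ht₂ c.1.1 1 ∘L Y = Y ∘L ten ht₁ ht₁ c.1.2 1}) ‖X‖ ⟨⟨c₀, hc₀⟩, fun Y hY => hY.1⟩ (by
    intro s
    suffices h : ∃ Y, ‖Y‖ ≤ ‖X‖ ∧ X - Y ∈ wkSpan S ∧
        (∀ c ∈ Q₀, ten ht₂ ht₂ c.1 1 ∘L Y = Y ∘L ten ht₁ ht₁ c.2 1) ∧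
        ∀ c ∈ s, ten ht₂ ht₂ c.1.1 1 ∘L Y = Y ∘L ten ht₁ ht₁ c.1.2 1 by
      obtain ⟨Y, h1, h2, h3, h4⟩ := h
      exact ⟨Y, fun c hc => ⟨h1, h2, h4 c hc⟩⟩
    induction s using Finset.induction_on with
    | empty => exact ⟨X, le_rfl, by rw [sub_self]; exact zero_mem _, hX, by simp⟩
    | insert c s _ ih =>
      obtain ⟨Y, h1, h2, h3, h4⟩ := ih
      obtain ⟨hc2, hc1⟩ := hQ c.1 c.2
      refine ⟨dg (ten ht₂ ht₂ c.1.1 1) (ten ht₁ ht₁ c.1.2 1) Y, ?_, ?_, ?_, ?_⟩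
      · exact norm_diag (ten_idem ht₁ hc1.2.1) (ten_sa ht₁ hc1.2.2) (ten_idem ht₂ hc2.2.1)
          (ten_sa ht₂ hc2.2.2) h1 h1
      · have h5 := hS Y h2 h3 c.1 c.2
        rw [ten_compl, ten_compl] at h5
        have h6 := add_mem h2 (add_mem h5.1 h5.2)
        rw [← dg_sub, sub_add_sub_cancel] at h6
        exact h6
      · intro c' hc'
        exact dg_comm (ten_cc ht₂ hD₂ (hQ₀ c' hc').1 hc2) (ten_cc ht₁ hD₁ (hQ₀ c' hc').2 hc1) (h3 c' hc')
      · intro c' hc'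
        rcases Finset.mem_insert.1 hc' with rfl | hc'
        · exact dg_self (ten_idem ht₂ hc2.2.1) (ten_idem ht₁ hc1.2.1) Y
        · exact dg_comm (ten_cc ht₂ hD₂ (hQ c'.1 c'.2).1 hc2) (ten_cc ht₁ hD₁ (hQ c'.1 c'.2).2 hc1) (h4 c' hc'))
  refine ⟨Y, mem_wkSpan.2 fun ξ η hk => ?_, fun c hc => ?_⟩
  · rw [map_sub, sub_eq_zero]
    refine tendsto_nhds_unique (Tendsto.congr' ?_ tendsto_const_nhds) (hlim ξ η)
    filter_upwards [hF ⟨c₀, hc₀⟩] with Z hZ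
    have := mem_wkSpan.1 hZ.2.1 ξ η hk
    rwa [map_sub, sub_eq_zero] at this
  · exact limit_comm hlim _ _ (mem_of_superset (hF ⟨c, hc⟩) fun Z hZ => hZ.2.2)

lemma main_ind (hD₁ : IsMasa D₁) (hD₂ : IsMasa D₂) {r : ℕ} {Bs : Fin r → Set (H₁ →L[ℂ] H₂)}
    {J : Type*} [DecidableEq J] (V : J → Set (H₁ →L[ℂ] H₂)) (al : J → Fin r)
    (hBV : ∀ a S, S ∈ Bs a ↔ ∀ j, al j = a → S ∈ V j)
    (hVb : ∀ j, ∀ X ∈ V j, ∀ A ∈ D₁, ∀ B ∈ D₂, B ∘L X ∘L A ∈ V j)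
    (hVn : ∀ j, ∃ C : Set ((H₂ →L[ℂ] H₂) × (H₁ →L[ℂ] H₁)), (∀ c ∈ C, PD D₂ c.1 ∧ PD D₁ c.2 ∧
      (∀ X ∈ V j, (1 - c.1) ∘L X ∘L c.2 = 0) ∧ ∀ X, c.1 ∘L X ∘L (1 - c.2) ∈ V j) ∧
      ∀ T, (∀ c ∈ C, c.1 ∘L T = T ∘L c.2) → T ∈ V j)
    {U : Set (K₁ →L[ℂ] K₂)} {Us : Fin r → Set (K₁ →L[ℂ] K₂)}
    {R : ℕ → Set (H₁ →L[ℂ] H₂)}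
    (hRb : ∀ i, ∀ X ∈ R i, ∀ A ∈ D₁, ∀ B ∈ D₂, B ∘L X ∘L A ∈ R i)
    (hR : ∀ i X, (∀ c ∈ CP D₁ D₂ (R i), c.1 ∘L X = X ∘L c.2) → X ∈ R i) (u : Finset J) :
    ∀ P₀ Q₀, PD D₂ P₀ → PD D₁ Q₀ →
      (∀ j ∉ u, (∀ X, P₀ ∘L X ∘L Q₀ ∈ V j) ∨ ∀ X ∈ V j, P₀ ∘L X ∘L Q₀ = 0) →
      ∀ X, (∀ i, X ∈ wkSpan (Gn ht₁ ht₂ (R i) U Bs Us)) →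
        ten ht₂ ht₂ P₀ 1 ∘L X ∘L ten ht₁ ht₁ Q₀ 1 ∈ wkSpan (Gn ht₁ ht₂ (⋂ i, R i) U Bs Us) := by
  have hBb : ∀ a, ∀ X ∈ Bs a, ∀ A ∈ D₁, ∀ B ∈ D₂, B ∘L X ∘L A ∈ Bs a := by
    intro a X hX A hA B hB
    exact (hBV a _).2 fun j hj => hVb j X ((hBV a X).1 hX j hj) A hA B hB
  choose C hC hCV using hVn
  induction u using Finset.strongInduction with
  | H u ih =>
  intro P₀ Q₀ hP₀ hQ₀ hdec X' hX'
  set W := Gn ht₁ ht₂ (⋂ i, R i) U Bs Us with hW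
  have hWi : ∀ i, wkSpan W ≤ wkSpan (Gn ht₁ ht₂ (R i) U Bs Us) := fun i =>
    wkSpan_mono (Gn_mono ht₁ ht₂ (iInter_subset _ i) U Bs Us)
  set X := ten ht₂ ht₂ P₀ 1 ∘L X' ∘L ten ht₁ ht₁ Q₀ 1 with hXdef
  have hX : ∀ i, X ∈ wkSpan (Gn ht₁ ht₂ (R i) U Bs Us) := fun i =>
    Gn_comp ht₁ ht₂ (fun S hS => Or.inl (hRb i S hS Q₀ hQ₀.1 P₀ hP₀.1))
      (fun a S hS => hBb a S hS Q₀ hQ₀.1 P₀ hP₀.1) (hX' i)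
  have hXP : ten ht₂ ht₂ P₀ 1 ∘L X = X := by
    rw [hXdef, ← comp_assoc, ten_idem ht₂ hP₀.2.1]
  have hXQ : X ∘L ten ht₁ ht₁ Q₀ 1 = X := by
    rw [hXdef, comp_assoc, comp_assoc, ten_idem ht₁ hQ₀.2.1]
  clear_value X
  clear hXdef hX'
  set Q : Set ((H₂ →L[ℂ] H₂) × (H₁ →L[ℂ] H₁)) := {c | PD D₂ c.1 ∧ PD D₁ c.2 ∧
    ∀ Y, (∀ i, Y ∈ wkSpan (Gn ht₁ ht₂ (R i) U Bs Us)) → ten ht₂ ht₂ P₀ 1 ∘L Y = Y →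
      Y ∘L ten ht₁ ht₁ Q₀ 1 = Y →
      ten ht₂ ht₂ c.1 1 ∘L Y ∘L ten ht₁ ht₁ (1 - c.2) 1 ∈ wkSpan W ∧
        ten ht₂ ht₂ (1 - c.1) 1 ∘L Y ∘L ten ht₁ ht₁ c.2 1 ∈ wkSpan W} with hQdef
  have hcP : (P₀, (1 : H₁ →L[ℂ] H₁)) ∈ Q := by
    refine ⟨hP₀, PD.one, fun Y _ hYP _ => ⟨?_, ?_⟩⟩
    · rw [sub_self, ten_zero_left, comp_zero, comp_zero]; exact zero_mem _
    · rw [ten_compl, ten_one, comp_one', sub_comp, hYP, one_comp', sub_self]; exact zero_mem _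
  have hcQ : ((1 : H₂ →L[ℂ] H₂), Q₀) ∈ Q := by
    refine ⟨PD.one, hQ₀, fun Y _ _ hYQ => ⟨?_, ?_⟩⟩
    · rw [ten_compl, comp_sub, hYQ, comp_one', sub_self, comp_zero]; exact zero_mem _
    · rw [sub_self, ten_zero_left, zero_comp]; exact zero_mem _
  have hCP : ∀ i, CP D₁ D₂ (R i) ⊆ Q := by
    rintro i c ⟨h1, h2, h3⟩
    refine ⟨h1, h2, fun Y hY _ _ => ⟨?_, ?_⟩⟩
    · refine Gn_comp ht₁ ht₂ (fun S hS => Or.inr ?_) (fun a S hS => hBb a S hS _ h2.compl.1 _ h1.1) (hY i)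
      rw [← comp_assoc, h3 S hS, comp_assoc, comp_sub, h2.2.1, comp_one', sub_self, comp_zero]
    · refine Gn_comp ht₁ ht₂ (fun S hS => Or.inr ?_) (fun a S hS => hBb a S hS _ h2.1 _ h1.compl.1) (hY i)
      rw [← h3 S hS, ← comp_assoc, sub_comp, h1.2.1, one_comp', sub_self, zero_comp]
  have hCj : ∀ j ∈ u, C j ⊆ Q := by
    intro j hj c hc
    obtain ⟨h1, h2, h3, h4⟩ := hC j c hc
    have key : ∀ P' Q', PD D₂ P' → PD D₁ Q' → ((∀ X, P' ∘L X ∘L Q' ∈ V j) ∨ ∀ X ∈ V j, P' ∘L X ∘L Q' = 0) →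
        ∀ Y, (∀ i, Y ∈ wkSpan (Gn ht₁ ht₂ (R i) U Bs Us)) → ten ht₂ ht₂ P₀ 1 ∘L Y = Y →
          Y ∘L ten ht₁ ht₁ Q₀ 1 = Y → ten ht₂ ht₂ P' 1 ∘L Y ∘L ten ht₁ ht₁ Q' 1 ∈ wkSpan W := by
      intro P' Q' hP' hQ' hj' Y hY hYP hYQ
      have e : ∀ Z : H₁ →L[ℂ] H₂, (P' ∘L P₀) ∘L Z ∘L (Q₀ ∘L Q') = P' ∘L (P₀ ∘L Z ∘L Q₀) ∘L Q' := by
        intro Z; simp only [comp_assoc]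
      have := ih (u.erase j) (Finset.erase_ssubset hj) (P' ∘L P₀) (Q₀ ∘L Q') (PD.mul hD₂ hP' hP₀)
        (PD.mul hD₁ hQ₀ hQ') (by
          intro k hk
          by_cases hkj : k = j
          · subst hkj
            rcases hj' with h | h
            · left; intro Z; rw [e]; exact h _
            · right; intro Z hZ; rw [e]; exact h _ (hVb k Z hZ Q₀ hQ₀.1 P₀ hP₀.1)
          · have hku : k ∉ u := fun h => hk (Finset.mem_erase.2 ⟨hkj, h⟩)
            rcases hdec k hku with h | h
            · left; intro Z; rw [e]; exact hVb k _ (h Z) Q' hQ'.1 P' hP'.1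
            · right; intro Z hZ; rw [e, h Z hZ, zero_comp, comp_zero]) Y hY
      have e2 : ten ht₂ ht₂ (P' ∘L P₀) 1 = ten ht₂ ht₂ P' 1 ∘L ten ht₂ ht₂ P₀ 1 := by
        rw [ten_comp, one_comp']
      have e3 : ten ht₁ ht₁ (Q₀ ∘L Q') 1 = ten ht₁ ht₁ Q₀ 1 ∘L ten ht₁ ht₁ Q' 1 := by
        rw [ten_comp, one_comp']
      rw [e2, e3, ← comp_assoc Y, hYQ, comp_assoc, ← comp_assoc _ Y, hYP] at this
      exact this
    refine ⟨h1, h2, fun Y hY hYP hYQ => ⟨?_, ?_⟩⟩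
    · exact key _ _ h1 h2.compl (Or.inl h4) Y hY hYP hYQ
    · exact key _ _ h1.compl h2 (Or.inr h3) Y hY hYP hYQ
  obtain ⟨Y, hXY, hYc⟩ := limit_step ht₁ ht₂ hD₁ hD₂ (S := W) (Q := Q) (fun c hc => ⟨hc.1, hc.2.1⟩)
    {(P₀, (1 : H₁ →L[ℂ] H₁)), ((1 : H₂ →L[ℂ] H₂), Q₀)} (by
      rintro c (rfl | rfl)
      · exact ⟨hP₀, PD.one⟩
      · exact ⟨PD.one, hQ₀⟩) (by
      rintro c (rfl | rfl)
      · exact hcP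
      · exact hcQ) ⟨_, hcP⟩ (X := X) (by
      rintro c (rfl | rfl)
      · change ten ht₂ ht₂ P₀ 1 ∘L X = X ∘L ten ht₁ ht₁ 1 1
        rw [ten_one, comp_one', hXP]
      · change ten ht₂ ht₂ 1 1 ∘L X = X ∘L ten ht₁ ht₁ Q₀ 1
        rw [ten_one, one_comp', hXQ]) (by
      intro Y hY hYc c hc
      refine hc.2.2 Y (fun i => ?_) ?_ ?_
      · have := sub_mem (hX i) (hWi i hY)
        rwa [sub_sub_cancel] at this
      · have := hYc _ (Or.inl rfl)
        rwa [ten_one, comp_one'] at this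
      · have := hYc _ (Or.inr rfl)
        rw [ten_one, one_comp'] at this
        exact this.symm)
  have hYi : ∀ i, Y ∈ wkSpan (Gn ht₁ ht₂ (R i) U Bs Us) := fun i => by
    have := sub_mem (hX i) (hWi i hXY)
    rwa [sub_sub_cancel] at this
  have hYP : ten ht₂ ht₂ P₀ 1 ∘L Y = Y := by
    have := hYc _ hcP
    rwa [ten_one, comp_one'] at this
  have hYQ : Y ∘L ten ht₁ ht₁ Q₀ 1 = Y := by
    have := hYc _ hcQ
    rw [ten_one, one_comp'] at this
    exact this.symm
  suffices hY : Y ∈ wkSpan W by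
    have := add_mem hXY hY
    rwa [sub_add_cancel] at this
  set Ug : Set (K₁ →L[ℂ] K₂) := U ∪ ⋃ a, {v | v ∈ Us a ∧ ∀ j, al j = a → j ∉ u → ∀ Z, P₀ ∘L Z ∘L Q₀ ∈ V j}
    with hUg
  have hsl : ∀ x x', adjoint (ht₂.I x') ∘L Y ∘L ht₁.I x ∈ (wkSpan Ug : Set (K₁ →L[ℂ] K₂)) := by
    intro x x'
    have e0 : adjoint (ht₂.I x') ∘L Y ∘L ht₁.I x =
        (adjoint (ht₂.I x') ∘L ten ht₂ ht₂ P₀ 1) ∘L Y ∘L (ten ht₁ ht₁ Q₀ 1 ∘L ht₁.I x) := by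
      rw [← comp_assoc Y, hYQ, comp_assoc (adjoint (ht₂.I x')), ← comp_assoc (ten ht₂ ht₂ P₀ 1) Y, hYP]
    rw [e0]
    have e : ∀ S v, (adjoint (ht₂.I x') ∘L ten ht₂ ht₂ P₀ 1) ∘L ten ht₁ ht₂ S v ∘L (ten ht₁ ht₁ Q₀ 1 ∘L ht₁.I x) =
        ⟪x', (P₀ ∘L S ∘L Q₀) x⟫ • v := by
      intro S v
      rw [← slI_ten ht₁ ht₂, comp_assoc, ← comp_assoc _ (ten ht₁ ht₁ Q₀ 1), ten_comp, ← comp_assoc _ _ (ht₁.I x), ten_comp,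
        one_comp', comp_one']
    refine wkSpan_comp _ _ ?_ (hYi 0)
    rintro _ (⟨S, hS, v, hv, rfl⟩ | hh)
    · rw [e]
      exact Submodule.smul_mem _ _ (subset_wkSpan _ (Or.inl hv))
    · obtain ⟨a, S, hS, v, hv, rfl⟩ := mem_iUnion.1 hh
      rw [e]
      by_cases hact : ∀ j, al j = a → j ∉ u → ∀ Z, P₀ ∘L Z ∘L Q₀ ∈ V j
      · exact Submodule.smul_mem _ _ (subset_wkSpan _ (Or.inr (mem_iUnion.2 ⟨a, hv, hact⟩)))
      · push Not at hact
        obtain ⟨j, hja, hju, Z, hZ⟩ := hact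
        rcases hdec j hju with h | h
        · exact absurd (h Z) hZ
        · rw [h S ((hBV a S).1 hS j hja), zero_apply, inner_zero_right, zero_smul]; exact zero_mem _
  have hfin := slice_S ht₁ ht₂ hD₁ hD₂ (Q := Q) (fun c hc => ⟨hc.1, hc.2.1⟩) hYc
    (U := (wkSpan Ug : Set (K₁ →L[ℂ] K₂))) (fun c v hv => Submodule.smul_mem _ c hv) hsl
  refine wkSpan_le ?_ hfin
  rintro _ ⟨T, hT, v, hv, rfl⟩
  refine ten_wkSpan ht₁ ht₂ ?_ hv
  have hTP : P₀ ∘L T ∘L Q₀ = T := by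
    have h1 := hT _ hcP
    have h2 := hT _ hcQ
    change P₀ ∘L T = T ∘L 1 at h1
    change 1 ∘L T = T ∘L Q₀ at h2
    rw [← h2, one_comp', h1, comp_one']
  rintro v (hv | hv)
  · refine subset_wkSpan _ (Or.inl ⟨T, mem_iInter.2 fun i => hR i T fun c hc => hT c (hCP i hc), v, hv, rfl⟩)
  · obtain ⟨a, hv, hact⟩ := mem_iUnion.1 hv
    refine subset_wkSpan _ (Or.inr (mem_iUnion.2 ⟨a, T, (hBV a T).2 fun j hj => ?_, v, hv, rfl⟩))
    by_cases hju : j ∈ u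
    · exact hCV j T fun c hc => hT c (hCj j hju hc)
    · rw [← hTP]; exact hact j hj hju T

lemma final_incl (hD₁ : IsMasa D₁) (hD₂ : IsMasa D₂) {r : ℕ} {Bs : Fin r → Set (H₁ →L[ℂ] H₂)}
    (hBs : ∀ i, HasFiniteWidth D₁ D₂ (Bs i)) {U : Set (K₁ →L[ℂ] K₂)} {Us : Fin r → Set (K₁ →L[ℂ] K₂)}
    {ψ : ℕ → (H₁ →L[ℂ] H₂) → (H₁ →L[ℂ] H₂)}
    (hψ : ∀ i, IsSchurIdempotent D₁ D₂ (ψ i)) (hcontr : ∀ i X, ‖ψ i X‖ ≤ ‖X‖) (X : T₁ →L[ℂ] T₂)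
    (hX : ∀ i, X ∈ wkSpan (Gn ht₁ ht₂ (range (ψ i)) U Bs Us)) :
    X ∈ wkSpan (Gn ht₁ ht₂ (⋂ i, range (ψ i)) U Bs Us) := by
  classical
  choose k Vs hVs hBV using hBs
  have h := main_ind ht₁ ht₂ hD₁ hD₂ (Bs := Bs) (J := Σ a, Fin (k a)) (fun j => Vs j.1 j.2) (fun j => j.1)
    (by
      intro a S
      rw [hBV a, mem_iInter]
      constructor
      · rintro h ⟨a', l⟩ rfl; exact h l
      · intro h l; exact h ⟨a, l⟩ rfl)
    (fun j => (hVs j.1 j.2).1.2) (fun j => nest_pairs hD₁ hD₂ (hVs j.1 j.2).1 (hVs j.1 j.2).2)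
    (U := U) (Us := Us) (R := fun i => range (ψ i))
    (by
      rintro i _ ⟨Z, rfl⟩ A hA B hB
      exact ⟨_, (hψ i).2.2.2.2 Z A hA B hB⟩)
    (by
      intro i Z hZ
      obtain ⟨h1, h2, -, h4, h5⟩ := hψ i
      have hBI : BI D₁ D₂ (h1.mk' (ψ i)) :=
        ⟨fun ξ η => pre_comp_wk h1 h2 ξ η, fun X => congrFun h4 X, fun X A hA B hB => h5 X A hA B hB⟩
      exact ⟨Z, schur_struct hD₁ hD₂ hBI (hcontr i) hZ⟩)
    Finset.univ 1 1 PD.one PD.one (fun j hj => absurd (Finset.mem_univ j) hj) X hX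
  rwa [ten_one, ten_one, one_comp', comp_one'] at h

end Main
end OpSynth

/-- Proposition 4.1 (v), `mazi` (v). -/
theorem statement7
    {H₁ H₂ K₁ K₂ T₁ T₂ : Type*}
    [NormedAddCommGroup H₁] [InnerProductSpace ℂ H₁] [CompleteSpace H₁]
    [NormedAddCommGroup H₂] [InnerProductSpace ℂ H₂] [CompleteSpace H₂]
    [NormedAddCommGroup K₁] [InnerProductSpace ℂ K₁] [CompleteSpace K₁]
    [NormedAddCommGroup K₂] [InnerProductSpace ℂ K₂] [CompleteSpace K₂]
    [NormedAddCommGroup T₁] [InnerProductSpace ℂ T₁] [CompleteSpace T₁]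
    [NormedAddCommGroup T₂] [InnerProductSpace ℂ T₂] [CompleteSpace T₂]
    [TopologicalSpace.SeparableSpace H₁] [TopologicalSpace.SeparableSpace H₂]
    (D₁ : StarSubalgebra ℂ (H₁ →L[ℂ] H₁)) (D₂ : StarSubalgebra ℂ (H₂ →L[ℂ] H₂))
    (hD₁ : IsMasa D₁) (hD₂ : IsMasa D₂)
    {r : ℕ} (Bs : Fin r → Set (H₁ →L[ℂ] H₂))
    (hBs : ∀ i, HasFiniteWidth D₁ D₂ (Bs i))
    (U : Set (K₁ →L[ℂ] K₂)) (Us : Fin r → Set (K₁ →L[ℂ] K₂))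
    (hU : IsWkClosedSubspace U) (hUs : ∀ i, IsWkClosedSubspace (Us i))
    (t₁ : H₁ → K₁ → T₁) (t₂ : H₂ → K₂ → T₂)
    (ht₁ : IsTensorEmbedding t₁) (ht₂ : IsTensorEmbedding t₂)
    (ψ : ℕ → (H₁ →L[ℂ] H₂) → (H₁ →L[ℂ] H₂))
    (hψ : ∀ i, IsSchurIdempotent D₁ D₂ (ψ i))
    (hcontr : ∀ i X, ‖ψ i X‖ ≤ ‖X‖)
    (hnested : ∀ i, Set.range (ψ (i + 1)) ⊆ Set.range (ψ i)) :
    (⋂ i : ℕ, wkClosure (wTensor t₁ t₂ (Set.range (ψ i)) U +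
        setSum fun j => wTensor t₁ t₂ (Bs j) (Us j))) =
      wkClosure (wTensor t₁ t₂ (⋂ i : ℕ, Set.range (ψ i)) U +
        setSum fun j => wTensor t₁ t₂ (Bs j) (Us j)) := by
  have key : ∀ M : Set (H₁ →L[ℂ] H₂), wkClosure (wTensor t₁ t₂ M U + setSum fun j => wTensor t₁ t₂ (Bs j) (Us j))
      = ↑(wkSpan (Gn ht₁ ht₂ M U Bs Us)) := by
    intro M
    simp only [wTensor_eq ht₁ ht₂]
    exact setSum_wkSpan _ _
  simp only [key]
  apply Subset.antisymm
  · intro X hX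
    exact final_incl ht₁ ht₂ hD₁ hD₂ hBs hψ hcontr X (fun i => mem_iInter.1 hX i)
  · exact subset_iInter fun i => wkSpan_mono (Gn_mono ht₁ ht₂ (iInter_subset _ i) U Bs Us)
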